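/- Let (R, m) be a commutative Noetherian local ring and let C be a semidualizing R-module. Then the following are equivalent: (i) C is a dualizing R-module; (ii) G_C-injective dimension Gid_C(H^n_𝔞(R)) is finite for all proper ideals 𝔞 of R such that R is relative Cohen-Macaulay with respect to 𝔞 with ht_R 𝔞 = n; (iii) Gid_C(H^n_𝔞(R)) is finite for some proper ideal 𝔞 of R such that R is relative Cohen-Macaulay with respect to 𝔞 with ht_R 𝔞 = n. -/

import Mathlib

/-!
Definitions needed to state results of "On flat and Gorenstein flat dimensions of
local cohomology modules" by M.R. Zargar and H. Zakeri.
-/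

open CategoryTheory IsLocalRing

universe u

namespace Paper

variable (R : Type u) [CommRing R]

/-! ## Resolution/coresolution dimensions with respect to a class of modules -/

/-- `ResDimLE R P n M` : `M` admits a resolution `0 → Xₙ → ⋯ → X₀ → M → 0`
with each `Xᵢ` in the class `P`. -/
def ResDimLE (P : ModuleCat.{u} R → Prop) : ℕ → ModuleCat.{u} R → Prop
  | 0, M => P M
  | n + 1, M => ResDimLE P n M ∨
      ∃ (X : ModuleCat.{u} R) (f : X →ₗ[R] M), P X ∧ Function.Surjective f ∧
        ResDimLE P n (ModuleCat.of R (LinearMap.ker f))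

/-- `CoresDimLE R P n M` : `M` admits a coresolution `0 → M → X₀ → ⋯ → Xₙ → 0`
with each `Xᵢ` in the class `P`. -/
def CoresDimLE (P : ModuleCat.{u} R → Prop) : ℕ → ModuleCat.{u} R → Prop
  | 0, M => P M
  | n + 1, M => CoresDimLE P n M ∨
      ∃ (X : ModuleCat.{u} R) (f : M →ₗ[R] X), P X ∧ Function.Injective f ∧
        CoresDimLE P n (ModuleCat.of R (X ⧸ LinearMap.range f))

/-- The resolution dimension of `M` with respect to the class `P`, as an
extended natural number (`⊤` if there is no finite resolution). -/
noncomputable def ResDim (P : ModuleCat.{u} R → Prop) (M : ModuleCat.{u} R) : ℕ∞ :=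
  sInf {n : ℕ∞ | ∃ k : ℕ, (k : ℕ∞) = n ∧ ResDimLE R P k M}

/-- The coresolution dimension of `M` with respect to the class `P`. -/
noncomputable def CoresDim (P : ModuleCat.{u} R → Prop) (M : ModuleCat.{u} R) : ℕ∞ :=
  sInf {n : ℕ∞ | ∃ k : ℕ, (k : ℕ∞) = n ∧ CoresDimLE R P k M}

/-- Flat dimension `fd_R M`. -/
noncomputable def flatDim (M : Type u) [AddCommGroup M] [Module R M] : ℕ∞ :=
  ResDim R (fun N => Module.Flat R N) (ModuleCat.of R M)

/-- Projective dimension `pd_R M`. -/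
noncomputable def projDim (M : Type u) [AddCommGroup M] [Module R M] : ℕ∞ :=
  ResDim R (fun N => Module.Projective R N) (ModuleCat.of R M)

/-- Injective dimension `id_R M`. -/
noncomputable def injDim (M : Type u) [AddCommGroup M] [Module R M] : ℕ∞ :=
  CoresDim R (fun N => Module.Injective R N) (ModuleCat.of R M)

/-! ## Local cohomology -/

/-- The local cohomology module `H^i_𝔞(M)`, as an object of `ModuleCat R`. -/
noncomputable def lcoh (𝔞 : Ideal R) (i : ℕ) (M : Type u) [AddCommGroup M] [Module R M] :
    ModuleCat.{u} R :=
  (localCohomology 𝔞 i).obj (ModuleCat.of R M)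

/-- `M` is relative Cohen-Macaulay with respect to `𝔞` with `ht_M 𝔞 = n`, i.e. the
`n`-th local cohomology of `M` with respect to `𝔞` is the only non-vanishing one. -/
def IsRelCM (𝔞 : Ideal R) (n : ℕ) (M : Type u) [AddCommGroup M] [Module R M] : Prop :=
  (∀ i : ℕ, i ≠ n → Subsingleton (lcoh R 𝔞 i M)) ∧ ¬ Subsingleton (lcoh R 𝔞 n M)

/-! ## Depth, dimension, Cohen-Macaulay -/

/-- The depth of a module over a local ring: the supremum of the lengths of
`M`-regular sequences contained in the maximal ideal. -/
noncomputable def depth [IsLocalRing R] (M : Type u) [AddCommGroup M] [Module R M] : ℕ∞ :=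
  sSup {n : ℕ∞ | ∃ rs : List R, (rs.length : ℕ∞) = n ∧ (∀ x ∈ rs, x ∈ maximalIdeal R) ∧
    RingTheory.Sequence.IsRegular M rs}

/-- The (Krull) dimension of a module: the Krull dimension of `R` modulo
the annihilator of `M` (`⊥` for the zero module). -/
noncomputable def moduleDim (M : Type u) [AddCommGroup M] [Module R M] : WithBot ℕ∞ :=
  ringKrullDim (R ⧸ Module.annihilator R M)

/-- A finitely generated module over a local ring is Cohen-Macaulay
if its depth equals its dimension. -/
def IsCohenMacaulayModule [IsLocalRing R] (M : Type u) [AddCommGroup M] [Module R M] : Prop :=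
  (depth R M : WithBot ℕ∞) = moduleDim R M

/-- A local ring is Cohen-Macaulay if it is so as a module over itself. -/
def IsCohenMacaulayRing [IsLocalRing R] : Prop := IsCohenMacaulayModule R R

/-- A local ring is Gorenstein if it has finite injective dimension over itself. -/
def IsGorensteinRing : Prop := injDim R R ≠ ⊤

/-! ## Ext, Tor, semidualizing modules -/

/-- `Ext^i_R(A, B)`. -/
noncomputable def ext (i : ℕ) (A B : Type u) [AddCommGroup A] [Module R A]
    [AddCommGroup B] [Module R B] : ModuleCat.{u} R :=
  ((Ext R (ModuleCat.{u} R) i).obj (Opposite.op (ModuleCat.of R A))).obj (ModuleCat.of R B)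

/-- `Tor^R_p(A, B)` indexed by `p : ℤ`, with the convention that it vanishes in
negative degrees. -/
noncomputable def tor (p : ℤ) (A B : Type u) [AddCommGroup A] [Module R A]
    [AddCommGroup B] [Module R B] : ModuleCat.{u} R :=
  if 0 ≤ p then ((Tor (ModuleCat.{u} R) p.toNat).obj (ModuleCat.of R A)).obj (ModuleCat.of R B)
  else ModuleCat.of R PUnit

/-- A finitely generated module `C` is semidualizing if the natural map
`R → Hom_R(C, C)` is bijective and `Ext^i_R(C, C) = 0` for all `i ≥ 1`. -/
def IsSemidualizing (C : Type u) [AddCommGroup C] [Module R C] : Prop :=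
  Module.Finite R C ∧
  Function.Bijective (fun r : R => (r • LinearMap.id : C →ₗ[R] C)) ∧
  ∀ i : ℕ, 1 ≤ i → Subsingleton (ext R i C C)

/-! ## Gorenstein homological classes -/

/-- `N` is Gorenstein injective: it is the kernel of the `0`-th differential of some
exact complex `Y` of injective modules which stays exact under `Hom(I, -)` for every
injective module `I`. (The complex is written cohomologically.) -/
def IsGorensteinInjective (N : Type u) [AddCommGroup N] [Module R N] : Prop :=
  ∃ (Y : ℤ → ModuleCat.{u} R) (d : ∀ i : ℤ, Y i →ₗ[R] Y (i + 1)),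
    (∀ i, Module.Injective R (Y i)) ∧
    (∀ i, Function.Exact (d i) (d (i + 1))) ∧
    (∀ (I : ModuleCat.{u} R), Module.Injective R I →
      ∀ (i : ℤ) (g : I →ₗ[R] Y (i + 1)), (d (i + 1)).comp g = 0 →
        ∃ h : I →ₗ[R] Y i, (d i).comp h = g) ∧
    ∃ ι : N →ₗ[R] Y 0, Function.Injective ι ∧ Function.Exact ι (d 0)

/-- `N` is Gorenstein projective: it is the cokernel of a differential of some
exact complex `X` of projective modules which stays exact under `Hom(-, P)` for
every projective module `P`. -/
def IsGorensteinProjective (N : Type u) [AddCommGroup N] [Module R N] : Prop :=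
  ∃ (X : ℤ → ModuleCat.{u} R) (d : ∀ i : ℤ, X i →ₗ[R] X (i + 1)),
    (∀ i, Module.Projective R (X i)) ∧
    (∀ i, Function.Exact (d i) (d (i + 1))) ∧
    (∀ (P : ModuleCat.{u} R), Module.Projective R P →
      ∀ (i : ℤ) (g : X (i + 1) →ₗ[R] P), g.comp (d i) = 0 →
        ∃ h : X (i + 1 + 1) →ₗ[R] P, h.comp (d (i + 1)) = g) ∧
    ∃ π : X 0 →ₗ[R] N, Function.Surjective π ∧ Function.Exact (d (-1)) π

/-- `N` is Gorenstein flat: it is the cokernel of a differential of some exact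
complex `Z` of flat modules which stays exact under `- ⊗ I` for every injective
module `I`. -/
def IsGorensteinFlat (N : Type u) [AddCommGroup N] [Module R N] : Prop :=
  ∃ (Z : ℤ → ModuleCat.{u} R) (d : ∀ i : ℤ, Z i →ₗ[R] Z (i + 1)),
    (∀ i, Module.Flat R (Z i)) ∧
    (∀ i, Function.Exact (d i) (d (i + 1))) ∧
    (∀ (I : ModuleCat.{u} R), Module.Injective R I →
      ∀ i : ℤ, Function.Exact (LinearMap.rTensor (R := R) I (d i))
        (LinearMap.rTensor (R := R) I (d (i + 1)))) ∧
    ∃ π : Z 0 →ₗ[R] N, Function.Surjective π ∧ Function.Exact (d (-1)) π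

/-- Gorenstein injective dimension `Gid_R M`. -/
noncomputable def GinjDim (M : Type u) [AddCommGroup M] [Module R M] : ℕ∞ :=
  CoresDim R (fun N => IsGorensteinInjective R N) (ModuleCat.of R M)

/-- Gorenstein projective dimension `Gpd_R M`. -/
noncomputable def GprojDim (M : Type u) [AddCommGroup M] [Module R M] : ℕ∞ :=
  ResDim R (fun N => IsGorensteinProjective R N) (ModuleCat.of R M)

/-- Gorenstein flat dimension `Gfd_R M`. -/
noncomputable def GflatDim (M : Type u) [AddCommGroup M] [Module R M] : ℕ∞ :=
  ResDim R (fun N => IsGorensteinFlat R N) (ModuleCat.of R M)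

/-! ## `C`-injective, `C`-projective, `C`-flat modules and the `G_C`-classes -/

/-- `N` is `C`-injective if `N ≅ Hom_R(C, I)` for some injective module `I`. -/
def IsCInjective (C : Type u) [AddCommGroup C] [Module R C]
    (N : Type u) [AddCommGroup N] [Module R N] : Prop :=
  ∃ I : ModuleCat.{u} R, Module.Injective R I ∧ Nonempty (N ≃ₗ[R] (C →ₗ[R] I))

/-- `N` is `C`-projective if `N ≅ C ⊗_R P` for some projective module `P`. -/
def IsCProjective (C : Type u) [AddCommGroup C] [Module R C]
    (N : Type u) [AddCommGroup N] [Module R N] : Prop :=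
  ∃ P : ModuleCat.{u} R, Module.Projective R P ∧ Nonempty (N ≃ₗ[R] TensorProduct R C P)

/-- `N` is `C`-flat if `N ≅ C ⊗_R F` for some flat module `F`. -/
def IsCFlat (C : Type u) [AddCommGroup C] [Module R C]
    (N : Type u) [AddCommGroup N] [Module R N] : Prop :=
  ∃ F : ModuleCat.{u} R, Module.Flat R F ∧ Nonempty (N ≃ₗ[R] TensorProduct R C F)

/-- `C`-injective dimension `cid_R M`. -/
noncomputable def cInjDim (C : Type u) [AddCommGroup C] [Module R C]
    (M : Type u) [AddCommGroup M] [Module R M] : ℕ∞ :=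
  CoresDim R (fun N => IsCInjective R C N) (ModuleCat.of R M)

/-- `C`-projective dimension `cpd_R M`. -/
noncomputable def cProjDim (C : Type u) [AddCommGroup C] [Module R C]
    (M : Type u) [AddCommGroup M] [Module R M] : ℕ∞ :=
  ResDim R (fun N => IsCProjective R C N) (ModuleCat.of R M)

/-- `N` is `G_C`-injective: `N` is the kernel of the `0`-th differential of an exact
complex `Y` (a complete `I_C I`-coresolution) with `Y i` injective in degrees belonging
to the coresolution part and `C`-injective elsewhere, such that `Hom(I', Y)` is exact
for every `C`-injective module `I'`. -/
def IsGCInjective (C : Type u) [AddCommGroup C] [Module R C]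
    (N : Type u) [AddCommGroup N] [Module R N] : Prop :=
  ∃ (Y : ℤ → ModuleCat.{u} R) (d : ∀ i : ℤ, Y i →ₗ[R] Y (i + 1)),
    (∀ i : ℤ, 0 ≤ i → Module.Injective R (Y i)) ∧
    (∀ i : ℤ, i < 0 → IsCInjective R C (Y i)) ∧
    (∀ i, Function.Exact (d i) (d (i + 1))) ∧
    (∀ (I : ModuleCat.{u} R), IsCInjective R C I →
      ∀ (i : ℤ) (g : I →ₗ[R] Y (i + 1)), (d (i + 1)).comp g = 0 →
        ∃ h : I →ₗ[R] Y i, (d i).comp h = g) ∧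
    ∃ ι : N →ₗ[R] Y 0, Function.Injective ι ∧ Function.Exact ι (d 0)

/-- `N` is `G_C`-projective: the cokernel of the degree `0` differential of a complete
`P_C P`-resolution. -/
def IsGCProjective (C : Type u) [AddCommGroup C] [Module R C]
    (N : Type u) [AddCommGroup N] [Module R N] : Prop :=
  ∃ (X : ℤ → ModuleCat.{u} R) (d : ∀ i : ℤ, X i →ₗ[R] X (i + 1)),
    (∀ i : ℤ, i ≤ 0 → Module.Projective R (X i)) ∧
    (∀ i : ℤ, 0 < i → IsCProjective R C (X i)) ∧
    (∀ i, Function.Exact (d i) (d (i + 1))) ∧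
    (∀ (Q : ModuleCat.{u} R), IsCProjective R C Q →
      ∀ (i : ℤ) (g : X (i + 1) →ₗ[R] Q), g.comp (d i) = 0 →
        ∃ h : X (i + 1 + 1) →ₗ[R] Q, h.comp (d (i + 1)) = g) ∧
    ∃ π : X 0 →ₗ[R] N, Function.Surjective π ∧ Function.Exact (d (-1)) π

/-- `N` is `G_C`-flat: the cokernel of the degree `0` differential of a complete
`F_C F`-resolution. -/
def IsGCFlat (C : Type u) [AddCommGroup C] [Module R C]
    (N : Type u) [AddCommGroup N] [Module R N] : Prop :=
  ∃ (Z : ℤ → ModuleCat.{u} R) (d : ∀ i : ℤ, Z i →ₗ[R] Z (i + 1)),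
    (∀ i : ℤ, i ≤ 0 → Module.Flat R (Z i)) ∧
    (∀ i : ℤ, 0 < i → IsCFlat R C (Z i)) ∧
    (∀ i, Function.Exact (d i) (d (i + 1))) ∧
    (∀ (J : ModuleCat.{u} R), IsCInjective R C J →
      ∀ i : ℤ, Function.Exact (LinearMap.rTensor (R := R) J (d i))
        (LinearMap.rTensor (R := R) J (d (i + 1)))) ∧
    ∃ π : Z 0 →ₗ[R] N, Function.Surjective π ∧ Function.Exact (d (-1)) π

/-- `G_C`-injective dimension `Gid_C M`. -/
noncomputable def GCinjDim (C : Type u) [AddCommGroup C] [Module R C]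
    (M : Type u) [AddCommGroup M] [Module R M] : ℕ∞ :=
  CoresDim R (fun N => IsGCInjective R C N) (ModuleCat.of R M)

/-- `G_C`-projective dimension `G_C-pd_R M`. -/
noncomputable def GCprojDim (C : Type u) [AddCommGroup C] [Module R C]
    (M : Type u) [AddCommGroup M] [Module R M] : ℕ∞ :=
  ResDim R (fun N => IsGCProjective R C N) (ModuleCat.of R M)

/-- `G_C`-flat dimension `G_C-fd_R M`. -/
noncomputable def GCflatDim (C : Type u) [AddCommGroup C] [Module R C]
    (M : Type u) [AddCommGroup M] [Module R M] : ℕ∞ :=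
  ResDim R (fun N => IsGCFlat R C N) (ModuleCat.of R M)

end Paper

namespace PAux
section Part1
open CategoryTheory

section cx
variable {R : Type u} [CommRing R]

/-- Raw cochain complexes of modules indexed by the integers. -/
structure Cx (R : Type u) [CommRing R] where
  X : ℤ → ModuleCat.{u} R
  d : ∀ i, X i →ₗ[R] X (i + 1)
  dd : ∀ i x, d (i + 1) (d i x) = 0

/-- Chain maps. -/
structure CHom (D E : Cx R) where
  f : ∀ i, D.X i →ₗ[R] E.X i
  comm : ∀ i x, f (i + 1) (D.d i x) = E.d i (f i x)

/-- Cohomology in degree `i + 1`. -/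
abbrev Cx.H (D : Cx R) (i : ℤ) : Type u :=
  LinearMap.ker (D.d (i + 1)) ⧸
    (LinearMap.range (D.d i)).comap (LinearMap.ker (D.d (i + 1))).subtype

/-- Quasi-isomorphisms. -/
def QIso {D E : Cx R} (f : CHom D E) : Prop :=
  ∀ i, (∀ x : D.X (i + 1), D.d (i + 1) x = 0 → (∃ y, E.d i y = f.f (i + 1) x) →
      ∃ y, D.d i y = x) ∧
    (∀ x' : E.X (i + 1), E.d (i + 1) x' = 0 →
      ∃ x y, D.d (i + 1) x = 0 ∧ x' = f.f (i + 1) x + E.d i y)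

/-- Induced map on cocycles. -/
def CHom.ck {D E : Cx R} (f : CHom D E) (i : ℤ) :
    LinearMap.ker (D.d i) →ₗ[R] LinearMap.ker (E.d i) :=
  (f.f i).restrict (fun x hx => by
    rw [LinearMap.mem_ker] at *
    rw [← f.comm, hx, map_zero])

theorem QIso.equiv {D E : Cx R} {f : CHom D E} (h : QIso f) (i : ℤ) :
    Nonempty (D.H i ≃ₗ[R] E.H i) := by
  let g : D.H i →ₗ[R] E.H i := Submodule.mapQ _ _ (f.ck (i + 1)) (by
    rintro ⟨x, hx⟩ ⟨y, hy⟩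
    refine ⟨f.f i y, ?_⟩
    simp only [Submodule.subtype_apply] at hy
    rw [← f.comm, hy]; rfl)
  refine ⟨LinearEquiv.ofBijective g ⟨?_, ?_⟩⟩
  · rw [injective_iff_map_eq_zero]
    intro a ha
    obtain ⟨⟨x, hx⟩, rfl⟩ := Submodule.Quotient.mk_surjective _ a
    rw [Submodule.mapQ_apply, Submodule.Quotient.mk_eq_zero] at ha
    obtain ⟨y, hy⟩ := ha
    rw [Submodule.Quotient.mk_eq_zero]
    obtain ⟨z, hz⟩ := (h i).1 x hx ⟨y, hy⟩
    exact ⟨z, hz⟩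
  · intro a
    obtain ⟨⟨x', hx'⟩, rfl⟩ := Submodule.Quotient.mk_surjective _ a
    obtain ⟨x, y, hx, hxy⟩ := (h i).2 x' hx'
    refine ⟨Submodule.Quotient.mk ⟨x, hx⟩, ?_⟩
    rw [Submodule.mapQ_apply, eq_comm, Submodule.Quotient.eq]
    refine ⟨y, ?_⟩
    simp [hxy, CHom.ck]

theorem QIso.of_bijective {D E : Cx R} {f : CHom D E} (h : ∀ i, Function.Bijective (f.f i)) :
    QIso f := by
  intro i
  constructor
  · rintro x hx ⟨y, hy⟩
    obtain ⟨z, rfl⟩ := (h i).2 y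
    refine ⟨z, (h (i + 1)).1 ?_⟩
    rw [f.comm, hy]
  · intro x' hx'
    obtain ⟨x, rfl⟩ := (h (i + 1)).2 x'
    refine ⟨x, 0, (h (i + 1 + 1)).1 ?_, by simp⟩
    rw [f.comm, hx', map_zero]

/-- Exactness in terms of cohomology. -/
theorem exact_iff_H (D : Cx R) (i : ℤ) :
    Function.Exact (D.d i) (D.d (i + 1)) ↔ Subsingleton (D.H i) := by
  rw [Submodule.Quotient.subsingleton_iff, eq_top_iff]
  constructor
  · rintro h ⟨x, hx⟩ -
    exact (h x).1 hx
  · intro h x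
    constructor
    · intro hx
      exact h (x := ⟨x, hx⟩) trivial
    · rintro ⟨y, rfl⟩
      exact D.dd i y

/-- Shift. -/
def Cx.shift (D : Cx R) : Cx R where
  X i := D.X (i + 1)
  d i := D.d (i + 1)
  dd i := D.dd (i + 1)

theorem exists_finsupp {A B : Type*} [Zero A] [Zero B] (x : ℕ →₀ A) (Q : ℕ → B → Prop)
    (h : ∀ n, ∃ y, Q n y) (h0 : ∀ n, x n = 0 → Q n 0) : ∃ y : ℕ →₀ B, ∀ n, Q n (y n) := by
  classical
  choose y hy using h
  refine ⟨Finsupp.onFinset x.support (fun n => if x n = 0 then 0 else y n) ?_, ?_⟩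
  · intro n hn
    simp only [Finsupp.mem_support_iff]
    intro h
    simp [h] at hn
  · intro n
    simp only [Finsupp.onFinset_apply]
    split_ifs with h
    · exact h0 n h
    · exact hy n

/-- Countable copower of a complex. -/
noncomputable abbrev NN (D : Cx R) : Cx R where
  X i := ModuleCat.of R (ℕ →₀ D.X i)
  d i := Finsupp.mapRange.linearMap (D.d i)
  dd i _ := Finsupp.ext fun _ => D.dd i _

/-- Countable copower of a map. -/
noncomputable def NNmap {D E : Cx R} (f : CHom D E) : CHom (NN D) (NN E) where
  f i := Finsupp.mapRange.linearMap (f.f i)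
  comm i _ := Finsupp.ext fun _ => f.comm i _

theorem qiso_NN {D E : Cx R} {f : CHom D E} (h : QIso f) : QIso (NNmap f) := by
  intro i
  constructor
  · rintro (x : ℕ →₀ D.X (i + 1)) hx ⟨(y : ℕ →₀ E.X i), hy⟩
    have hx' : ∀ n, D.d (i + 1) (x n) = 0 := fun n => DFunLike.congr_fun (F := ℕ →₀ _) hx n
    have hy' : ∀ n, E.d i (y n) = f.f (i + 1) (x n) :=
      fun n => DFunLike.congr_fun (F := ℕ →₀ _) hy n
    obtain ⟨z, hz⟩ := exists_finsupp (x : ℕ →₀ D.X (i + 1))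
      (fun n z => D.d i z = x n)
      (fun n => (h i).1 _ (hx' n) ⟨_, hy' n⟩) (fun n hn => by rw [hn, map_zero])
    exact ⟨z, Finsupp.ext hz⟩
  · rintro (x : ℕ →₀ E.X (i + 1)) hx
    have hx' : ∀ n, E.d (i + 1) (x n) = 0 := fun n => DFunLike.congr_fun (F := ℕ →₀ _) hx n
    obtain ⟨z, hz⟩ := exists_finsupp (x : ℕ →₀ E.X (i + 1))
      (fun n (z : D.X (i + 1) × E.X i) => D.d (i + 1) z.1 = 0 ∧
        x n = f.f (i + 1) z.1 + E.d i z.2)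
      (fun n => by
        obtain ⟨a, b, hab⟩ := (h i).2 _ (hx' n)
        exact ⟨(a, b), hab⟩) (fun n hn => by simp [hn])
    refine ⟨Finsupp.mapRange Prod.fst rfl z, Finsupp.mapRange Prod.snd rfl z, ?_, ?_⟩
    · exact Finsupp.ext fun n => (hz n).1
    · exact Finsupp.ext fun n => (hz n).2

/-- The telescope map. -/
noncomputable def phi (x : R) (A : Type u) [AddCommGroup A] [Module R A] :
    (ℕ →₀ A) →ₗ[R] (ℕ →₀ A) :=
  Finsupp.lcomapDomain (fun n : ℕ => n + 1) (add_left_injective 1) - x • LinearMap.id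

@[simp] theorem phi_apply (x : R) (A : Type u) [AddCommGroup A] [Module R A] (a : ℕ →₀ A) (n : ℕ) :
    phi x A a n = a (n + 1) - x • a n := by
  simp [phi, Finsupp.lcomapDomain]

theorem phi_nat (x : R) {A B : Type u} [AddCommGroup A] [Module R A] [AddCommGroup B] [Module R B]
    (f : A →ₗ[R] B) (a : ℕ →₀ A) :
    phi x B (Finsupp.mapRange.linearMap f a) = Finsupp.mapRange.linearMap f (phi x A a) := by
  ext n
  simp

/-- `phi` as a chain map. -/
noncomputable def phiC (x : R) (D : Cx R) : CHom (NN D) (NN D) where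
  f i := phi x (D.X i)
  comm i a := phi_nat x (D.d i) a

theorem phiC_nat (x : R) {D E : Cx R} (f : CHom D E) (i : ℤ) (a : (NN D).X i) :
    (phiC x E).f i ((NNmap f).f i a) = (NNmap f).f i ((phiC x D).f i a) :=
  phi_nat x (f.f i) a

/-- The telescope of a complex (a shifted cone of `phi`). -/
noncomputable abbrev tel (x : R) (D : Cx R) : Cx R where
  X i := ModuleCat.of R ((ℕ →₀ D.X (i + 1)) × (ℕ →₀ D.X i))
  d i := LinearMap.prod ((Finsupp.mapRange.linearMap (D.d (i + 1))).comp (LinearMap.fst R _ _))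
    ((phi x (D.X (i + 1))).comp (LinearMap.fst R _ _) -
      (Finsupp.mapRange.linearMap (D.d i)).comp (LinearMap.snd R _ _))
  dd i a := by
    obtain ⟨a, b⟩ := a
    have h2 := (NN D).dd i b
    refine Prod.ext ((NN D).dd (i + 1) a) ?_
    change (phiC x D).f _ ((NN D).d _ a) - (NN D).d _ ((phiC x D).f _ a - (NN D).d _ b) = 0
    rw [map_sub, h2, (phiC x D).comm]
    abel

theorem tel_d (x : R) (D : Cx R) (i : ℤ) (a : (NN D).X (i + 1)) (b : (NN D).X i) :
    (tel x D).d i (a, b) = ((NN D).d (i + 1) a, (phiC x D).f _ a - (NN D).d i b) := rfl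

/-- Functoriality of the telescope. -/
noncomputable def telMap (x : R) {D E : Cx R} (f : CHom D E) : CHom (tel x D) (tel x E) where
  f i := LinearMap.prodMap (Finsupp.mapRange.linearMap (f.f (i + 1)))
    (Finsupp.mapRange.linearMap (f.f i))
  comm i a := by
    obtain ⟨a, b⟩ := a
    refine Prod.ext ((NNmap f).comm (i + 1) a) ?_
    change (NNmap f).f _ ((phiC x D).f _ a - (NN D).d i b) =
      (phiC x E).f _ ((NNmap f).f _ a) - (NN E).d i ((NNmap f).f _ b)
    rw [map_sub, phiC_nat, (NNmap f).comm]

theorem telMap_f (x : R) {D E : Cx R} (f : CHom D E) (i : ℤ) (a : (NN D).X (i + 1)) (b : (NN D).X i) :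
    (telMap x f).f i (a, b) = ((NNmap f).f (i + 1) a, (NNmap f).f i b) := rfl

theorem qiso_tel {D E : Cx R} {f : CHom D E} (h : QIso f) (x : R) : QIso (telMap x f) := by
  have hF := qiso_NN h
  intro i
  constructor
  · rintro ⟨a, b⟩ hab ⟨⟨a', b'⟩, hab'⟩
    rw [tel_d] at hab hab'
    rw [telMap_f] at hab'
    obtain ⟨h1, h2⟩ := Prod.ext_iff.1 hab
    obtain ⟨h3, h4⟩ := Prod.ext_iff.1 hab'
    change (NN D).d _ a = 0 at h1
    change (phiC x D).f _ a - (NN D).d _ b = 0 at h2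
    change (NN E).d _ a' = (NNmap f).f _ a at h3
    change (phiC x E).f _ a' - (NN E).d _ b' = (NNmap f).f _ b at h4
    obtain ⟨a1, ha1⟩ := (hF (i + 1)).1 a h1 ⟨a', h3⟩
    obtain ⟨a2, e, ha2, he⟩ := (hF i).2 (a' - (NNmap f).f _ a1) (by
      rw [map_sub, h3, ← (NNmap f).comm, ha1, sub_self])
    have h5 : a' = (NNmap f).f _ (a1 + a2) + (NN E).d i e := by
      rw [map_add, add_assoc, ← he]; abel
    obtain ⟨b1, hb1⟩ := (hF i).1 ((phiC x D).f _ (a1 + a2) - b) (by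
      rw [map_sub, ← (phiC x D).comm, map_add, ha1, ha2, add_zero, h2]) ⟨b' - (phiC x E).f _ e, by
      rw [map_sub, map_sub, ← h4, h5, ← phiC_nat, map_add ((phiC x E).f (i + 1)),
        ← (phiC x E).comm]; abel⟩
    refine ⟨(a1 + a2, b1), ?_⟩
    rw [tel_d]
    refine Prod.ext ?_ ?_
    · change (NN D).d _ (a1 + a2) = a
      rw [map_add, ha1, ha2, add_zero]
    · change (phiC x D).f _ (a1 + a2) - (NN D).d _ b1 = b
      rw [hb1]; abel
  · rintro ⟨a', b'⟩ hab
    rw [tel_d] at hab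
    obtain ⟨h1, h2⟩ := Prod.ext_iff.1 hab
    change (NN E).d _ a' = 0 at h1
    change (phiC x E).f _ a' - (NN E).d _ b' = 0 at h2
    obtain ⟨a, e, ha, hae⟩ := (hF (i + 1)).2 a' h1
    obtain ⟨b0, hb0⟩ := (hF (i + 1)).1 ((phiC x D).f _ a) (by
      rw [← (phiC x D).comm, ha, map_zero]) ⟨b' - (phiC x E).f _ e, by
      rw [map_sub, ← phiC_nat, ← (phiC x E).comm, ← sub_eq_zero.1 h2, hae, map_add]; abel⟩
    obtain ⟨b2, g, hb2, hg⟩ := (hF i).2 (b' - (phiC x E).f _ e - (NNmap f).f _ b0) (by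
      rw [map_sub, map_sub, ← sub_eq_zero.1 h2, ← (NNmap f).comm, hb0, ← phiC_nat,
        ← (phiC x E).comm, hae, map_add]; abel)
    refine ⟨(a, b0 + b2), (e, -g), ?_, ?_⟩
    · rw [tel_d]
      refine Prod.ext ha ?_
      change (phiC x D).f _ a - (NN D).d _ (b0 + b2) = 0
      rw [map_add, hb0, hb2]; abel
    · rw [tel_d, telMap_f]
      refine Prod.ext hae ?_
      change b' = (NNmap f).f _ (b0 + b2) + ((phiC x E).f _ e - (NN E).d _ (-g))
      rw [map_add, map_neg, sub_neg_eq_add]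
      have : b' = (phiC x E).f _ e + (NNmap f).f _ b0 + ((NNmap f).f _ b2 + (NN E).d _ g) := by
        rw [← hg]; abel
      rw [this]; abel

/-- Iterated telescope. -/
noncomputable def T : List R → Cx R → Cx R
  | [], D => D
  | x :: l, D => T l (tel x D)

/-- Iterated telescope on maps. -/
noncomputable def Tmap : (l : List R) → {D E : Cx R} → CHom D E → CHom (T l D) (T l E)
  | [], _, _, f => f
  | x :: l, _, _, f => Tmap l (telMap x f)

theorem qiso_T {D E : Cx R} {f : CHom D E} (h : QIso f) (l : List R) : QIso (Tmap l f) := by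
  induction l generalizing D E with
  | nil => exact h
  | cons x l ih => exact ih (qiso_tel h x)

end cx

end Part1
end PAux

namespace PAux
section Part2
open CategoryTheory

section gam
variable {R : Type u} [CommRing R]

theorem surj_factor {A B D : Type*} [AddCommGroup A] [Module R A] [AddCommGroup B] [Module R B]
    [AddCommGroup D] [Module R D] (f : A →ₗ[R] B) (hf : Function.Surjective f) (h : A →ₗ[R] D)
    (hk : ∀ a, f a = 0 → h a = 0) : ∃ k : B →ₗ[R] D, ∀ a, k (f a) = h a := by
  refine ⟨((LinearMap.ker f).liftQ h hk).comp (f.quotKerEquivOfSurjective hf).symm.toLinearMap, ?_⟩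
  intro a
  have : (f.quotKerEquivOfSurjective hf).symm (f a) = Submodule.Quotient.mk a := by
    rw [LinearEquiv.symm_apply_eq]; rfl
  rw [LinearMap.comp_apply, LinearEquiv.coe_coe, this]
  exact Submodule.liftQ_apply _ _ _

theorem inj_factor {A B J : Type u} [AddCommGroup A] [Module R A] [AddCommGroup B] [Module R B]
    [AddCommGroup J] [Module R J] (hJ : Module.Injective R J) (f : A →ₗ[R] B) (h : A →ₗ[R] J)
    (hk : ∀ a, f a = 0 → h a = 0) : ∃ k : B →ₗ[R] J, ∀ a, k (f a) = h a := by
  obtain ⟨k, hk'⟩ := hJ.out ((LinearMap.ker f).liftQ f le_rfl)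
    (by
      rw [← LinearMap.ker_eq_bot]
      exact Submodule.ker_liftQ_eq_bot _ _ _ le_rfl)
    ((LinearMap.ker f).liftQ h hk)
  exact ⟨k, fun a => hk' (Submodule.Quotient.mk a)⟩

/-- Factor through an injective map. -/
theorem lift_factor {A B D : Type*} [AddCommGroup A] [Module R A] [AddCommGroup B] [Module R B]
    [AddCommGroup D] [Module R D] (f : A →ₗ[R] B) (hf : Function.Injective f) (h : D →ₗ[R] B)
    (hk : ∀ a, ∃ b, f b = h a) : ∃ k : D →ₗ[R] A, ∀ a, f (k a) = h a := by
  let e := LinearEquiv.ofInjective f hf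
  refine ⟨e.symm.toLinearMap.comp (h.codRestrict (LinearMap.range f) hk), fun a => ?_⟩
  have := e.apply_symm_apply (h.codRestrict (LinearMap.range f) hk a)
  exact congrArg Subtype.val this

theorem injective_of_equiv {A B : Type u} [AddCommGroup A] [Module R A] [AddCommGroup B]
    [Module R B] (e : A ≃ₗ[R] B) (h : Module.Injective R A) : Module.Injective R B := by
  refine ⟨fun {X Y} _ _ _ _ f hf g => ?_⟩
  obtain ⟨k, hk⟩ := h.out f hf (e.symm.toLinearMap.comp g)
  exact ⟨e.toLinearMap.comp k, fun x => by simp [hk]⟩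

theorem exists_section {A B : Type u} [AddCommGroup A] [Module R A] [AddCommGroup B]
    [Module R B] (f : A →ₗ[R] B) (hf : Function.Surjective f)
    (hi : Module.Injective R (LinearMap.ker f)) : ∃ s : B →ₗ[R] A, ∀ b, f (s b) = b := by
  obtain ⟨r, hr⟩ := inj_factor hi (LinearMap.ker f).subtype LinearMap.id (by simp)
  obtain ⟨s, hs⟩ := surj_factor f hf (LinearMap.id - (LinearMap.ker f).subtype.comp r) (by
    intro a ha
    have := hr ⟨a, ha⟩
    simp only [Submodule.subtype_apply] at this
    simp [this])
  refine ⟨s, fun b => ?_⟩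
  obtain ⟨a, rfl⟩ := hf b
  simp [hs]

/-- `x`-power torsion. -/
def Gx (x : R) (A : Type u) [AddCommGroup A] [Module R A] : Submodule R A where
  carrier := {a | ∃ n : ℕ, x ^ n • a = 0}
  zero_mem' := ⟨0, by simp⟩
  add_mem' := by
    rintro a b ⟨n, hn⟩ ⟨m, hm⟩
    refine ⟨n + m, ?_⟩
    rw [smul_add, pow_add, mul_smul, mul_smul, hm, smul_comm, hn]; simp
  smul_mem' := by
    rintro c a ⟨n, hn⟩
    exact ⟨n, by rw [smul_comm, hn, smul_zero]⟩

theorem mem_Gx {x : R} {A : Type u} [AddCommGroup A] [Module R A] {a : A} :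
    a ∈ Gx x A ↔ ∃ n : ℕ, x ^ n • a = 0 := Iff.rfl

theorem Gx_map (x : R) {A B : Type u} [AddCommGroup A] [Module R A] [AddCommGroup B] [Module R B]
    (f : A →ₗ[R] B) {a : A} (ha : a ∈ Gx x A) : f a ∈ Gx x B := by
  obtain ⟨n, hn⟩ := ha
  exact ⟨n, by rw [← map_smul, hn, map_zero]⟩

theorem Gx_fg (x : R) {Z A : Type u} [AddCommGroup A] [Module R A] [AddCommGroup Z] [Module R Z]
    [Module.Finite R Z] (f : Z →ₗ[R] A) (hf : ∀ z, f z ∈ Gx x A) : ∃ n : ℕ, ∀ z, x ^ n • f z = 0 := by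
  obtain ⟨S, hS⟩ := Module.Finite.fg_top (R := R) (M := Z)
  choose n hn using hf
  refine ⟨S.sup n, ?_⟩
  have : ⊤ ≤ LinearMap.ker (x ^ (S.sup n) • f) := by
    rw [← hS, Submodule.span_le]
    intro z hz
    have h1 : n z ≤ S.sup n := Finset.le_sup hz
    obtain ⟨k, hk⟩ := Nat.exists_eq_add_of_le h1
    simp [hk, pow_add, mul_comm (x ^ n z), mul_smul, hn]
  intro z
  exact this (x := z) trivial

theorem stab [IsNoetherianRing R] (x : R) (I : Ideal R) :
    ∃ k : ℕ, ∀ (n : ℕ) (r : R), x ^ (k + n) * r ∈ I → x ^ k * r ∈ I := by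
  let F : ℕ →o Ideal R := ⟨fun k => Submodule.comap (LinearMap.mulLeft R (x ^ k)) I, by
    intro a b hab r hr
    obtain ⟨c, rfl⟩ := Nat.exists_eq_add_of_le hab
    simp only [Submodule.mem_comap, LinearMap.mulLeft_apply] at *
    rw [pow_add, mul_comm (x ^ a), mul_assoc]
    exact I.mul_mem_left _ hr⟩
  obtain ⟨k, hk⟩ := monotone_stabilizes_iff_noetherian.2 (inferInstance : IsNoetherian R R) F
  refine ⟨k, fun n r hr => ?_⟩
  have h1 : r ∈ F (k + n) := hr
  rw [← hk (k + n) (by omega)] at h1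
  exact h1

theorem phi_surj_inj [IsNoetherianRing R] (x : R) (J : Type u) [AddCommGroup J] [Module R J]
    (hJ : Module.Injective R J) : Function.Surjective (phi x J) := by
  rw [← LinearMap.range_eq_top, eq_top_iff]
  have key1 : ∀ (i : ℕ) (a : J), Finsupp.single i a - x • Finsupp.single (i + 1) a ∈
      LinearMap.range (phi x J) := by
    intro i a
    refine ⟨Finsupp.single (i + 1) a, ?_⟩
    ext n
    simp [Finsupp.single_apply]
  have key2 : ∀ (N i : ℕ) (a : J), Finsupp.single i a - Finsupp.single (i + N) (x ^ N • a) ∈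
      LinearMap.range (phi x J) := by
    intro N i a
    induction N with
    | zero => simp
    | succ N ih =>
      have := add_mem ih (key1 (i + N) (x ^ N • a))
      rw [Finsupp.smul_single, smul_smul, ← pow_succ', sub_add_sub_cancel] at this
      exact this
  have key3 : ∀ a : J, Finsupp.single 0 (x • a) ∈ LinearMap.range (phi x J) := by
    intro a
    refine ⟨- Finsupp.single 0 a, ?_⟩
    ext n
    simp [Finsupp.single_apply]
  have key : ∀ (m : ℕ) (e : J), Finsupp.single m e ∈ LinearMap.range (phi x J) := by
    intro m e
    obtain ⟨N, hN⟩ := stab x (⊥ : Ideal R)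
    obtain ⟨k, hk⟩ := inj_factor hJ (LinearMap.mulLeft R (x ^ (N + (m + 1))))
      (LinearMap.toSpanSingleton R J (x ^ N • e)) (by
        intro r hr
        have : x ^ N * r ∈ (⊥ : Ideal R) := hN (m + 1) r (by simpa using hr)
        rw [LinearMap.toSpanSingleton_apply, smul_smul, mul_comm, (Submodule.mem_bot R).1 this,
          zero_smul])
    have hb : x ^ (N + (m + 1)) • k 1 = x ^ N • e := by
      have := hk 1
      simp only [LinearMap.mulLeft_apply, mul_one, LinearMap.toSpanSingleton_apply, one_smul] at this
      rw [← this, ← map_smul, smul_eq_mul, mul_one]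
    have h1 := key2 N m e
    rw [← hb] at h1
    have h2 := key2 (m + N) 0 (x • k 1)
    rw [smul_smul, ← pow_succ, zero_add, show m + N + 1 = N + (m + 1) by ring] at h2
    have h3 := sub_mem (key3 (k 1)) h2
    rw [sub_sub_cancel] at h3
    have := add_mem h1 h3
    rwa [sub_add_cancel] at this
  intro a _
  induction a using Finsupp.induction_linear with
  | zero => exact zero_mem _
  | add f g hf hg => exact add_mem (hf trivial) (hg trivial)
  | single a b => exact key a b

theorem Gx_inj [IsNoetherianRing R] (x : R) (J : Type u) [AddCommGroup J] [Module R J]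
    (hJ : Module.Injective R J) : Module.Injective R (Gx x J) := by
  rw [← Module.Baer.iff_injective]
  intro I g
  obtain ⟨n, hn⟩ := Gx_fg x ((Gx x J).subtype.comp g) (fun z => (g z).2)
  obtain ⟨k, hk⟩ := stab x I
  obtain ⟨q, hq⟩ := inj_factor hJ (A := I × R)
    (LinearMap.coprod I.subtype (LinearMap.mulLeft R (x ^ (k + n))))
    ((Gx x J).subtype.comp (g.comp (LinearMap.fst R I R))) (by
      rintro ⟨⟨i, hi⟩, r⟩ h
      simp only [LinearMap.coprod_apply, Submodule.subtype_apply, LinearMap.mulLeft_apply] at h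
      have h1 : i = x ^ n * (x ^ k * (-r)) := by
        rw [← mul_assoc, ← pow_add, add_comm n k]; linear_combination h
      have h2 : x ^ k * (-r) ∈ I := hk n (-r) (by
        rw [pow_add, mul_comm (x ^ k), mul_assoc, ← h1]; exact hi)
      have h3 : (⟨i, hi⟩ : I) = x ^ n • ⟨x ^ k * (-r), h2⟩ := Subtype.ext h1
      have h4 := hn ⟨x ^ k * (-r), h2⟩
      rw [← map_smul, ← h3] at h4
      exact h4)
  have hz : q (x ^ (k + n)) = 0 := by
    have := hq (0, 1)
    simpa using this
  refine ⟨q.codRestrict (Gx x J) (fun s => ⟨k + n, ?_⟩), ?_⟩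
  · rw [← map_smul, smul_eq_mul, mul_comm, ← smul_eq_mul, map_smul, hz, smul_zero]
  · intro i hi
    apply Subtype.ext
    have := hq (⟨i, hi⟩, 0)
    simp only [LinearMap.coprod_apply, Submodule.subtype_apply, map_zero, add_zero] at this
    exact this

/-- The sequence of multiples of a torsion element. -/
noncomputable def sq (x : R) (A : Type u) [AddCommGroup A] [Module R A] : Gx x A →ₗ[R] (ℕ →₀ A) where
  toFun a := Finsupp.ofSupportFinite (fun n => x ^ n • (a : A)) (by
    obtain ⟨a, N, hN⟩ := a
    refine (Set.finite_lt_nat N).subset ?_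
    intro n hn
    by_contra h
    obtain ⟨c, rfl⟩ := Nat.exists_eq_add_of_le (not_lt.1 h)
    apply hn
    simp [pow_add, mul_comm (x ^ N), mul_smul, hN])
  map_add' a b := by ext n; simp [Finsupp.ofSupportFinite_coe]
  map_smul' a b := by ext n; simp [Finsupp.ofSupportFinite_coe, smul_comm a]

theorem sq_apply (x : R) (A : Type u) [AddCommGroup A] [Module R A] (a : Gx x A) (n : ℕ) :
    sq x A a n = x ^ n • (a : A) := rfl

theorem sq_inj (x : R) (A : Type u) [AddCommGroup A] [Module R A] : Function.Injective (sq x A) := by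
  intro a b h
  have := DFunLike.congr_fun h 0
  simp only [sq_apply, pow_zero, one_smul] at this
  exact Subtype.ext this

theorem phi_sq (x : R) (A : Type u) [AddCommGroup A] [Module R A] (a : Gx x A) :
    phi x A (sq x A a) = 0 := by
  ext n
  simp [sq_apply, pow_succ', mul_smul]

theorem exists_sq (x : R) (A : Type u) [AddCommGroup A] [Module R A] (a : ℕ →₀ A)
    (h : phi x A a = 0) : ∃ e, sq x A e = a := by
  have h1 : ∀ n, a n = x ^ n • a 0 := by
    intro n
    induction n with
    | zero => simp
    | succ n ih =>
      have := DFunLike.congr_fun h n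
      simp only [phi_apply, Finsupp.coe_zero, Pi.zero_apply] at this
      rw [sub_eq_zero.1 this, ih, smul_smul, pow_succ']
  obtain ⟨N, hN⟩ := Infinite.exists_notMem_finset a.support
  refine ⟨⟨a 0, N, ?_⟩, ?_⟩
  · rw [← h1]; simpa using hN
  · ext n
    rw [h1 n]; rfl

theorem ker_phi_inj [IsNoetherianRing R] (x : R) (J : Type u) [AddCommGroup J] [Module R J]
    (hJ : Module.Injective R J) : Module.Injective R (LinearMap.ker (phi x J)) := by
  refine injective_of_equiv (LinearEquiv.ofBijective
    ((sq x J).codRestrict (LinearMap.ker (phi x J)) (phi_sq x J)) ⟨?_, ?_⟩) (Gx_inj x J hJ)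
  · intro a b h
    exact sq_inj x J (congrArg Subtype.val h)
  · rintro ⟨a, ha⟩
    obtain ⟨e, he⟩ := exists_sq x J a ha
    exact ⟨e, Subtype.ext he⟩

/-- Modules of the form `Hom(Z, J)` with `J` injective. -/
def Good (Z : Type u) [AddCommGroup Z] [Module R Z] (A : Type u) [AddCommGroup A] [Module R A] :
    Prop := Paper.IsCInjective R Z A

theorem phi_surj_good [IsNoetherianRing R] (x : R) {Z : Type u} [AddCommGroup Z] [Module R Z]
    [Module.Finite R Z] {A : Type u} [AddCommGroup A] [Module R A] (hA : Good (R := R) Z A) :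
    Function.Surjective (phi x A) := by
  obtain ⟨J, hJ, ⟨e⟩⟩ := hA
  obtain ⟨s, hs⟩ := exists_section (phi x J) (phi_surj_inj x J hJ) (ker_phi_inj x J hJ)
  intro w
  let ev : Z →ₗ[R] (ℕ →₀ J) :=
    { toFun := fun z => Finsupp.mapRange (fun a => e a z) (by simp) w
      map_add' := fun a b => by ext n; simp
      map_smul' := fun a b => by ext n; simp }
  obtain ⟨S, hS⟩ := Module.Finite.fg_top (R := R) (M := Z)
  have hfin : ∀ n, n ∉ S.sup (fun z => (s (ev z)).support) → ∀ z, s (ev z) n = 0 := by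
    intro n hn
    have : ⊤ ≤ LinearMap.ker ((Finsupp.lapply n).comp (s.comp ev)) := by
      rw [← hS, Submodule.span_le]
      intro z hz
      by_contra h
      apply hn
      rw [Finset.mem_sup]
      exact ⟨z, hz, by simpa using h⟩
    intro z
    exact this (x := z) trivial
  refine ⟨Finsupp.onFinset (S.sup (fun z => (s (ev z)).support))
    (fun n => e.symm ((Finsupp.lapply n).comp (s.comp ev))) ?_, ?_⟩
  · intro n hn
    by_contra h
    apply hn
    rw [LinearEquiv.symm_apply_eq, map_zero]
    ext z
    exact hfin n h z
  · ext n
    rw [phi_apply]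
    apply e.injective
    rw [map_sub, map_smul]
    simp only [Finsupp.onFinset_apply, LinearEquiv.apply_symm_apply]
    ext z
    have := DFunLike.congr_fun (hs (ev z)) n
    rw [phi_apply] at this
    exact this

theorem good_Gx [IsNoetherianRing R] (x : R) {Z : Type u} [AddCommGroup Z] [Module R Z]
    [Module.Finite R Z] {A : Type u} [AddCommGroup A] [Module R A] (hA : Good (R := R) Z A) :
    Good (R := R) Z (Gx x A) := by
  obtain ⟨J, hJ, ⟨e⟩⟩ := hA
  refine ⟨ModuleCat.of R (Gx x J), Gx_inj x J hJ, ⟨LinearEquiv.ofBijective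
    { toFun := fun a : Gx x A => (e a.1).codRestrict (Gx x J) (fun z => by
        obtain ⟨a, n, hn⟩ := a
        exact ⟨n, by rw [← LinearMap.smul_apply, ← map_smul, hn]; simp⟩)
      map_add' := fun a b => by
        refine LinearMap.ext fun z => Subtype.ext ?_
        change e (a.1 + b.1) z = e a.1 z + e b.1 z
        simp
      map_smul' := fun a b => by
        refine LinearMap.ext fun z => Subtype.ext ?_
        change e (a • b.1) z = a • e b.1 z
        simp } ⟨?_, ?_⟩⟩⟩
  · intro a b h
    apply Subtype.ext
    apply e.injective
    ext z
    exact congrArg Subtype.val (LinearMap.congr_fun h z)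
  · intro f
    obtain ⟨n, hn⟩ := Gx_fg x ((Gx x J).subtype.comp f) (fun z => (f z).2)
    refine ⟨⟨e.symm ((Gx x J).subtype.comp f), n, ?_⟩, ?_⟩
    · rw [← map_smul, LinearEquiv.symm_apply_eq, map_zero]
      ext z
      exact hn z
    · ext z
      simp

/-- Shifted torsion subcomplex. -/
abbrev gx (x : R) (D : Cx R) : Cx R where
  X i := ModuleCat.of R (Gx x (D.X (i + 1)))
  d i := (D.d (i + 1)).restrict (fun _ h => Gx_map x _ h)
  dd i _ := Subtype.ext (D.dd (i + 1) _)

/-- Inclusion of the torsion into the telescope. -/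
noncomputable def gxTel (x : R) (D : Cx R) : CHom (gx x D) (tel x D) where
  f i := LinearMap.prod (sq x (D.X (i + 1))) 0
  comm i a := by
    refine Prod.ext ?_ ?_
    · refine Finsupp.ext fun n => ?_
      exact (map_smul (D.d (i + 1)) (x ^ n) (a : Gx x (D.X (i + 1))).1).symm
    · change (0 : ℕ →₀ D.X (i + 1)) = phi x _ (sq x _ a) - Finsupp.mapRange.linearMap _ 0
      rw [phi_sq, map_zero, sub_zero]

theorem qiso_gx (x : R) (D : Cx R) (h : ∀ i, Function.Surjective (phi x (D.X i))) :
    QIso (gxTel x D) := by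
  have sqd : ∀ (i : ℤ) (e : (gx x D).X i), sq x (D.X (i + 1 + 1)) ((gx x D).d i e) =
      (NN D).d (i + 1) (sq x (D.X (i + 1)) e) := by
    intro i e
    exact congrArg Prod.fst ((gxTel x D).comm i e)
  intro i
  constructor
  · rintro e he ⟨⟨a, b⟩, hab⟩
    rw [tel_d] at hab
    obtain ⟨h1, h2⟩ := Prod.ext_iff.1 hab
    change (NN D).d _ a = sq x _ e at h1
    change (phiC x D).f _ a - (NN D).d _ b = 0 at h2
    obtain ⟨c, rfl⟩ := h i b
    obtain ⟨e', he'⟩ := exists_sq x (D.X (i + 1)) (a - (NN D).d _ c) (by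
      change (phiC x D).f _ (a - (NN D).d _ c) = 0
      rw [map_sub, (phiC x D).comm]; exact h2)
    refine ⟨e', sq_inj x _ ?_⟩
    rw [sqd, he', map_sub, (NN D).dd, h1, sub_zero]
  · rintro ⟨a, b⟩ hab
    rw [tel_d] at hab
    obtain ⟨h1, h2⟩ := Prod.ext_iff.1 hab
    change (NN D).d _ a = 0 at h1
    change (phiC x D).f _ a - (NN D).d _ b = 0 at h2
    obtain ⟨c, rfl⟩ := h (i + 1) b
    obtain ⟨e', he'⟩ := exists_sq x (D.X (i + 1 + 1)) (a - (NN D).d _ c) (by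
      change (phiC x D).f _ (a - (NN D).d _ c) = 0
      rw [map_sub, (phiC x D).comm]; exact h2)
    refine ⟨e', (c, 0), sq_inj x _ ?_, ?_⟩
    · rw [sqd, he', map_sub, (NN D).dd, h1, sub_zero, map_zero]
    · rw [tel_d]
      refine Prod.ext ?_ ?_
      · change a = sq x _ e' + (NN D).d _ c
        rw [he', sub_add_cancel]
      · change (phiC x D).f _ c = 0 + ((phiC x D).f _ c - (NN D).d _ 0)
        rw [map_zero]; abel

/-- Torsion with respect to a list of elements. -/
def Gl (l : List R) (A : Type u) [AddCommGroup A] [Module R A] : Submodule R A where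
  carrier := {a | ∀ x ∈ l, a ∈ Gx x A}
  zero_mem' := fun _ _ => zero_mem _
  add_mem' := fun ha hb x hx => add_mem (ha x hx) (hb x hx)
  smul_mem' := fun c _ ha x hx => Submodule.smul_mem _ c (ha x hx)

theorem Gl_map (l : List R) {A B : Type u} [AddCommGroup A] [Module R A] [AddCommGroup B]
    [Module R B] (f : A →ₗ[R] B) {a : A} (ha : a ∈ Gl l A) : f a ∈ Gl l B :=
  fun x hx => Gx_map x f (ha x hx)

/-- Torsion subcomplex. -/
abbrev gl (l : List R) (D : Cx R) : Cx R where
  X i := ModuleCat.of R (Gl l (D.X i))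
  d i := (D.d i).restrict (fun _ h => Gl_map l _ h)
  dd i _ := Subtype.ext (D.dd i _)

/-- Flattening of nested torsion. -/
def GlGx (x : R) (l : List R) (A : Type u) [AddCommGroup A] [Module R A] :
    Gl l (Gx x A) →ₗ[R] Gl (x :: l) A :=
  ((Gx x A).subtype.comp (Gl l (Gx x A)).subtype).codRestrict _ (by
    rintro ⟨⟨a, ha⟩, hb⟩ y hy
    rcases List.mem_cons.1 hy with rfl | hy
    · exact ha
    · exact Gx_map y (Gx x A).subtype (hb y hy))

theorem GlGx_bij (x : R) (l : List R) (A : Type u) [AddCommGroup A] [Module R A] :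
    Function.Bijective (GlGx x l A) := by
  constructor
  · intro a b h
    apply Subtype.ext
    apply Subtype.ext
    have h2 := Subtype.ext_iff.1 h
    exact h2
  · rintro ⟨a, ha⟩
    refine ⟨⟨⟨a, ha x (by simp)⟩, ?_⟩, rfl⟩
    intro y hy
    obtain ⟨n, hn⟩ := ha y (List.mem_cons_of_mem _ hy)
    exact ⟨n, Subtype.ext hn⟩

theorem Gl_inj [IsNoetherianRing R] (l : List R) (J : Type u) [AddCommGroup J] [Module R J]
    (hJ : Module.Injective R J) : Module.Injective R (Gl l J) := by
  induction l generalizing J with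
  | nil =>
    refine injective_of_equiv (Submodule.topEquiv.symm.trans (LinearEquiv.ofEq _ _ ?_)) hJ
    symm
    rw [eq_top_iff]
    intro a _ x hx
    simp at hx
  | cons x l ih =>
    exact injective_of_equiv (LinearEquiv.ofBijective _ (GlGx_bij x l J)) (ih _ (Gx_inj x J hJ))

/-- Cohomology of the iterated telescope. -/
theorem H_T [IsNoetherianRing R] (l : List R) {Z : Type u} [AddCommGroup Z] [Module R Z]
    [Module.Finite R Z] (D : Cx R) (hD : ∀ i, Good (R := R) Z (D.X i)) (i j : ℤ)
    (hij : j = i + l.length) : Nonempty ((T l D).H i ≃ₗ[R] (gl l D).H j) := by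
  induction l generalizing D i j with
  | nil =>
    have : j = i := by simpa using hij
    subst this
    let f : CHom (gl [] D) D := ⟨fun i => (Gl [] (D.X i)).subtype, fun i x => rfl⟩
    have hf : QIso f := QIso.of_bijective (fun i => ⟨Subtype.val_injective, fun a =>
      ⟨⟨a, fun x hx => by simp at hx⟩, rfl⟩⟩)
    obtain ⟨e⟩ := hf.equiv j
    exact ⟨e.symm⟩
  | cons x l ih =>
    obtain ⟨k, rfl⟩ : ∃ k, j = k + 1 := ⟨j - 1, by ring⟩
    obtain ⟨e1⟩ := (qiso_T (qiso_gx x D (fun i => phi_surj_good x (hD i))) l).equiv i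
    obtain ⟨e2⟩ := ih (gx x D) (fun i => good_Gx x (hD (i + 1))) i k (by
      simp only [List.length_cons, Nat.cast_add, Nat.cast_one] at hij; linarith)
    let f : CHom (gl l (gx x D)) (gl (x :: l) D).shift :=
      ⟨fun i => GlGx x l (D.X (i + 1)), fun i x => rfl⟩
    have hf : QIso f := QIso.of_bijective (fun i => GlGx_bij x l _)
    obtain ⟨e3⟩ := hf.equiv k
    exact ⟨e1.symm.trans (e2.trans e3)⟩

end gam

end Part2
end PAux

namespace PAux
section Part3
open CategoryTheory TensorProduct

section cores
variable {R : Type u} [CommRing R]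

/-- Coresolutions. -/
structure Cores (R : Type u) [CommRing R] (A : Type u) [AddCommGroup A] [Module R A] where
  J : ℕ → ModuleCat.{u} R
  d : ∀ n, J n →ₗ[R] J (n + 1)
  i : A →ₗ[R] J 0
  hi : Function.Injective i
  e0 : Function.Exact i (d 0)
  ex : ∀ n, Function.Exact (d n) (d (n + 1))

variable {A : Type u} [AddCommGroup A] [Module R A]

/-- Underlying family. -/
def fam (J : ℕ → ModuleCat.{u} R) : ℤ → ModuleCat.{u} R
  | Int.ofNat n => J n
  | Int.negSucc _ => ModuleCat.of R PUnit.{u + 1}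

/-- Underlying differentials. -/
def famd (J : ℕ → ModuleCat.{u} R) (d : ∀ n, J n →ₗ[R] J (n + 1)) :
    ∀ i : ℤ, fam J i →ₗ[R] fam J (i + 1)
  | Int.ofNat n => d n
  | Int.negSucc _ => 0

/-- Complex of a nonnegatively graded complex. -/
def ncx (J : ℕ → ModuleCat.{u} R) (d : ∀ n, J n →ₗ[R] J (n + 1))
    (dd : ∀ n x, d (n + 1) (d n x) = 0) : Cx R where
  X := fam J
  d := famd J d
  dd i := match i with
    | Int.ofNat n => dd n
    | Int.negSucc _ => fun _ => map_zero _

/-- Complex of a coresolution. -/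
def Cores.cx (K : Cores R A) : Cx R := ncx K.J K.d (fun n x => (K.ex n).apply_apply_eq_zero x)

/-- Family concentrated in degree zero. -/
def cfam (A : Type u) [AddCommGroup A] [Module R A] : ℤ → ModuleCat.{u} R
  | Int.ofNat 0 => ModuleCat.of R A
  | Int.ofNat (_ + 1) => ModuleCat.of R PUnit.{u + 1}
  | Int.negSucc _ => ModuleCat.of R PUnit.{u + 1}

/-- Complex concentrated in degree zero. -/
def conc (R : Type u) [CommRing R] (A : Type u) [AddCommGroup A] [Module R A] : Cx R where
  X := cfam A
  d _ := 0
  dd _ _ := rfl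

/-- Augmentation. -/
def augf (K : Cores R A) : ∀ i : ℤ, cfam (R := R) A i →ₗ[R] fam K.J i
  | Int.ofNat 0 => K.i
  | Int.ofNat (_ + 1) => 0
  | Int.negSucc _ => 0

/-- Augmentation. -/
def aug (K : Cores R A) : CHom (conc R A) K.cx where
  f := augf K
  comm i := match i with
    | Int.ofNat 0 => fun x => ((map_zero _).trans (K.e0.apply_apply_eq_zero x).symm)
    | Int.ofNat (_ + 1) => fun _ => ((map_zero _).trans (map_zero _).symm)
    | Int.negSucc _ => fun _ => ((map_zero _).trans (map_zero _).symm)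

theorem qiso_aug (K : Cores R A) : QIso (aug K) := by
  rintro (n | (_ | k))
  · constructor
    · intro x hx _
      exact ⟨0, Subsingleton.elim (α := PUnit) _ _⟩
    · intro x' hx'
      obtain ⟨y, hy⟩ := (K.ex n x').1 hx'
      exact ⟨0, y, map_zero _, by rw [map_zero, zero_add]; exact hy.symm⟩
  · constructor
    · rintro x hx ⟨y, hy⟩
      refine ⟨0, ?_⟩
      have h1 : K.i x = 0 := hy.symm
      have h2 : x = (0 : A) := K.hi (h1.trans (map_zero _).symm)
      exact h2.symm
    · intro x' hx'
      obtain ⟨y, hy⟩ := (K.e0 x').1 hx'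
      exact ⟨y, 0, rfl, by rw [map_zero, add_zero]; exact hy.symm⟩
  · constructor
    · intro x hx _
      exact ⟨0, Subsingleton.elim (α := PUnit) _ _⟩
    · intro x' hx'
      exact ⟨0, 0, rfl, Subsingleton.elim (α := PUnit) _ _⟩

theorem good_cx (K : Cores R A) {Z : Type u} [AddCommGroup Z] [Module R Z]
    (h : ∀ n, Good (R := R) Z (K.J n)) (i : ℤ) : Good (R := R) Z (K.cx.X i) := by
  rcases i with n | n
  · exact h n
  · refine ⟨ModuleCat.of R PUnit.{u + 1}, ?_, ⟨?_⟩⟩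
    · exact ⟨fun _ _ _ _ _ _ _ _ _ => ⟨0, fun _ => Subsingleton.elim (α := PUnit) _ _⟩⟩
    · refine LinearEquiv.ofBijective (0 : PUnit.{u + 1} →ₗ[R] _) ⟨fun _ _ _ => rfl, fun f => ⟨0, ?_⟩⟩
      ext z

/-- Main comparison. -/
theorem H_cores [IsNoetherianRing R] (l : List R) {Z : Type u} [AddCommGroup Z] [Module R Z]
    [Module.Finite R Z] (K : Cores R A) (hK : ∀ n, Good (R := R) Z (K.J n)) (i j : ℤ)
    (hij : j = i + l.length) : Nonempty ((T l (conc R A)).H i ≃ₗ[R] (gl l K.cx).H j) := by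
  obtain ⟨e1⟩ := (qiso_T (qiso_aug K) l).equiv i
  obtain ⟨e2⟩ := H_T l K.cx (good_cx K hK) i j hij
  exact ⟨e1.trans e2⟩

theorem good_of_inj {J : Type u} [AddCommGroup J] [Module R J] (h : Module.Injective R J) :
    Good (R := R) R J :=
  ⟨ModuleCat.of R J, h, ⟨(LinearMap.ringLmapEquivSelf R R J).symm⟩⟩

/-! Properties of the telescope -/

theorem tel_proj (x : R) (D : Cx R) (h : ∀ i, Module.Projective R (D.X i)) (i : ℤ) :
    Module.Projective R ((tel x D).X i) := by
  have := h i
  have := h (i + 1)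
  have key : ∀ A : ModuleCat.{u} R, Module.Projective R A → Module.Projective R (ℕ →₀ A) :=
    fun A _ => Module.Projective.of_equiv (finsuppLEquivDirectSum R A ℕ).symm
  have := key _ (h i)
  have := key _ (h (i + 1))
  change Module.Projective R ((ℕ →₀ D.X (i + 1)) × (ℕ →₀ D.X i))
  infer_instance

theorem tel_subs (x : R) (D : Cx R) (i : ℤ) (h : Subsingleton (D.X i))
    (h' : Subsingleton (D.X (i + 1))) : Subsingleton ((tel x D).X i) := by
  change Subsingleton ((ℕ →₀ D.X (i + 1)) × (ℕ →₀ D.X i))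
  infer_instance

theorem T_proj (l : List R) (D : Cx R) (h : ∀ i, Module.Projective R (D.X i)) (i : ℤ) :
    Module.Projective R ((T l D).X i) := by
  induction l generalizing D with
  | nil => exact h i
  | cons x l ih => exact ih _ (tel_proj x D h)

theorem T_above (l : List R) (D : Cx R) (N : ℤ) (h : ∀ i, N < i → Subsingleton (D.X i)) (i : ℤ)
    (hi : N < i) : Subsingleton ((T l D).X i) := by
  induction l generalizing D with
  | nil => exact h i hi
  | cons x l ih => exact ih _ (fun j hj => tel_subs x D j (h j hj) (h (j + 1) (by omega)))

theorem T_below (l : List R) (D : Cx R) (N : ℤ) (h : ∀ i, i < N → Subsingleton (D.X i)) (i : ℤ)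
    (hi : i < N - l.length) : Subsingleton ((T l D).X i) := by
  induction l generalizing D N with
  | nil => exact h i (by simpa using hi)
  | cons x l ih =>
    refine ih _ (N - 1) (fun j hj => tel_subs x D j (h j (by omega)) (h (j + 1) (by omega))) ?_
    simp only [List.length_cons, Nat.cast_add, Nat.cast_one] at hi
    omega

theorem conc_subs (i : ℤ) (hi : i ≠ 0) : Subsingleton ((conc R A).X i) := by
  rcases i with (_ | n) | n
  · exact absurd rfl hi
  · exact inferInstanceAs (Subsingleton PUnit)
  · exact inferInstanceAs (Subsingleton PUnit)

theorem conc_proj (i : ℤ) : Module.Projective R ((conc R R).X i) := by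
  rcases i with (_ | n) | n
  · exact inferInstanceAs (Module.Projective R R)
  · exact inferInstanceAs (Module.Projective R PUnit.{u + 1})
  · exact inferInstanceAs (Module.Projective R PUnit.{u + 1})

/-- `E` is the tensor product of `D` with `C`. -/
def IsTens (C : Type u) [AddCommGroup C] [Module R C] (D E : Cx R) : Prop :=
  ∃ e : ∀ i, (D.X i ⊗[R] C) ≃ₗ[R] E.X i, ∀ i (t : D.X i) (c : C),
    e (i + 1) (D.d i t ⊗ₜ c) = E.d i (e i (t ⊗ₜ c))

theorem IsTens.tel {C : Type u} [AddCommGroup C] [Module R C] {D E : Cx R}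
    (h : IsTens C D E) (x : R) : IsTens C (tel x D) (tel x E) := by
  obtain ⟨e, he⟩ := h
  let N : ∀ i, ((ℕ →₀ D.X i) ⊗[R] C) ≃ₗ[R] (ℕ →₀ E.X i) := fun i =>
    (TensorProduct.finsuppLeft R R (D.X i) C ℕ).trans (Finsupp.mapRange.linearEquiv (e i))
  have hN : ∀ i (a : ℕ →₀ D.X i) (c : C) n, N i (a ⊗ₜ c) n = e i (a n ⊗ₜ c) := by
    intro i a c n
    simp [N]
  refine ⟨fun i => (TensorProduct.prodLeft R R (ℕ →₀ D.X (i + 1)) (ℕ →₀ D.X i) C).trans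
    ((N (i + 1)).prodCongr (N i)), ?_⟩
  rintro i ⟨a, b⟩ c
  refine Prod.ext ?_ ?_
  · refine Finsupp.ext fun n => ?_
    change N (i + 1 + 1) ((NN D).d (i + 1) a ⊗ₜ c) n = E.d (i + 1) (N (i + 1) (a ⊗ₜ c) n)
    rw [hN, hN, ← he]
    rfl
  · refine Finsupp.ext fun n => ?_
    change N (i + 1) ((phi x _ a - (NN D).d i b) ⊗ₜ c) n =
      phi x _ (N (i + 1) (a ⊗ₜ c)) n - E.d i (N i (b ⊗ₜ c) n)
    rw [hN, hN, ← he, phi_apply, hN, hN, Finsupp.sub_apply, phi_apply, sub_tmul, map_sub,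
      sub_tmul, map_sub, ← smul_tmul', map_smul]
    rfl

theorem IsTens.T {C : Type u} [AddCommGroup C] [Module R C] {D E : Cx R}
    (h : IsTens C D E) (l : List R) : IsTens C (T l D) (T l E) := by
  induction l generalizing D E with
  | nil => exact h
  | cons x l ih => exact ih (h.tel x)

/-- Base case. -/
noncomputable def concTens (C : Type u) [AddCommGroup C] [Module R C] :
    ∀ i, ((conc R R).X i ⊗[R] C) ≃ₗ[R] (conc R C).X i
  | Int.ofNat 0 => TensorProduct.lid R C
  | Int.ofNat (_ + 1) =>
    haveI : Subsingleton (PUnit.{u + 1} ⊗[R] C) :=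
      inferInstance
    (LinearEquiv.ofBijective (0 : (PUnit.{u + 1} ⊗[R] C) →ₗ[R] PUnit.{u + 1})
      ⟨fun _ _ _ => Subsingleton.elim _ _, fun _ => ⟨0, rfl⟩⟩)
  | Int.negSucc _ =>
    haveI : Subsingleton (PUnit.{u + 1} ⊗[R] C) :=
      inferInstance
    (LinearEquiv.ofBijective (0 : (PUnit.{u + 1} ⊗[R] C) →ₗ[R] PUnit.{u + 1})
      ⟨fun _ _ _ => Subsingleton.elim _ _, fun _ => ⟨0, rfl⟩⟩)

theorem isTens_conc (C : Type u) [AddCommGroup C] [Module R C] :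
    IsTens C (conc R R) (conc R C) := by
  refine ⟨concTens C, fun i t c => ?_⟩
  change concTens C (i + 1) ((0 : (conc R R).X (i + 1)) ⊗ₜ c) = 0
  rw [zero_tmul, map_zero]

end cores

end Part3
end PAux

namespace PAux
section Part4
open CategoryTheory Opposite Limits
section
variable {R : Type u} [CommRing R]

/-- functor -/
noncomputable abbrev yF (A : ModuleCat.{u} R) : ModuleCat.{u} R ⥤ (ModuleCat.{u} R)ᵒᵖ :=
  ((linearYoneda R (ModuleCat.{u} R)).obj A).rightOp

/-- complex of homs -/
noncomputable abbrev yQ {X : ModuleCat.{u} R} (P : ProjectiveResolution X) (A : ModuleCat.{u} R) :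
    ChainComplex (ModuleCat.{u} R)ᵒᵖ ℕ :=
  ((yF A).mapHomologicalComplex _).obj P.complex

/-- the iso -/
noncomputable def ii {X : ModuleCat.{u} R} (P : ProjectiveResolution X) (A : ModuleCat.{u} R)
    (n : ℕ) : ((yF A).leftDerived n).obj X ≅ (yQ P A).homology n := P.isoLeftDerivedObj (yF A) n

/-- the representing map -/
noncomputable def rep {X : ModuleCat.{u} R} (P : ProjectiveResolution X) (A : ModuleCat.{u} R)
    (n : ℕ) : unop ((yQ P A).opcycles n) ⟶ ((Ext R (ModuleCat.{u} R) n).obj (op X)).obj A :=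
  ((yQ P A).homologyι n).unop ≫ (ii P A n).hom.unop

/-- the inclusion -/
noncomputable def jj {X : ModuleCat.{u} R} (P : ProjectiveResolution X) (A : ModuleCat.{u} R)
    (n : ℕ) : unop ((yQ P A).opcycles n) ⟶ ModuleCat.of R (P.complex.X n ⟶ A) :=
  ((yQ P A).pOpcycles n).unop

theorem rep_surj {X : ModuleCat.{u} R} (P : ProjectiveResolution X) (A : ModuleCat.{u} R)
    (n : ℕ) : Function.Surjective (rep P A n) := by
  rw [← ModuleCat.epi_iff_surjective]
  unfold rep
  have h1 : Epi ((yQ P A).homologyι n).unop := unop_epi_of_mono _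
  have h2 : Epi (ii P A n).hom.unop := unop_epi_of_mono _
  exact @epi_comp _ _ _ _ _ _ h1 _ h2

theorem jj_inj {X : ModuleCat.{u} R} (P : ProjectiveResolution X) (A : ModuleCat.{u} R)
    (n : ℕ) : Function.Injective (jj P A n) := by
  rw [← ModuleCat.mono_iff_injective]
  unfold jj
  exact unop_mono_of_epi _

theorem jj_d {X : ModuleCat.{u} R} (P : ProjectiveResolution X) (A : ModuleCat.{u} R)
    (n : ℕ) (c) : P.complex.d (n + 1) n ≫ (jj P A n c : P.complex.X n ⟶ A) = 0 := by
  have h := (yQ P A).d_pOpcycles (n + 1) n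
  have h2 : ((yQ P A).pOpcycles n).unop ≫ ((yQ P A).d (n + 1) n).unop = 0 := by
    rw [← unop_comp, h, unop_zero]
  exact congrArg (fun k => k.hom c) h2

theorem jj_ex {X : ModuleCat.{u} R} (P : ProjectiveResolution X) (A : ModuleCat.{u} R)
    (n : ℕ) (f : P.complex.X n ⟶ A) (hf : P.complex.d (n + 1) n ≫ f = 0) :
    ∃ c, jj P A n c = f := by
  have h := ShortComplex.exact_of_g_is_cokernel
    (ShortComplex.mk ((yQ P A).d (n + 1) n) ((yQ P A).pOpcycles n) ((yQ P A).d_pOpcycles _ _))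
    ((yQ P A).opcyclesIsCokernel (n + 1) n (by simp))
  have h2 := h.unop
  rw [ShortComplex.moduleCat_exact_iff] at h2
  exact h2 f hf

theorem rep_zero {X : ModuleCat.{u} R} (P : ProjectiveResolution X) (A : ModuleCat.{u} R)
    (c) (hc : rep P A 0 c = 0) : c = 0 := by
  have h := ShortComplex.exact_of_f_is_kernel
    (ShortComplex.mk ((yQ P A).homologyι 0) ((yQ P A).fromOpcycles 0 0) (by simp))
    ((yQ P A).homologyIsKernel 0 0 (by simp))
  have h2 := h.unop
  rw [ShortComplex.moduleCat_exact_iff] at h2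
  have h3 : Function.Injective (ii P A 0).hom.unop := by
    rw [← ModuleCat.mono_iff_injective]
    infer_instance
  obtain ⟨g, hg⟩ := h2 c (h3 (hc.trans (map_zero _).symm))
  rw [← hg]
  have : (yQ P A).fromOpcycles 0 0 = 0 := by
    rw [← cancel_epi ((yQ P A).pOpcycles 0)]
    simp
  change ((yQ P A).fromOpcycles 0 0).unop g = 0
  rw [this]; rfl

theorem rep_succ {X : ModuleCat.{u} R} (P : ProjectiveResolution X) (A : ModuleCat.{u} R)
    (n : ℕ) (c) : rep P A (n + 1) c = 0 ↔
      ∃ g : P.complex.X n ⟶ A, P.complex.d (n + 1) n ≫ g = jj P A (n + 1) c := by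
  have h := ShortComplex.exact_of_f_is_kernel
    (ShortComplex.mk ((yQ P A).homologyι (n + 1)) ((yQ P A).fromOpcycles (n + 1) n) (by simp))
    ((yQ P A).homologyIsKernel (n + 1) n (by simp))
  have h2 := h.unop
  rw [ShortComplex.moduleCat_exact_iff] at h2
  have h3 : Function.Injective (ii P A (n + 1)).hom.unop := by
    rw [← ModuleCat.mono_iff_injective]
    infer_instance
  have h4 : ∀ g : P.complex.X n ⟶ A, jj P A (n + 1) (((yQ P A).fromOpcycles (n + 1) n).unop g) =
      P.complex.d (n + 1) n ≫ g := by
    intro g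
    have : ((yQ P A).fromOpcycles (n + 1) n).unop ≫ ((yQ P A).pOpcycles (n + 1)).unop =
      ((yQ P A).d (n + 1) n).unop := by
      rw [← unop_comp, HomologicalComplex.p_fromOpcycles]
    exact congrArg (fun k => k.hom g) this
  constructor
  · intro hc
    obtain ⟨g, hg⟩ := h2 c (h3 (hc.trans (map_zero _).symm))
    exact ⟨g, (h4 g).symm.trans (congrArg _ hg)⟩
  · rintro ⟨g, hg⟩
    rw [← h4] at hg
    have hg' := jj_inj P A _ hg
    rw [← hg']
    have h5 : ((yQ P A).fromOpcycles (n + 1) n).unop ≫ ((yQ P A).homologyι (n + 1)).unop = 0 := by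
      rw [← unop_comp, HomologicalComplex.homologyι_comp_fromOpcycles, unop_zero]
    have h6 : ((yQ P A).homologyι (n + 1)).unop (((yQ P A).fromOpcycles (n + 1) n).unop g) = 0 :=
      congrArg (fun k => k.hom g) h5
    change (ii P A (n + 1)).hom.unop
      (((yQ P A).homologyι (n + 1)).unop (((yQ P A).fromOpcycles (n + 1) n).unop g)) = 0
    rw [h6]
    exact map_zero _

theorem rep_nat {X X' : ModuleCat.{u} R} (P : ProjectiveResolution X) (P' : ProjectiveResolution X')
    (A : ModuleCat.{u} R) (n : ℕ) (g : X' ⟶ X) (φ : P'.complex ⟶ P.complex)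
    (comm : φ.f 0 ≫ P.π.f 0 = P'.π.f 0 ≫ g) (c) :
    ∃ c', rep P' A n c' = ((Ext R (ModuleCat.{u} R) n).map g.op).app A (rep P A n c) ∧
      jj P' A n c' = φ.f n ≫ (jj P A n c : P.complex.X n ⟶ A) := by
  let Φ := ((yF A).mapHomologicalComplex (ComplexShape.down ℕ)).map φ
  refine ⟨(HomologicalComplex.opcyclesMap Φ n).unop c, ?_, ?_⟩
  · have h1 : ((yF A).leftDerived n).map g ≫ (ii P A n).hom =
      (ii P' A n).hom ≫ HomologicalComplex.homologyMap Φ n := ProjectiveResolution.isoLeftDerivedObj_hom_naturality g P' P φ comm (yF A) n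
    have h2 : HomologicalComplex.homologyMap Φ n ≫ (yQ P A).homologyι n =
      (yQ P' A).homologyι n ≫ HomologicalComplex.opcyclesMap Φ n := by simp
    have h3 : ((yF A).leftDerived n).map g ≫ (ii P A n).hom ≫
        (yQ P A).homologyι n = (ii P' A n).hom ≫ (yQ P' A).homologyι n ≫
          HomologicalComplex.opcyclesMap Φ n := by
      rw [reassoc_of% h1, ← h2]
    have h4 := congrArg Quiver.Hom.unop h3
    exact (congrArg (fun k => k.hom c) h4).symm
  · have h1 : (yQ P' A).pOpcycles n ≫ HomologicalComplex.opcyclesMap Φ n =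
      Φ.f n ≫ (yQ P A).pOpcycles n := by simp
    have h4 := congrArg Quiver.Hom.unop h1
    exact (congrArg (fun k => k.hom c) h4)
end

end Part4
end PAux

namespace PAux
section Part5
open CategoryTheory Opposite Limits
section
variable {R : Type u} [CommRing R]

open CochainComplex HomComplex in
theorem projExtMk_zero {X A : ModuleCat.{u} R} (P : ProjectiveResolution X)
    (f : P.complex.X 0 ⟶ A) (hf : P.complex.d 1 0 ≫ f = 0)
    (h : P.extMk f 1 rfl hf = 0) : f = 0 := by
  rw [← P.extEquivCohomologyClass.apply_eq_iff_eq, P.extEquivCohomologyClass_extMk,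
    P.extEquivCohomologyClass_zero, CohomologyClass.mk_eq_zero_iff,
    Cocycle.toSingleMk_mem_coboundaries_iff _ _ _ _ _ 1 (by simp)] at h
  obtain ⟨g, hg⟩ := h
  have hz : IsZero (P.cochainComplex.X 1) := P.cochainComplex.isZero_of_isStrictlyLE 0 1 (by simp)
  rw [hz.eq_of_src g 0, comp_zero] at hg
  rw [← cancel_epi (P.cochainComplexXIso (-((0 : ℕ) : ℤ)) 0 rfl).hom, ← hg, comp_zero]

open CochainComplex HomComplex in
theorem injExtMk_zero {X A : ModuleCat.{u} R} (E : InjectiveResolution A)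
    (f : X ⟶ E.cocomplex.X 0) (hf : f ≫ E.cocomplex.d 0 1 = 0)
    (h : E.extMk f 1 rfl hf = 0) : f = 0 := by
  rw [← E.extEquivCohomologyClass.apply_eq_iff_eq, E.extEquivCohomologyClass_extMk,
    E.extEquivCohomologyClass_zero, CohomologyClass.mk_eq_zero_iff,
    Cocycle.fromSingleMk_mem_coboundaries_iff _ _ _ _ _ (-1) (by simp)] at h
  obtain ⟨g, hg⟩ := h
  have hz : IsZero (E.cochainComplex.X (-1)) :=
    E.cochainComplex.isZero_of_isStrictlyGE 0 (-1) (by simp)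
  rw [hz.eq_of_tgt g 0, zero_comp] at hg
  rw [← cancel_mono (E.cochainComplexXIso ((0 : ℕ) : ℤ) 0 rfl).inv, ← hg, zero_comp]

theorem proj_smul_extMk {X A : ModuleCat.{u} R} (P : ProjectiveResolution X) (n : ℕ) (r : R)
    (f : P.complex.X n ⟶ A) (hf : P.complex.d (n + 1) n ≫ f = 0) :
    r • P.extMk f (n + 1) rfl hf = P.extMk (r • f) (n + 1) rfl (by rw [Linear.comp_smul, hf, smul_zero]) := by
  rw [Abelian.Ext.smul_eq_comp_mk₀, P.extMk_comp_mk₀]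
  congr 1

theorem inj_smul_extMk {X A : ModuleCat.{u} R} (E : InjectiveResolution A) (n : ℕ) (r : R)
    (f : X ⟶ E.cocomplex.X n) (hf : f ≫ E.cocomplex.d n (n + 1) = 0) :
    r • E.extMk f (n + 1) rfl hf =
      E.extMk (r • f) (n + 1) rfl (by rw [Linear.smul_comp, hf, smul_zero]) := by
  have : r • E.extMk f (n + 1) rfl hf =
      (Abelian.Ext.mk₀ (r • 𝟙 X)).comp (E.extMk f (n + 1) rfl hf) (zero_add _) := by
    rw [Abelian.Ext.mk₀_smul, Abelian.Ext.smul_comp, Abelian.Ext.mk₀_id_comp]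
  rw [this, E.mk₀_comp_extMk]
  congr 1
  simp

/-- auxiliary -/
noncomputable def ss {X : ModuleCat.{u} R} (P : ProjectiveResolution X) (A : ModuleCat.{u} R)
    (n : ℕ) : (unop ((yQ P A).opcycles n) : ModuleCat.{u} R) →ₗ[R] Abelian.Ext.{u} X A n where
  toFun c := P.extMk (jj P A n c) (n + 1) rfl (jj_d P A n c)
  map_add' c c' := by
    rw [P.add_extMk]
    congr 1
    exact map_add (jj P A n).hom c c'
  map_smul' r c := by
    rw [RingHom.id_apply, proj_smul_extMk]
    congr 1
    exact map_smul (jj P A n).hom r c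

theorem ss_apply {X : ModuleCat.{u} R} (P : ProjectiveResolution X) (A : ModuleCat.{u} R)
    (n : ℕ) (c) (f : P.complex.X n ⟶ A) (hf) (h : jj P A n c = f) :
    ss P A n c = P.extMk f (n + 1) rfl hf := by
  subst h; rfl

theorem ss_zero_iff {X : ModuleCat.{u} R} (P : ProjectiveResolution X) (A : ModuleCat.{u} R)
    (n : ℕ) (c) : ss P A n c = 0 ↔ rep P A n c = 0 := by
  cases n with
  | zero =>
    constructor
    · intro h
      have := projExtMk_zero P _ (jj_d P A 0 c) h
      have h2 : c = 0 := jj_inj P A 0 (this.trans (map_zero _).symm)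
      rw [h2, map_zero]
    · intro h
      rw [rep_zero P A c h, map_zero]
  | succ n =>
    rw [rep_succ]
    exact P.extMk_eq_zero_iff (jj P A (n + 1) c) (n + 2) rfl (jj_d P A (n + 1) c) n rfl

theorem exists_theta (X A : ModuleCat.{u} R) (n : ℕ) :
    ∃ k : ((Ext R (ModuleCat.{u} R) n).obj (op X)).obj A →ₗ[R] Abelian.Ext.{u} X A n,
      ∀ c, k ((rep (projectiveResolution X) A n).hom c) = ss (projectiveResolution X) A n c :=
  surj_factor _ (rep_surj (projectiveResolution X) A n) _ (fun c hc => (ss_zero_iff _ A n c).2 hc)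

/-- comparison -/
noncomputable def theta (X A : ModuleCat.{u} R) (n : ℕ) :
    ((Ext R (ModuleCat.{u} R) n).obj (op X)).obj A →ₗ[R] Abelian.Ext.{u} X A n :=
  (exists_theta X A n).choose

theorem theta_rep (X A : ModuleCat.{u} R) (n : ℕ) (c) :
    theta X A n ((rep (projectiveResolution X) A n).hom c) = ss (projectiveResolution X) A n c :=
  (exists_theta X A n).choose_spec c

theorem theta_bij (X A : ModuleCat.{u} R) (n : ℕ) : Function.Bijective (theta X A n) := by
  constructor
  · rw [injective_iff_map_eq_zero]
    intro e he
    obtain ⟨c, rfl⟩ := rep_surj (projectiveResolution X) A n e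
    have := theta_rep X A n c
    rw [← ss_zero_iff, ← this]
    exact he
  · intro α
    obtain ⟨f, hf, rfl⟩ := (projectiveResolution X).extMk_surjective α (n + 1) rfl
    obtain ⟨c, hc⟩ := jj_ex (projectiveResolution X) A n f hf
    exact ⟨_, (theta_rep X A n c).trans (ss_apply _ A n c f hf hc)⟩

theorem theta_nat {X X' A : ModuleCat.{u} R} (g : X' ⟶ X) (n : ℕ) (e) :
    theta X' A n (((Ext R (ModuleCat.{u} R) n).map g.op).app A e) =
      (Abelian.Ext.mk₀ g).comp (theta X A n e) (zero_add _) := by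
  obtain ⟨c, rfl⟩ := rep_surj (projectiveResolution X) A n e
  let P := projectiveResolution X
  let P' := projectiveResolution X'
  let φ : P'.complex ⟶ P.complex := ProjectiveResolution.lift g P' P
  have comm : φ.f 0 ≫ P.π.f 0 = P'.π.f 0 ≫ g := by
    exact ProjectiveResolution.lift_commutes_zero g P' P
  obtain ⟨c', hc', hj⟩ := rep_nat P P' A n g φ comm c
  refine (congrArg (theta X' A n) hc').symm.trans ?_
  refine (theta_rep X' A n c').trans ?_
  have h2 : theta X A n ((rep (projectiveResolution X) A n) c) = _ := theta_rep X A n c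
  rw [h2]
  have h3 := P.mk₀_comp_extMk (jj P A n c) (n + 1) rfl (jj_d P A n c) (⟨φ, comm⟩ :
    ProjectiveResolution.Hom P' P g)
  exact (ss_apply P' A n c' _ _ hj).trans h3.symm
end

end Part5
end PAux

namespace PAux
section Part6
open CategoryTheory Opposite Limits
section
variable {R : Type u} [CommRing R] {A : Type u} [AddCommGroup A] [Module R A]

/-- coresolution from an injective resolution -/
noncomputable def coresOf (E : InjectiveResolution (ModuleCat.of R A)) : Cores R A where
  J n := E.cocomplex.X n
  d n := (E.cocomplex.d n (n + 1)).hom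
  i := (E.ι.f 0).hom
  hi := (ModuleCat.mono_iff_injective _).1 (inferInstanceAs (Mono (E.ι.f 0)))
  e0 := by
    have := E.exact₀
    rw [ShortComplex.ShortExact.moduleCat_exact_iff_function_exact] at this
    exact this
  ex n := by
    have := E.exact_succ n
    rw [ShortComplex.ShortExact.moduleCat_exact_iff_function_exact] at this
    exact this

theorem coresOf_inj (E : InjectiveResolution (ModuleCat.of R A)) (n : ℕ) :
    Module.Injective R ((coresOf E).J n) := by
  have : Injective (E.cocomplex.X n) := E.injective n
  have : Injective (ModuleCat.of R (E.cocomplex.X n)) := this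
  exact Module.injective_module_of_injective_object R (E.cocomplex.X n)

variable (E : InjectiveResolution (ModuleCat.of R A))

/-- cocycles in hom complex -/
noncomputable def Zc (X : Type u) [AddCommGroup X] [Module R X] (n : ℕ) : Submodule R (X →ₗ[R] (coresOf E).J n) :=
  LinearMap.ker (LinearMap.compRight R ((coresOf E).d n))

theorem mem_Zc {X : Type u} [AddCommGroup X] [Module R X] {n : ℕ} {f : X →ₗ[R] (coresOf E).J n} :
    f ∈ Zc E X n ↔ ((coresOf E).d n).comp f = 0 := Iff.rfl

theorem Zc_hom {X : Type u} [AddCommGroup X] [Module R X] {n : ℕ} (f : Zc E X n) :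
    (ModuleCat.ofHom f.1 : ModuleCat.of R X ⟶ E.cocomplex.X n) ≫ E.cocomplex.d n (n + 1) = 0 :=
  ModuleCat.hom_ext f.2

/-- class of a cocycle -/
noncomputable def cl (X : Type u) [AddCommGroup X] [Module R X] (n : ℕ) :
    Zc E X n →ₗ[R] Abelian.Ext.{u} (ModuleCat.of R X) (ModuleCat.of R A) n where
  toFun f := E.extMk (ModuleCat.ofHom f.1) (n + 1) rfl (Zc_hom E f)
  map_add' f g := by
    rw [E.add_extMk]
    congr 1
  map_smul' r f := by
    rw [RingHom.id_apply, inj_smul_extMk]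
    congr 1

theorem cl_surj (X : Type u) [AddCommGroup X] [Module R X] (n : ℕ) :
    Function.Surjective (cl E X n) := by
  intro α
  obtain ⟨f, hf, rfl⟩ := E.extMk_surjective α (n + 1) rfl
  exact ⟨⟨f.hom, congrArg ModuleCat.Hom.hom hf⟩, rfl⟩

theorem cl_zero (X : Type u) [AddCommGroup X] [Module R X] (f : Zc E X 0) (h : cl E X 0 f = 0) :
    f = 0 := by
  have := injExtMk_zero E (ModuleCat.ofHom f.1) (Zc_hom E f) h
  exact Subtype.ext (congrArg ModuleCat.Hom.hom this)

theorem cl_succ (X : Type u) [AddCommGroup X] [Module R X] (n : ℕ) (f : Zc E X (n + 1)) :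
    cl E X (n + 1) f = 0 ↔ ∃ g : X →ₗ[R] (coresOf E).J n, ((coresOf E).d n).comp g = f.1 := by
  refine (E.extMk_eq_zero_iff (ModuleCat.ofHom f.1) (n + 2) rfl (Zc_hom E f) n rfl).trans ?_
  constructor
  · rintro ⟨g, hg⟩
    exact ⟨g.hom, congrArg ModuleCat.Hom.hom hg⟩
  · rintro ⟨g, hg⟩
    exact ⟨ModuleCat.ofHom g, ModuleCat.hom_ext hg⟩

theorem cl_nat {X X' : Type u} [AddCommGroup X] [Module R X] [AddCommGroup X'] [Module R X'] (n : ℕ)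
    (g : X' →ₗ[R] X) (f : Zc E X n) (f' : Zc E X' n) (h : f'.1 = f.1.comp g) :
    (Abelian.Ext.mk₀ (ModuleCat.ofHom g)).comp (cl E X n f) (zero_add _) = cl E X' n f' := by
  refine (E.mk₀_comp_extMk (ModuleCat.ofHom f.1) (n+1) rfl (Zc_hom E f) (ModuleCat.ofHom g)).trans ?_
  change _ = E.extMk (ModuleCat.ofHom f'.1) (n + 1) rfl (Zc_hom E f')
  congr 1
  rw [h]
  rfl

theorem ext_subs_iff (X : Type u) [AddCommGroup X] [Module R X] (n : ℕ) :
    Subsingleton (Abelian.Ext.{u} (ModuleCat.of R X) (ModuleCat.of R A) (n + 1)) ↔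
      ∀ f : X →ₗ[R] (coresOf E).J (n + 1), ((coresOf E).d (n + 1)).comp f = 0 →
        ∃ g : X →ₗ[R] (coresOf E).J n, ((coresOf E).d n).comp g = f := by
  constructor
  · intro h f hf
    exact (cl_succ E X n ⟨f, hf⟩).1 (Subsingleton.elim _ _)
  · intro h
    refine ⟨fun a b => ?_⟩
    obtain ⟨a, rfl⟩ := cl_surj E X _ a
    obtain ⟨b, rfl⟩ := cl_surj E X _ b
    rw [(cl_succ E X n a).2 (h a.1 a.2), (cl_succ E X n b).2 (h b.1 b.2)]

theorem ext_subs_paper (X : Type u) [AddCommGroup X] [Module R X] (n : ℕ)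
    (h : Subsingleton (Paper.ext R n X A)) :
    Subsingleton (Abelian.Ext.{u} (ModuleCat.of R X) (ModuleCat.of R A) n) :=
  haveI : Subsingleton (((Ext R (ModuleCat R) n).obj (op (ModuleCat.of R X))).obj
    (ModuleCat.of R A)) := h
  (theta_bij (ModuleCat.of R X) (ModuleCat.of R A) n).2.subsingleton

/-- torsion cocycles -/
def ZG (l : List R) (K : Cores R A) (n : ℕ) : Submodule R (K.J n) :=
  LinearMap.ker (K.d n) ⊓ Gl l (K.J n)

/-- torsion coboundaries -/
def Bd (l : List R) (K : Cores R A) : ∀ n : ℕ, K.J n → Prop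
  | 0, y => y = 0
  | n + 1, y => ∃ w ∈ Gl l (K.J n), K.d n w = y

/-- previous index -/
def jm : ℕ → ℤ
  | 0 => -1
  | n + 1 => n

theorem exists_q (l : List R) (K : Cores R A) (n : ℕ) :
    ∃ q : ZG l K n →ₗ[R] (gl l K.cx).H (jm n), Function.Surjective q ∧
      ∀ y, q y = 0 ↔ Bd l K n y.1 := by
  cases n with
  | zero =>
    let c : ZG l K 0 →ₗ[R] LinearMap.ker ((gl l K.cx).d (-1 + 1)) :=
      { toFun := fun y => ⟨(⟨y.1, y.2.2⟩ : Gl l (K.J 0)), Subtype.ext y.2.1⟩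
        map_add' := fun _ _ => rfl
        map_smul' := fun _ _ => rfl }
    refine ⟨(Submodule.mkQ _).comp c, ?_, ?_⟩
    · intro a
      obtain ⟨⟨⟨x, hx⟩, hx'⟩, rfl⟩ := Submodule.Quotient.mk_surjective _ a
      exact ⟨⟨x, congrArg Subtype.val hx', hx⟩, rfl⟩
    · intro y
      refine (Submodule.Quotient.mk_eq_zero _).trans ?_
      constructor
      · rintro ⟨w, hw⟩
        exact (congrArg Subtype.val hw).symm
      · intro h
        exact ⟨0, Subtype.ext h.symm⟩
  | succ n =>
    let c : ZG l K (n + 1) →ₗ[R] LinearMap.ker ((gl l K.cx).d ((n : ℤ) + 1)) :=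
      { toFun := fun y => ⟨(⟨y.1, y.2.2⟩ : Gl l (K.J (n + 1))), Subtype.ext y.2.1⟩
        map_add' := fun _ _ => rfl
        map_smul' := fun _ _ => rfl }
    refine ⟨(Submodule.mkQ _).comp c, ?_, ?_⟩
    · intro a
      obtain ⟨⟨⟨x, hx⟩, hx'⟩, rfl⟩ := Submodule.Quotient.mk_surjective _ a
      exact ⟨⟨x, congrArg Subtype.val hx', hx⟩, rfl⟩
    · intro y
      refine (Submodule.Quotient.mk_eq_zero _).trans ?_
      constructor
      · rintro ⟨⟨w, hw'⟩, hw⟩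
        exact ⟨w, hw', congrArg Subtype.val hw⟩
      · rintro ⟨w, hw', hw⟩
        exact ⟨⟨w, hw'⟩, Subtype.ext hw⟩

theorem Gl_pow {l : List R} {𝔞 : Ideal R} (h𝔞 : 𝔞 = Ideal.span {x | x ∈ l}) {M : Type u}
    [AddCommGroup M] [Module R M] (w : M) :
    w ∈ Gl l M ↔ ∃ s : ℕ, ∀ a ∈ 𝔞 ^ s, a • w = 0 := by
  classical
  constructor
  · intro h
    have h1 : 𝔞 ≤ Ideal.radical (LinearMap.ker (LinearMap.toSpanSingleton R M w) : Ideal R) := by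
      rw [h𝔞, Ideal.span_le]
      intro x hx
      obtain ⟨n, hn⟩ := h x hx
      exact ⟨n, hn⟩
    have h2 : 𝔞.FG := by
      rw [h𝔞]
      exact ⟨l.toFinset, by simp⟩
    obtain ⟨s, hs⟩ := Ideal.exists_pow_le_of_le_radical_of_fg h1 h2
    exact ⟨s, fun a ha => hs ha⟩
  · rintro ⟨s, hs⟩ x hx
    refine ⟨s, hs _ (Ideal.pow_mem_pow ?_ s)⟩
    rw [h𝔞]
    exact Ideal.subset_span hx
end

end Part6
end PAux

namespace PAux
section Part7
open CategoryTheory Opposite Limits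
section
variable {R : Type u} [CommRing R] {A : Type u} [AddCommGroup A] [Module R A]
variable (E : InjectiveResolution (ModuleCat.of R A))

/-- evaluation at one -/
noncomputable def ev1 {l : List R} {𝔞 : Ideal R} (h𝔞 : 𝔞 = Ideal.span {x | x ∈ l}) (i t : ℕ) :
    Zc E (R ⧸ 𝔞 ^ t) i →ₗ[R] ZG l (coresOf E) i where
  toFun z := ⟨z.1 (Submodule.Quotient.mk 1), LinearMap.congr_fun z.2 _, (Gl_pow h𝔞 _).2
    ⟨t, fun a ha => by
      rw [← map_smul, ← Submodule.Quotient.mk_smul, (Submodule.Quotient.mk_eq_zero _).2, map_zero]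
      simpa using ha⟩⟩
  map_add' _ _ := rfl
  map_smul' _ _ := rfl

theorem quot_hom_ext {I : Ideal R} {M : Type u} [AddCommGroup M] [Module R M]
    {f g : (R ⧸ I) →ₗ[R] M} (h : f (Submodule.Quotient.mk 1) = g (Submodule.Quotient.mk 1)) :
    f = g := by
  refine LinearMap.ext fun x => ?_
  obtain ⟨r, rfl⟩ := Submodule.Quotient.mk_surjective _ x
  have : (Submodule.Quotient.mk r : R ⧸ I) = r • Submodule.Quotient.mk 1 := by
    rw [← Submodule.Quotient.mk_smul]; simp
  rw [this, map_smul, map_smul, h]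

theorem exists_quot_hom {I : Ideal R} {M : Type u} [AddCommGroup M] [Module R M]
    (w : M) (h : ∀ a ∈ I, a • w = 0) :
    ∃ f : (R ⧸ I) →ₗ[R] M, f (Submodule.Quotient.mk 1) = w :=
  ⟨Submodule.liftQ I (LinearMap.toSpanSingleton R M w) h, (Submodule.liftQ_apply I (LinearMap.toSpanSingleton R M w) 1).trans (one_smul R w)⟩

theorem lcoh_equiv {l : List R} {𝔞 : Ideal R} (h𝔞 : 𝔞 = Ideal.span {x | x ∈ l}) (i : ℕ) :
    Nonempty (Paper.lcoh R 𝔞 i A ≃ₗ[R] (gl l (coresOf E).cx).H (jm i)) := by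
  classical
  obtain ⟨q, hq, hq0⟩ := exists_q l (coresOf E) i
  have key : ∀ t z, cl E (R ⧸ 𝔞 ^ t) i z = 0 → q (ev1 E h𝔞 i t z) = 0 := by
    intro t z hz
    rw [hq0]
    cases i with
    | zero =>
      rw [cl_zero E _ z hz]
      rfl
    | succ i =>
      obtain ⟨g, hg⟩ := (cl_succ E _ _ z).1 hz
      refine ⟨g (Submodule.Quotient.mk 1), (Gl_pow h𝔞 _).2 ⟨t, fun a ha => ?_⟩, ?_⟩
      · rw [← map_smul, ← Submodule.Quotient.mk_smul, (Submodule.Quotient.mk_eq_zero _).2, map_zero]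
        simpa using ha
      · exact LinearMap.congr_fun hg _
  have key2 : ∀ t, ∃ k : Abelian.Ext.{u} (ModuleCat.of R (R ⧸ 𝔞 ^ t)) (ModuleCat.of R A) i →ₗ[R]
      (gl l (coresOf E).cx).H (jm i), ∀ z, k (cl E (R ⧸ 𝔞 ^ t) i z) = q (ev1 E h𝔞 i t z) := fun t =>
    surj_factor _ (cl_surj E _ _) (q.comp (ev1 E h𝔞 i t)) (key t)
  choose k hk using key2
  let F : ℕᵒᵖᵒᵖ ⥤ ModuleCat.{u} R :=
    localCohomology.diagram (localCohomology.idealPowersDiagram 𝔞) i ⋙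
      (evaluation _ _).obj (ModuleCat.of R A)
  let c : Cocone F := ((evaluation _ _).obj (ModuleCat.of R A)).mapCocone
    (colimit.cocone (localCohomology.diagram (localCohomology.idealPowersDiagram 𝔞) i))
  have hc : IsColimit c := isColimitOfPreserves _ (colimit.isColimit _)
  let th : ∀ t : ℕ, F.obj (op (op t)) →ₗ[R]
      Abelian.Ext.{u} (ModuleCat.of R (R ⧸ 𝔞 ^ t)) (ModuleCat.of R A) i := fun t =>
    theta (ModuleCat.of R (R ⧸ 𝔞 ^ t)) (ModuleCat.of R A) i
  have hth : ∀ t, Function.Bijective (th t) := fun t => theta_bij _ _ _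
  let tr : ∀ (s t : ℕ), s ≤ t → (R ⧸ 𝔞 ^ t) →ₗ[R] (R ⧸ 𝔞 ^ s) := fun s t h =>
    Submodule.mapQ _ _ LinearMap.id (Ideal.pow_le_pow_right h)
  have hnat : ∀ (s t : ℕ) (f : (op (op s) : ℕᵒᵖᵒᵖ) ⟶ op (op t)) (e : F.obj (op (op s))),
      th t (F.map f e) = (Abelian.Ext.mk₀ (ModuleCat.ofHom (tr s t f.unop.unop.down.down))).comp
        (th s e) (zero_add _) := fun s t f e =>
    theta_nat (A := ModuleCat.of R A) (ModuleCat.ofHom (tr s t f.unop.unop.down.down)) i e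
  have hclnat : ∀ (s t : ℕ) (h : s ≤ t) (z : Zc E (R ⧸ 𝔞 ^ s) i),
      ∃ z' : Zc E (R ⧸ 𝔞 ^ t) i, (Abelian.Ext.mk₀ (ModuleCat.ofHom (tr s t h))).comp
        (cl E _ i z) (zero_add _) = cl E _ i z' ∧ z'.1 = z.1.comp (tr s t h) := by
    intro s t h z
    refine ⟨⟨z.1.comp (tr s t h), ?_⟩, cl_nat E i _ z _ rfl, rfl⟩
    rw [mem_Zc, ← LinearMap.comp_assoc, (mem_Zc E).1 z.2, LinearMap.zero_comp]
  let d : Cocone F :=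
    { pt := ModuleCat.of R ((gl l (coresOf E).cx).H (jm i))
      ι := { app := fun t => ModuleCat.ofHom ((k t.unop.unop).comp (th t.unop.unop))
             naturality := by
              intro s t f
              refine ModuleCat.hom_ext (LinearMap.ext fun e => ?_)
              change k t.unop.unop (th t.unop.unop (F.map f e)) = k s.unop.unop (th s.unop.unop e)
              refine (congrArg _ (hnat s.unop.unop t.unop.unop f e)).trans ?_
              obtain ⟨z, hz⟩ := cl_surj E _ i (th s.unop.unop e)
              rw [← hz]
              obtain ⟨z', h1, h2⟩ := hclnat s.unop.unop t.unop.unop f.unop.unop.down.down z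
              refine (congrArg _ h1).trans ?_
              rw [hk, hk]
              congr 1
              refine Subtype.ext ?_
              change z'.1 _ = z.1 _
              rw [h2]
              rfl } }
  let Φ : c.pt →ₗ[R] (gl l (coresOf E).cx).H (jm i) := (hc.desc d).hom
  have hΦ : ∀ (t : ℕ) (e : F.obj (op (op t))), Φ (c.ι.app (op (op t)) e) = k t (th t e) :=
    fun t e => ConcreteCategory.congr_hom (hc.fac d (op (op t))) e
  have hsurj : Function.Surjective Φ := by
    intro y
    obtain ⟨⟨w, hw, hw'⟩, rfl⟩ := hq y
    obtain ⟨t, ht⟩ := (Gl_pow h𝔞 w).1 hw'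
    obtain ⟨f, hf⟩ := exists_quot_hom w ht
    have hfZ : f ∈ Zc E (R ⧸ 𝔞 ^ t) i := by
      rw [mem_Zc]
      refine quot_hom_ext ?_
      rw [LinearMap.comp_apply, hf]
      exact hw
    obtain ⟨e, he⟩ := (hth t).2 (cl E _ i ⟨f, hfZ⟩)
    refine ⟨c.ι.app (op (op t)) e, ?_⟩
    rw [hΦ, he, hk]
    congr 1
    exact Subtype.ext hf
  have hinj : Function.Injective Φ := by
    rw [injective_iff_map_eq_zero]
    intro a ha
    haveI hP1 : PreservesFilteredColimitsOfSize.{0, 0} (forget (ModuleCat.{u} R)) :=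
      preservesFilteredColimitsOfSize_shrink.{0, u, 0, u} _
    haveI hP2 : PreservesColimitsOfShape ℕᵒᵖᵒᵖ (forget (ModuleCat.{u} R)) := inferInstance
    obtain ⟨s, e, rfl⟩ := Concrete.isColimit_exists_rep F hc a
    obtain ⟨s⟩ := s
    obtain ⟨s⟩ := s
    have ha' : k s (th s e) = 0 := (hΦ s e).symm.trans ha
    obtain ⟨z, hz⟩ := cl_surj E _ i (th s e)
    rw [← hz, hk, hq0] at ha'
    have : ∃ t : ℕ, ∃ h : s ≤ t, (Abelian.Ext.mk₀ (ModuleCat.ofHom (tr s t h))).comp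
        (cl E _ i z) (zero_add _) = 0 := by
      cases i with
      | zero =>
        refine ⟨s, le_rfl, ?_⟩
        have : z = 0 := Subtype.ext (quot_hom_ext ha')
        rw [this, map_zero, Abelian.Ext.comp_zero]
      | succ i =>
        obtain ⟨w, hw, hw'⟩ := ha'
        obtain ⟨t, ht⟩ := (Gl_pow h𝔞 w).1 hw
        refine ⟨s + t, Nat.le_add_right _ _, ?_⟩
        obtain ⟨z', h1, h2⟩ := hclnat s (s + t) (Nat.le_add_right _ _) z
        rw [h1, cl_succ]
        obtain ⟨g, hg⟩ := exists_quot_hom (I := 𝔞 ^ (s + t)) w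
          (fun a ha => ht a (Ideal.pow_le_pow_right (Nat.le_add_left _ _) ha))
        refine ⟨g, quot_hom_ext ?_⟩
        rw [LinearMap.comp_apply, hg, hw', h2]
        rfl
    obtain ⟨t, h, h0⟩ := this
    let f : (op (op s) : ℕᵒᵖᵒᵖ) ⟶ op (op t) := (homOfLE h).op.op
    have h3 : F.map f e = 0 := by
      apply (hth t).1
      rw [map_zero]
      refine (hnat s t f e).trans ?_
      rw [← hz]
      exact h0
    have h4 := ConcreteCategory.congr_hom (c.w f) e
    refine h4.symm.trans ?_
    refine (congrArg (c.ι.app (op (op t))) h3).trans ?_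
    exact map_zero (c.ι.app (op (op t))).hom
  exact ⟨LinearEquiv.ofBijective Φ ⟨hinj, hsurj⟩⟩
end

end Part7
end PAux

namespace PAux
section Part8
open CategoryTheory Opposite Limits
section
variable {R : Type u} [CommRing R]

/-- Vanishing of the first extension group, via liftings. -/
def LiftP (X A : Type u) [AddCommGroup X] [Module R X] [AddCommGroup A] [Module R A] : Prop :=
  ∀ (Y B : ModuleCat.{u} R) (f : A →ₗ[R] Y) (g : Y →ₗ[R] B), Function.Injective f →
    Function.Surjective g → Function.Exact f g → ∀ h : X →ₗ[R] B,
      ∃ h' : X →ₗ[R] Y, g.comp h' = h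

variable {X A Y B : Type u} [AddCommGroup X] [Module R X] [AddCommGroup A] [Module R A]
  [AddCommGroup Y] [Module R Y] [AddCommGroup B] [Module R B]

theorem LiftP.lift (H : LiftP (R := R) X A) (f : A →ₗ[R] Y) (g : Y →ₗ[R] B)
    (hf : Function.Injective f) (hg : Function.Surjective g) (hfg : Function.Exact f g)
    (h : X →ₗ[R] B) : ∃ h' : X →ₗ[R] Y, g.comp h' = h :=
  H (ModuleCat.of R Y) (ModuleCat.of R B) f g hf hg hfg h

theorem liftP_inj (hA : Module.Injective R A) : LiftP (R := R) X A := by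
  intro Y B f g hf hg hfg h
  obtain ⟨r, hr⟩ := Module.Injective.out f hf LinearMap.id
  have hr' : ∀ a, r (f a) = a := hr
  obtain ⟨s, hs⟩ := surj_factor g hg (LinearMap.id - f.comp r) (by
    intro y hy
    obtain ⟨a, rfl⟩ := (hfg y).1 hy
    simp [hr'])
  refine ⟨s.comp h, LinearMap.ext fun x => ?_⟩
  obtain ⟨y, hy⟩ := hg (h x)
  simp only [LinearMap.comp_apply, ← hy, hs]
  simp [hfg.apply_apply_eq_zero]

theorem LiftP.of_equiv (e : A ≃ₗ[R] B) (h : LiftP (R := R) X A) : LiftP (R := R) X B := by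
  intro Y D f g hf hg hfg k
  refine h.lift (f.comp e.toLinearMap) g (hf.comp e.injective) hg ?_ k
  intro y
  rw [hfg y]
  constructor
  · rintro ⟨b, rfl⟩; exact ⟨e.symm b, by simp⟩
  · rintro ⟨b, rfl⟩; exact ⟨e b, by simp⟩

theorem LiftP.of_equiv_left (e : X ≃ₗ[R] Y) (h : LiftP (R := R) X A) : LiftP (R := R) Y A := by
  intro Y' D f g hf hg hfg k
  obtain ⟨h', hh⟩ := h.lift f g hf hg hfg (k.comp e.toLinearMap)
  refine ⟨h'.comp e.symm.toLinearMap, LinearMap.ext fun x => ?_⟩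
  have := LinearMap.congr_fun hh (e.symm x)
  simpa using this

theorem LiftP.kernel (f : A →ₗ[R] Y) (g : Y →ₗ[R] B) (hf : Function.Injective f)
    (hfg : Function.Exact f g) (hY : LiftP (R := R) X Y)
    (hs : ∀ h : X →ₗ[R] B, (∀ x, h x ∈ LinearMap.range g) → ∃ h' : X →ₗ[R] Y, g.comp h' = h) :
    LiftP (R := R) X A := by
  intro Y' B' f' g' hf' hg' hfg' h
  let N : Submodule R (Y × Y') := LinearMap.range (f.prod (-f'))
  let P := (Y × Y') ⧸ N
  let a : Y →ₗ[R] P := N.mkQ.comp (LinearMap.inl R Y Y')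
  let b : P →ₗ[R] B' := N.liftQ (g'.comp (LinearMap.snd R Y Y')) (by
    rintro _ ⟨x, rfl⟩
    simp [hfg'.apply_apply_eq_zero])
  let c : P →ₗ[R] B := N.liftQ (g.comp (LinearMap.fst R Y Y')) (by
    rintro _ ⟨x, rfl⟩
    simp [hfg.apply_apply_eq_zero])
  have hb : ∀ p, b (N.mkQ p) = g' p.2 := fun p => rfl
  have hc : ∀ p, c (N.mkQ p) = g p.1 := fun p => rfl
  have hN : ∀ p, N.mkQ p = 0 ↔ ∃ x, (f x, -f' x) = p := fun p =>
    (Submodule.Quotient.mk_eq_zero _).trans Iff.rfl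
  have ha : Function.Injective a := by
    rw [injective_iff_map_eq_zero]
    intro y hy
    obtain ⟨x, hx⟩ := (hN _).1 hy
    have h2 : -f' x = 0 := congrArg Prod.snd hx
    have h3 : x = 0 := hf' (by rw [map_zero]; simpa using h2)
    have h1 : f x = y := congrArg Prod.fst hx
    rw [← h1, h3, map_zero]
  have hbs : Function.Surjective b := by
    intro x
    obtain ⟨y, rfl⟩ := hg' x
    exact ⟨N.mkQ (0, y), rfl⟩
  have hab : Function.Exact a b := by
    intro p
    obtain ⟨⟨y, y'⟩, rfl⟩ := N.mkQ_surjective p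
    rw [hb]
    constructor
    · intro h
      obtain ⟨x, hx⟩ := (hfg' y').1 h
      refine ⟨y + f x, ?_⟩
      rw [← sub_eq_zero]
      refine (map_sub N.mkQ _ _).symm.trans ((hN _).2 ⟨x, ?_⟩)
      simp [hx]
    · rintro ⟨z, hz⟩
      have := congrArg b hz
      rw [hb] at this
      rw [← this]
      exact (map_zero g')
  obtain ⟨k, hk⟩ := hY.lift a b ha hbs hab h
  obtain ⟨m, hm⟩ := hs (c.comp k) (by
    intro x
    obtain ⟨p, hp⟩ := N.mkQ_surjective (k x)
    rw [LinearMap.comp_apply, ← hp, hc]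
    exact ⟨_, rfl⟩)
  let k' := k - a.comp m
  let j : Y' →ₗ[R] P := N.mkQ.comp (LinearMap.inr R Y Y')
  have hj : Function.Injective j := by
    rw [injective_iff_map_eq_zero]
    intro y hy
    obtain ⟨x, hx⟩ := (hN _).1 hy
    have h2 : f x = 0 := congrArg Prod.fst hx
    have h3 : x = 0 := hf (by rw [map_zero]; simpa using h2)
    have h1 : -f' x = y := congrArg Prod.snd hx
    rw [← h1, h3, map_zero, neg_zero]
  obtain ⟨t, ht⟩ := lift_factor j hj k' (by
    intro x
    obtain ⟨⟨y, y'⟩, hp⟩ := N.mkQ_surjective (k x)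
    have h1 : g (m x) = c (k x) := LinearMap.congr_fun hm x
    rw [← hp, hc] at h1
    obtain ⟨z, hz⟩ := (hfg (y - m x)).1 (by rw [map_sub, h1, sub_self])
    refine ⟨y' + f' z, ?_⟩
    change _ = k x - a (m x)
    rw [← hp, eq_comm, ← sub_eq_zero]
    refine (congrArg₂ (· - ·) (map_sub N.mkQ (y, y') (m x, 0)).symm rfl).trans ?_
    refine (map_sub N.mkQ _ _).symm.trans ((hN _).2 ⟨z, ?_⟩)
    simp [hz])
  refine ⟨t, LinearMap.ext fun x => ?_⟩
  have h1 : b (j (t x)) = b (k x - a (m x)) := congrArg b (ht x)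
  rw [map_sub, hab.apply_apply_eq_zero, sub_zero] at h1
  exact h1.trans (LinearMap.congr_fun hk x)

theorem LiftP.ext (f : A →ₗ[R] Y) (g : Y →ₗ[R] B) (hf : Function.Injective f)
    (hg : Function.Surjective g)
    (hfg : Function.Exact f g) (hA : LiftP (R := R) X A) (hB : LiftP (R := R) X B) :
    LiftP (R := R) X Y := by
  intro Z D i p hi hp hip h
  let N : Submodule R Z := LinearMap.range (i.comp f)
  let p' : (Z ⧸ N) →ₗ[R] D := N.liftQ p (by
    rintro _ ⟨x, rfl⟩
    exact hip.apply_apply_eq_zero _)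
  have hp' : ∀ z, p' (N.mkQ z) = p z := fun _ => rfl
  obtain ⟨i', hi'⟩ := surj_factor g hg (N.mkQ.comp i) (by
    intro y hy
    obtain ⟨a, rfl⟩ := (hfg y).1 hy
    exact (Submodule.Quotient.mk_eq_zero _).2 ⟨a, rfl⟩)
  have hii : Function.Injective i' := by
    rw [injective_iff_map_eq_zero]
    intro b hb
    obtain ⟨y, rfl⟩ := hg b
    rw [hi'] at hb
    obtain ⟨a, ha⟩ := (Submodule.Quotient.mk_eq_zero _).1 hb
    rw [← hi ha]
    exact hfg.apply_apply_eq_zero _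
  have hps : Function.Surjective p' := by
    intro d
    obtain ⟨z, rfl⟩ := hp d
    exact ⟨N.mkQ z, rfl⟩
  have hex : Function.Exact i' p' := by
    intro z
    obtain ⟨z, rfl⟩ := N.mkQ_surjective z
    rw [hp', hip z]
    constructor
    · rintro ⟨y, rfl⟩
      exact ⟨g y, hi' y⟩
    · rintro ⟨b, hb⟩
      obtain ⟨y, rfl⟩ := hg b
      rw [hi'] at hb
      have : N.mkQ (i y - z) = 0 := by rw [map_sub, ← hb]; simp
      obtain ⟨a, ha⟩ := (Submodule.Quotient.mk_eq_zero _).1 this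
      refine ⟨y - f a, ?_⟩
      rw [map_sub, ← LinearMap.comp_apply, ha]
      abel
  obtain ⟨h1, hh1⟩ := hB.lift i' p' hii hps hex h
  obtain ⟨h2, hh2⟩ := hA.lift (i.comp f) N.mkQ (hi.comp hf) N.mkQ_surjective
    (LinearMap.exact_iff.2 (Submodule.ker_mkQ _)) h1
  refine ⟨h2, ?_⟩
  rw [← hh1, ← hh2]
  rfl

end
section
variable {R : Type u} [CommRing R] (C : Type u) [AddCommGroup C] [Module R C]

/-- modules with an infinite proper left resolution by C-injectives -/
def LL (L : ModuleCat.{u} R) : Prop :=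
  ∃ S : ModuleCat.{u} R → Prop, S L ∧ ∀ A, S A →
    (∀ X : ModuleCat.{u} R, Paper.IsCInjective R C X → LiftP (R := R) X A) ∧
    ∃ (X : ModuleCat.{u} R) (g : X →ₗ[R] A), Paper.IsCInjective R C X ∧ Function.Surjective g ∧
      S (ModuleCat.of R (LinearMap.ker g))

variable {C}
theorem LL.unfold {L : ModuleCat.{u} R} (h : LL C L) :
    (∀ X : ModuleCat.{u} R, Paper.IsCInjective R C X → LiftP (R := R) X L) ∧
    ∃ (X : ModuleCat.{u} R) (g : X →ₗ[R] L), Paper.IsCInjective R C X ∧ Function.Surjective g ∧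
      LL C (ModuleCat.of R (LinearMap.ker g)) := by
  obtain ⟨S, hL, hS⟩ := h
  obtain ⟨h1, X, g, hX, hg, hk⟩ := hS L hL
  exact ⟨h1, X, g, hX, hg, S, hk, hS⟩

theorem LL.of_equiv {A B : ModuleCat.{u} R} (e : A ≃ₗ[R] B) (h : LL C A) : LL C B := by
  refine ⟨fun B => ∃ A, LL C A ∧ Nonempty (A ≃ₗ[R] B), ⟨A, h, ⟨e⟩⟩, ?_⟩
  clear h e A B
  rintro B ⟨A, hA, ⟨e⟩⟩
  obtain ⟨h1, X, g, hX, hg, hk⟩ := hA.unfold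
  refine ⟨fun X hX => (h1 X hX).of_equiv e, X, e.toLinearMap.comp g, hX,
    e.surjective.comp hg, _, hk, ⟨LinearEquiv.ofEq _ _ (LinearEquiv.ker_comp e g).symm⟩⟩

theorem cinj_prod {X Y : Type u} [AddCommGroup X] [Module R X] [AddCommGroup Y] [Module R Y]
    (hX : Paper.IsCInjective R C X) (hY : Paper.IsCInjective R C Y) :
    Paper.IsCInjective R C (X × Y) := by
  obtain ⟨I, hI, ⟨e⟩⟩ := hX
  obtain ⟨J, hJ, ⟨e'⟩⟩ := hY
  refine ⟨ModuleCat.of R (I × J), ?_, ⟨(e.prodCongr e').trans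
    (LinearMap.prodEquiv R)⟩⟩
  constructor
  intro A B _ _ _ _ f hf g
  obtain ⟨h1, hh1⟩ := Module.Injective.out f hf ((LinearMap.fst R I J).comp g)
  obtain ⟨h2, hh2⟩ := Module.Injective.out f hf ((LinearMap.snd R I J).comp g)
  exact ⟨h1.prod h2, fun x => Prod.ext (hh1 x) (hh2 x)⟩

theorem cinj_equiv {X Y : Type u} [AddCommGroup X] [Module R X] [AddCommGroup Y] [Module R Y]
    (e : X ≃ₗ[R] Y) (hX : Paper.IsCInjective R C X) : Paper.IsCInjective R C Y := by
  obtain ⟨I, hI, ⟨e'⟩⟩ := hX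
  exact ⟨I, hI, ⟨e.symm.trans e'⟩⟩

theorem LL.extension {L : ModuleCat.{u} R} (A B : ModuleCat.{u} R) (hA : LL C A) (hB : LL C B)
    (f : A →ₗ[R] L) (g : L →ₗ[R] B) (hf : Function.Injective f) (hg : Function.Surjective g)
    (hfg : Function.Exact f g) : LL C L := by
  refine ⟨fun L => ∃ (A B : ModuleCat.{u} R) (f : A →ₗ[R] L) (g : L →ₗ[R] B), LL C A ∧ LL C B ∧
    Function.Injective f ∧ Function.Surjective g ∧ Function.Exact f g,
    ⟨A, B, f, g, hA, hB, hf, hg, hfg⟩, ?_⟩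
  clear hA hB hf hg hfg f g A B L
  rintro L ⟨A, B, f, g, hA, hB, hf, hg, hfg⟩
  obtain ⟨a1, X1, g1, hX1, hg1, hk1⟩ := hA.unfold
  obtain ⟨a2, X2, g2, hX2, hg2, hk2⟩ := hB.unfold
  refine ⟨fun X hX => LiftP.ext f g hf hg hfg (a1 X hX) (a2 X hX), ?_⟩
  obtain ⟨m, hm⟩ := (a1 X2 hX2).lift f g hf hg hfg g2
  have hm' : ∀ x, g (m x) = g2 x := LinearMap.congr_fun hm
  let p : (X1 × X2) →ₗ[R] L := (f.comp g1).coprod m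
  have hp : ∀ x, p x = f (g1 x.1) + m x.2 := fun x => rfl
  refine ⟨ModuleCat.of R (X1 × X2), p, cinj_prod hX1 hX2, ?_, ModuleCat.of R (LinearMap.ker g1),
    ModuleCat.of R (LinearMap.ker g2), ?_⟩
  · intro y
    obtain ⟨x2, hx2⟩ := hg2 (g y)
    obtain ⟨a, ha⟩ := (hfg (y - m x2)).1 (by rw [map_sub, hm', hx2, sub_self])
    obtain ⟨x1, rfl⟩ := hg1 a
    exact ⟨(x1, x2), by rw [hp, ha]; simp⟩
  · let i : LinearMap.ker g1 →ₗ[R] LinearMap.ker p :=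
      ((LinearMap.inl R X1 X2).comp (LinearMap.ker g1).subtype).codRestrict _ (by
        intro x
        have : g1 x.1 = 0 := x.2
        simp [LinearMap.mem_ker, hp, this])
    let q : LinearMap.ker p →ₗ[R] LinearMap.ker g2 :=
      ((LinearMap.snd R X1 X2).comp (LinearMap.ker p).subtype).codRestrict _ (by
        intro x
        have : f (g1 x.1.1) + m x.1.2 = 0 := x.2
        have := congrArg g this
        rw [map_add, hfg.apply_apply_eq_zero, zero_add, hm', map_zero] at this
        exact this)
    refine ⟨i, q, hk1, hk2, ?_, ?_, ?_⟩
    · intro x y h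
      exact Subtype.ext (congrArg (fun t => t.1.1) h)
    · rintro ⟨x, hx⟩
      have hx' : g2 x = 0 := hx
      obtain ⟨a, ha⟩ := (hfg (m x)).1 (by rw [hm', hx'])
      obtain ⟨x1, rfl⟩ := hg1 a
      exact ⟨⟨(-x1, x), by rw [LinearMap.mem_ker, hp]; simp [ha]⟩, rfl⟩
    · rintro ⟨⟨x1, x2⟩, hx⟩
      constructor
      · intro h
        have h0 : x2 = 0 := congrArg Subtype.val h
        subst h0
        have hx' : f (g1 x1) + m 0 = 0 := hx
        rw [map_zero, add_zero] at hx'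
        exact ⟨⟨x1, hf (by rw [hx', map_zero])⟩, rfl⟩
      · rintro ⟨y, hy⟩
        exact Subtype.ext (congrArg (fun t => t.1.2) hy).symm

theorem LL_of_GC (hCC : ∀ X Y : ModuleCat.{u} R, Paper.IsCInjective R C X →
    Paper.IsCInjective R C Y → LiftP (R := R) X Y) (N : ModuleCat.{u} R)
    (h : Paper.IsGCInjective R C N) : LL C N := by
  obtain ⟨Y, d, hY, hY', hex, hH, ι, hι, hιex⟩ := h
  refine ⟨fun A => ∃ (i : ℤ) (ι : A →ₗ[R] Y i), i ≤ 0 ∧ Function.Injective ι ∧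
    Function.Exact ι (d i), ⟨0, ι, le_rfl, hι, hιex⟩, ?_⟩
  clear hιex hι ι N
  rintro A ⟨i, ι, hi, hι, hιex⟩
  refine ⟨fun X hX => ?_, ?_⟩
  · refine LiftP.kernel ι (d i) hι hιex ?_ ?_
    · rcases hi.lt_or_eq with h | h
      · exact hCC _ _ hX (hY' i h)
      · exact liftP_inj (hY i h.ge)
    · intro h hh
      refine hH X hX i h (LinearMap.ext fun x => ?_)
      obtain ⟨y, hy⟩ := hh x
      rw [LinearMap.comp_apply, ← hy]
      exact (hex i).apply_apply_eq_zero y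
  · obtain ⟨i, rfl⟩ : ∃ j, i = j + 1 := ⟨i - 1, by omega⟩
    obtain ⟨g, hg⟩ := lift_factor ι hι (d i) (fun a => (hιex _).1 ((hex i).apply_apply_eq_zero a))
    refine ⟨Y i, g, hY' i (by omega), ?_, i, (LinearMap.ker g).subtype, by omega,
      Subtype.val_injective, ?_⟩
    · intro a
      obtain ⟨y, hy⟩ := (hex i (ι a)).1 (hιex.apply_apply_eq_zero a)
      exact ⟨y, hι (by rw [hg, hy])⟩
    · intro y
      constructor
      · intro h
        exact ⟨⟨y, hι (by rw [hg, h, map_zero])⟩, rfl⟩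
      · rintro ⟨⟨y, hy⟩, rfl⟩
        have : g y = 0 := hy
        rw [Submodule.subtype_apply, ← hg, this, map_zero]

theorem coresDim_equiv {P : ModuleCat.{u} R → Prop}
    (hP : ∀ X Y : ModuleCat.{u} R, Nonempty (X ≃ₗ[R] Y) → P X → P Y) (k : ℕ) :
    ∀ X Y : ModuleCat.{u} R, Nonempty (X ≃ₗ[R] Y) → Paper.CoresDimLE R P k X →
      Paper.CoresDimLE R P k Y := by
  induction k with
  | zero => exact hP
  | succ k ih =>
    rintro X Y ⟨e⟩ (h | ⟨Z, f, hZ, hf, h⟩)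
    · exact Or.inl (ih X Y ⟨e⟩ h)
    · refine Or.inr ⟨Z, f.comp e.symm.toLinearMap, hZ, hf.comp e.symm.injective, ih _ _ ⟨?_⟩ h⟩
      exact Submodule.quotEquivOfEq _ _ (LinearEquiv.range_comp e.symm f).symm

theorem coresDim_mk {P : ModuleCat.{u} R → Prop}
    (hP : ∀ X Y : ModuleCat.{u} R, Nonempty (X ≃ₗ[R] Y) → P X → P Y) {k : ℕ}
    {M X N : ModuleCat.{u} R} (f : M →ₗ[R] X) (g : X →ₗ[R] N) (hf : Function.Injective f)
    (hg : Function.Surjective g) (hfg : Function.Exact f g) (hX : P X)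
    (h : Paper.CoresDimLE R P k N) : Paper.CoresDimLE R P (k + 1) M := by
  refine Or.inr ⟨X, f, hX, hf, coresDim_equiv hP k _ _ ⟨?_⟩ h⟩
  exact ((Submodule.quotEquivOfEq _ _ (LinearMap.exact_iff.1 hfg).symm).trans
    (g.quotKerEquivOfSurjective hg)).symm

theorem cinj_iso : ∀ X Y : ModuleCat.{u} R, Nonempty (X ≃ₗ[R] Y) →
    Paper.IsCInjective R C X → Paper.IsCInjective R C Y := fun _ _ ⟨e⟩ h => cinj_equiv e h

theorem exists_LW (hCC : ∀ X Y : ModuleCat.{u} R, Paper.IsCInjective R C X →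
    Paper.IsCInjective R C Y → LiftP (R := R) X Y) (g : ℕ) :
    ∀ M : ModuleCat.{u} R, Paper.CoresDimLE R (fun N => Paper.IsGCInjective R C N) g M →
    ∃ (W : ModuleCat.{u} R) (k : ℕ) (p : W →ₗ[R] M), Function.Surjective p ∧
      LL C (ModuleCat.of R (LinearMap.ker p)) ∧
      Paper.CoresDimLE R (fun N => Paper.IsCInjective R C N) k W := by
  induction g with
  | zero =>
    intro M hM
    obtain ⟨-, X, g, hX, hg, hk⟩ := (LL_of_GC hCC M hM).unfold
    exact ⟨X, 0, g, hg, hk, hX⟩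
  | succ g ih =>
    rintro M (h | ⟨G, f, hG, hf, h⟩)
    · exact ih M h
    · obtain ⟨W1, k, p, hp, hL1, hW1⟩ := ih _ h
      replace hG := LL_of_GC hCC G hG
      let V : Submodule R (G × W1) := LinearMap.ker
        (((LinearMap.range f).mkQ.comp (LinearMap.fst R G W1)) - p.comp (LinearMap.snd R G W1))
      have hV : ∀ v, v ∈ V ↔ (LinearMap.range f).mkQ v.1 = p v.2 := fun v =>
        (sub_eq_zero (a := (LinearMap.range f).mkQ v.1) (b := p v.2))
      have hVL : LL C (ModuleCat.of R V) := by
        refine LL.extension (ModuleCat.of R (LinearMap.ker p)) G hL1 hG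
          (((LinearMap.inr R G W1).comp (LinearMap.ker p).subtype).codRestrict V ?_)
          ((LinearMap.fst R G W1).comp V.subtype) ?_ ?_ ?_
        · intro x
          rw [hV]
          exact (map_zero _).trans x.2.symm
        · intro x y h
          exact Subtype.ext (congrArg (fun t => t.1.2) h)
        · intro x
          obtain ⟨w, hw⟩ := hp ((LinearMap.range f).mkQ x)
          exact ⟨⟨(x, w), (hV _).2 hw.symm⟩, rfl⟩
        · rintro ⟨⟨x, w⟩, hx⟩
          constructor
          · intro h
            have h0 : x = 0 := h
            subst h0
            exact ⟨⟨w, ((hV _).1 hx).symm.trans (map_zero _)⟩, rfl⟩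
          · rintro ⟨y, hy⟩
            exact (congrArg (fun t => t.1.1) hy).symm
      obtain ⟨-, X, q, hX, hq, hk⟩ := hVL.unfold
      let r : X →ₗ[R] W1 := (LinearMap.snd R G W1).comp (V.subtype.comp q)
      have hr : Function.Surjective r := by
        intro w
        obtain ⟨x, hx⟩ := (LinearMap.range f).mkQ_surjective (p w)
        obtain ⟨y, hy⟩ := hq ⟨(x, w), (hV _).2 hx⟩
        exact ⟨y, congrArg (fun t => t.1.2) hy⟩
      obtain ⟨s, hs⟩ := lift_factor f hf
        (((LinearMap.fst R G W1).comp (V.subtype.comp q)).comp (LinearMap.ker r).subtype) (by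
          rintro ⟨x, hx⟩
          have h1 : (q x).1.2 = 0 := hx
          have h2 := (hV _).1 (q x).2
          rw [h1, map_zero] at h2
          exact (Submodule.Quotient.mk_eq_zero _).1 h2)
      have hs' : ∀ x, f (s x) = (q x.1).1.1 := hs
      refine ⟨ModuleCat.of R (LinearMap.ker r), k + 1, s, ?_, ?_, ?_⟩
      · intro m
        obtain ⟨x, hx⟩ := hq ⟨(f m, 0), (hV _).2 (by
          rw [map_zero]; exact (Submodule.Quotient.mk_eq_zero _).2 ⟨m, rfl⟩)⟩
        have hx2 : (q x).1.2 = 0 := congrArg (fun t => t.1.2) hx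
        refine ⟨⟨x, hx2⟩, hf ?_⟩
        rw [hs']
        exact congrArg (fun t => t.1.1) hx
      · let z : LinearMap.ker q →ₗ[R] LinearMap.ker s :=
          { toFun := fun x => ⟨⟨x.1, by
              have : q x.1 = 0 := x.2
              change (q x.1).1.2 = 0
              rw [this]; rfl⟩, by
              have : q x.1 = 0 := x.2
              refine hf ?_
              rw [hs', this, map_zero]; rfl⟩
            map_add' := fun _ _ => rfl
            map_smul' := fun _ _ => rfl }
        refine LL.of_equiv (LinearEquiv.ofBijective z ⟨?_, ?_⟩) hk
        · intro x y h
          exact Subtype.ext (congrArg (fun t => t.1.1) h)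
        · rintro ⟨⟨x, hx⟩, hx'⟩
          refine ⟨⟨x, Subtype.ext (Prod.ext ?_ hx)⟩, rfl⟩
          have h1 := hs' ⟨x, hx⟩
          have h2 : s ⟨x, hx⟩ = 0 := hx'
          rw [h2, map_zero] at h1
          exact h1.symm
      · exact coresDim_mk cinj_iso (LinearMap.ker r).subtype r Subtype.val_injective hr
          (LinearMap.exact_iff.2 (by simp)) hX hW1
end

end Part8
end PAux

namespace PAux
section Part9
open CategoryTheory Opposite Limits TensorProduct
section
variable {R : Type u} [CommRing R]

/-- tensor evaluation -/
noncomputable def evm (Z C I : Type u) [AddCommGroup Z] [Module R Z] [AddCommGroup C] [Module R C]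
    [AddCommGroup I] [Module R I] : Z ⊗[R] (C →ₗ[R] I) →ₗ[R] ((Z →ₗ[R] C) →ₗ[R] I) :=
  TensorProduct.lift
    (LinearMap.mk₂ R (fun z f => f.comp (LinearMap.applyₗ z))
      (fun _ _ _ => LinearMap.ext fun _ => by simp)
      (fun _ _ _ => LinearMap.ext fun _ => by simp)
      (fun _ _ _ => LinearMap.ext fun _ => by simp)
      (fun _ _ _ => LinearMap.ext fun _ => by simp))

variable {Z C I : Type u} [AddCommGroup Z] [Module R Z] [AddCommGroup C] [Module R C]
    [AddCommGroup I] [Module R I]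

theorem evm_tmul (z : Z) (f : C →ₗ[R] I) (φ : Z →ₗ[R] C) : evm Z C I (z ⊗ₜ f) φ = f (φ z) := rfl

theorem evm_nat {Z' : Type u} [AddCommGroup Z'] [Module R Z'] (a : Z →ₗ[R] Z')
    (t : Z ⊗[R] (C →ₗ[R] I)) (φ : Z' →ₗ[R] C) :
    evm Z' C I (a.rTensor _ t) φ = evm Z C I t (φ.comp a) := by
  induction t with
  | zero => simp
  | tmul z f => rfl
  | add x y hx hy => simp only [map_add, LinearMap.add_apply, hx, hy]

theorem fin_tmul (n : ℕ) {W : Type u} [AddCommGroup W] [Module R W] (t : (Fin n → R) ⊗[R] W) :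
    ∃ w : Fin n → W, t = ∑ i, (Pi.single i (1 : R)) ⊗ₜ[R] w i := by
  classical
  induction t with
  | zero => exact ⟨0, by simp⟩
  | tmul z f =>
    refine ⟨fun i => z i • f, ?_⟩
    conv_lhs => rw [← Finset.univ_sum_single z]
    rw [TensorProduct.sum_tmul]
    refine Finset.sum_congr rfl fun i _ => ?_
    rw [TensorProduct.tmul_smul, TensorProduct.smul_tmul', ← Pi.single_smul, smul_eq_mul, mul_one]
  | add x y hx hy =>
    obtain ⟨w, rfl⟩ := hx
    obtain ⟨v, rfl⟩ := hy
    exact ⟨w + v, by simp [TensorProduct.tmul_add, Finset.sum_add_distrib]⟩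

theorem evm_fin (n : ℕ) : Function.Bijective (evm (R := R) (Fin n → R) C I) := by
  classical
  constructor
  · rw [injective_iff_map_eq_zero]
    intro t ht
    obtain ⟨w, rfl⟩ := fin_tmul n t
    have : ∀ i, w i = 0 := by
      intro j
      refine LinearMap.ext fun c => ?_
      have := LinearMap.congr_fun ht ((LinearMap.toSpanSingleton R C c).comp (LinearMap.proj j))
      rw [map_sum, LinearMap.sum_apply] at this
      simp only [evm_tmul] at this
      rw [Finset.sum_eq_single j] at this
      · simpa using this
      · intro i _ hij
        simp [Pi.single_eq_of_ne hij.symm]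
      · simp
    simp [this]
  · intro h
    let a : Fin n → C →ₗ[R] ((Fin n → R) →ₗ[R] C) := fun i =>
      { toFun := fun c => (LinearMap.toSpanSingleton R C c).comp (LinearMap.proj i)
        map_add' := fun _ _ => LinearMap.ext fun _ => by simp
        map_smul' := fun _ _ => LinearMap.ext fun _ => by simp [smul_smul, mul_comm] }
    refine ⟨∑ i, (Pi.single i (1 : R)) ⊗ₜ[R] (h.comp (a i)), LinearMap.ext fun φ => ?_⟩
    rw [map_sum, LinearMap.sum_apply]
    simp only [evm_tmul, LinearMap.comp_apply]
    rw [← map_sum]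
    congr 1
    refine LinearMap.ext fun x => ?_
    conv_rhs => rw [← Finset.univ_sum_single x]
    rw [LinearMap.sum_apply, map_sum]
    refine Finset.sum_congr rfl fun i _ => ?_
    change x i • φ _ = _
    rw [← map_smul, ← Pi.single_smul, smul_eq_mul, mul_one]

theorem exists_pres [IsNoetherianRing R] [Module.Finite R Z] :
    ∃ (n m : ℕ) (π : (Fin n → R) →ₗ[R] Z) (q : (Fin m → R) →ₗ[R] (Fin n → R)),
      Function.Surjective π ∧ Function.Exact q π := by
  obtain ⟨n, π, hπ⟩ := Module.Finite.exists_fin' R Z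
  obtain ⟨m, q, hq⟩ := Module.Finite.exists_fin' R (LinearMap.ker π)
  refine ⟨n, m, π, (LinearMap.ker π).subtype.comp q, hπ, fun x => ⟨fun h => ?_, ?_⟩⟩
  · obtain ⟨y, hy⟩ := hq ⟨x, h⟩
    exact ⟨y, congrArg Subtype.val hy⟩
  · rintro ⟨y, rfl⟩
    exact (q y).2

theorem evm_bij [IsNoetherianRing R] [Module.Finite R Z] (hI : Module.Injective R I) :
    Function.Bijective (evm (R := R) Z C I) := by
  obtain ⟨n, m, π, q, hπ, hq⟩ := exists_pres (R := R) (Z := Z)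
  constructor
  · rw [injective_iff_map_eq_zero]
    intro t ht
    obtain ⟨s, rfl⟩ := LinearMap.rTensor_surjective (C →ₗ[R] I) hπ t
    obtain ⟨h, hh⟩ := inj_factor hI (LinearMap.lcomp R C q) (evm _ C I s) (by
      intro φ hφ
      obtain ⟨ψ, hψ⟩ := surj_factor π hπ φ (by
        intro x hx
        obtain ⟨y, rfl⟩ := (hq x).1 hx
        exact LinearMap.congr_fun hφ y)
      have : φ = ψ.comp π := LinearMap.ext fun x => (hψ x).symm
      rw [this]
      have h0 := LinearMap.congr_fun ht ψ
      rw [evm_nat] at h0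
      exact h0)
    obtain ⟨v, rfl⟩ := (evm_fin m).2 h
    have : s = q.rTensor _ v := by
      apply (evm_fin n).1
      refine LinearMap.ext fun φ => ?_
      rw [evm_nat]
      exact (hh φ).symm
    rw [this, ← LinearMap.comp_apply, ← LinearMap.rTensor_comp]
    have : π.comp q = 0 := LinearMap.ext fun x => hq.apply_apply_eq_zero x
    rw [this]; simp
  · intro h
    obtain ⟨h', hh'⟩ := inj_factor hI (LinearMap.lcomp R C π) h (by
      intro φ hφ
      have : φ = 0 := LinearMap.ext fun z => by
        obtain ⟨x, rfl⟩ := hπ z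
        exact LinearMap.congr_fun hφ x
      rw [this, map_zero])
    obtain ⟨s, rfl⟩ := (evm_fin n).2 h'
    refine ⟨π.rTensor _ s, LinearMap.ext fun φ => ?_⟩
    rw [evm_nat]
    exact hh' φ

/-- first consequence : C tensor Hom(C,I) is I -/
theorem tens_cinj [IsNoetherianRing R] [Module.Finite R C] (hI : Module.Injective R I)
    (hb : Function.Bijective (fun r : R => (r • LinearMap.id : C →ₗ[R] C))) :
    Nonempty (C ⊗[R] (C →ₗ[R] I) ≃ₗ[R] I) := by
  refine ⟨LinearEquiv.ofBijective ((LinearMap.applyₗ LinearMap.id).comp (evm C C I)) ?_⟩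
  constructor
  · rw [injective_iff_map_eq_zero]
    intro t ht
    refine (injective_iff_map_eq_zero (evm C C I)).1 (evm_bij hI).1 t (LinearMap.ext fun φ => ?_)
    obtain ⟨r, rfl⟩ := hb.2 φ
    have : evm C C I t LinearMap.id = 0 := ht
    rw [map_smul, this, smul_zero]
    rfl
  · intro x
    let h : R →ₗ[R] (C →ₗ[R] C) := LinearMap.toSpanSingleton R _ LinearMap.id
    let e := LinearEquiv.ofBijective h hb
    obtain ⟨t, ht⟩ := (evm_bij (R := R) (Z := C) (C := C) hI).2
      ((LinearMap.toSpanSingleton R I x).comp e.symm.toLinearMap)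
    refine ⟨t, ?_⟩
    change evm C C I t LinearMap.id = x
    rw [ht]
    have : e.symm LinearMap.id = 1 := by
      rw [LinearEquiv.symm_apply_eq]
      exact (one_smul R _).symm
    simp [this]

/-- finitely generated modules without extensions by C -/
def SZ (K : Cores R C) (Z : Type u) [AddCommGroup Z] [Module R Z] : Prop :=
  Module.Finite R Z ∧ ∀ (n : ℕ) (f : Z →ₗ[R] K.J (n + 1)), (K.d (n + 1)).comp f = 0 →
    ∃ g : Z →ₗ[R] K.J n, (K.d n).comp g = f

variable {K : Cores R C}

theorem SZ.ker_aux (hK : ∀ n, Module.Injective R (K.J n))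
    (hZ : SZ K Z) (n : ℕ) (π : (Fin n → R) →ₗ[R] Z) (hπ : Function.Surjective π)
    (m : ℕ) (f : LinearMap.ker π →ₗ[R] K.J m) (hf : (K.d m).comp f = 0) :
    ∃ F : (Fin n → R) →ₗ[R] K.J m, (∀ x, F x.1 = f x) ∧ (K.d m).comp F = 0 := by
  obtain ⟨F, hF⟩ := (hK m).out (LinearMap.ker π).subtype Subtype.val_injective f
  have hF' : ∀ x : LinearMap.ker π, F x.1 = f x := hF
  obtain ⟨h, hh⟩ := surj_factor π hπ ((K.d m).comp F) (by
    intro x hx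
    have := LinearMap.congr_fun hf ⟨x, hx⟩
    rw [LinearMap.comp_apply, ← hF'] at this
    exact this)
  obtain ⟨g, hg⟩ := hZ.2 m h (by
    refine LinearMap.ext fun z => ?_
    obtain ⟨x, rfl⟩ := hπ z
    rw [LinearMap.comp_apply, hh]
    exact (K.ex m).apply_apply_eq_zero _)
  refine ⟨F - g.comp π, fun x => ?_, LinearMap.ext fun x => ?_⟩
  · have : π x.1 = 0 := x.2
    simp [hF', this]
  · have := LinearMap.congr_fun hg (π x)
    rw [hh] at this
    simp only [LinearMap.comp_apply, LinearMap.sub_apply, map_sub] at this ⊢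
    rw [this, sub_self]; rfl

theorem SZ.ker [IsNoetherianRing R] (hK : ∀ n, Module.Injective R (K.J n))
    (hZ : SZ K Z) (n : ℕ) (π : (Fin n → R) →ₗ[R] Z)
    (hπ : Function.Surjective π) : SZ K (LinearMap.ker π) := by
  refine ⟨inferInstance, fun m f hf => ?_⟩
  obtain ⟨F, hF, hF0⟩ := SZ.ker_aux hK hZ n π hπ (m + 1) f hf
  obtain ⟨G, hG⟩ := lift_factor (LinearMap.range (K.d m)).subtype Subtype.val_injective F (fun x => by
    exact ⟨⟨F x, ((K.ex m) _).1 (LinearMap.congr_fun hF0 x)⟩, rfl⟩)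
  obtain ⟨H, hH⟩ := Module.projective_lifting_property (LinearMap.rangeRestrict (K.d m)) G
    (LinearMap.surjective_rangeRestrict _)
  refine ⟨H.comp (LinearMap.ker π).subtype, LinearMap.ext fun x => ?_⟩
  rw [← hF, ← hG, ← hH]
  rfl

theorem SZ.restr (hK : ∀ n, Module.Injective R (K.J n)) (hZ : SZ K Z) (n : ℕ) (π : (Fin n → R) →ₗ[R] Z)
    (hπ : Function.Surjective π) (φ : LinearMap.ker π →ₗ[R] C) :
    ∃ ψ : (Fin n → R) →ₗ[R] C, ∀ x, ψ x.1 = φ x := by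
  obtain ⟨F, hF, hF0⟩ := SZ.ker_aux hK hZ n π hπ 0 (K.i.comp φ)
    (LinearMap.ext fun x => K.e0.apply_apply_eq_zero _)
  obtain ⟨ψ, hψ⟩ := lift_factor K.i K.hi F (fun x => (K.e0 _).1 (LinearMap.congr_fun hF0 x))
  exact ⟨ψ, fun x => K.hi ((hψ _).trans (hF x))⟩

/-- vanishing of Tor against the class SZ -/
def TV (K : Cores R C) (W : Type u) [AddCommGroup W] [Module R W] : Prop :=
  ∀ (Z : ModuleCat.{u} R), SZ K Z → ∀ (n : ℕ) (π : (Fin n → R) →ₗ[R] Z), Function.Surjective π →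
    Function.Injective ((LinearMap.ker π).subtype.rTensor W)

theorem TV_cinj [IsNoetherianRing R] (hK : ∀ n, Module.Injective R (K.J n))
    (hI : Module.Injective R I) : TV K (C →ₗ[R] I) := by
  intro Z hZ n π hπ
  rw [injective_iff_map_eq_zero]
  intro t ht
  refine (injective_iff_map_eq_zero (evm _ C I)).1 (evm_bij hI).1 t (LinearMap.ext fun φ => ?_)
  obtain ⟨ψ, hψ⟩ := SZ.restr hK hZ n π hπ φ
  have := evm_nat (LinearMap.ker π).subtype t ψ
  rw [ht, map_zero] at this
  have h2 : φ = ψ.comp (LinearMap.ker π).subtype := LinearMap.ext fun x => (hψ x).symm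
  rw [h2]
  exact this.symm

theorem TV.of_equiv {W W' : Type u} [AddCommGroup W] [Module R W] [AddCommGroup W'] [Module R W']
    (e : W ≃ₗ[R] W') (h : TV K W) : TV K W' := by
  intro Z hZ n π hπ
  have h1 := h Z hZ n π hπ
  rw [injective_iff_map_eq_zero] at h1 ⊢
  intro t ht
  have h2 : (LinearMap.ker π).subtype.rTensor W (e.symm.toLinearMap.lTensor _ t) = 0 := by
    rw [← LinearMap.comp_apply, LinearMap.rTensor_comp_lTensor, ← LinearMap.lTensor_comp_rTensor,
      LinearMap.comp_apply, ht, map_zero]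
  have h3 := h1 _ h2
  exact (LinearEquiv.lTensor _ e.symm).injective (h3.trans (map_zero _).symm)

section seq
variable {W X V : Type u} [AddCommGroup W] [Module R W] [AddCommGroup X] [Module R X]
  [AddCommGroup V] [Module R V]

theorem TV.tens_inj (f : W →ₗ[R] X) (g : X →ₗ[R] V) (hf : Function.Injective f)
    (hg : Function.Surjective g) (hfg : Function.Exact f g) (hV : TV K V) (hZ : SZ K Z) : Function.Injective (f.lTensor Z) := by
  obtain ⟨n, π, hπ⟩ := haveI := hZ.1; Module.Finite.exists_fin' R Z
  have hV' := hV (ModuleCat.of R Z) hZ n π hπ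
  let N := LinearMap.ker π
  have hex : Function.Exact N.subtype π := LinearMap.exact_iff.2 (by simp [N])
  rw [injective_iff_map_eq_zero]
  intro t ht
  obtain ⟨s, rfl⟩ := LinearMap.rTensor_surjective W hπ t
  have h1 : π.rTensor X (f.lTensor _ s) = 0 := by
    rw [← ht, ← LinearMap.comp_apply, ← LinearMap.comp_apply, LinearMap.rTensor_comp_lTensor,
      LinearMap.lTensor_comp_rTensor]
  obtain ⟨v, hv⟩ := (rTensor_exact X hex hπ _).1 h1
  have h2 : g.lTensor N v = 0 := by
    apply hV'
    rw [map_zero, ← LinearMap.comp_apply, LinearMap.rTensor_comp_lTensor,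
      ← LinearMap.lTensor_comp_rTensor, LinearMap.comp_apply]
    refine (congrArg _ hv).trans ?_
    exact (lTensor_exact _ hfg hg).apply_apply_eq_zero s
  obtain ⟨w, hw⟩ := (lTensor_exact N hfg hg v).1 h2
  have h3 : N.subtype.rTensor W w = s := by
    apply Module.Flat.lTensor_preserves_injective_linearMap (M := (Fin n → R)) f hf
    rw [← hv, ← hw, ← LinearMap.comp_apply, ← LinearMap.comp_apply, LinearMap.rTensor_comp_lTensor,
      LinearMap.lTensor_comp_rTensor]
  rw [← h3]
  exact (rTensor_exact W hex hπ).apply_apply_eq_zero w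

theorem TV.kernel [IsNoetherianRing R] (hK : ∀ n, Module.Injective R (K.J n))
    (f : W →ₗ[R] X) (g : X →ₗ[R] V) (hf : Function.Injective f)
    (hg : Function.Surjective g) (hfg : Function.Exact f g) (hX : TV K X) (hV : TV K V) : TV K W := by
  intro Z hZ n π hπ
  have h1 := TV.tens_inj f g hf hg hfg hV (SZ.ker hK hZ n π hπ)
  have h2 := hX Z hZ n π hπ
  have h3 := h2.comp h1
  rw [← LinearMap.coe_comp, LinearMap.rTensor_comp_lTensor, ← LinearMap.lTensor_comp_rTensor,
    LinearMap.coe_comp] at h3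
  exact h3.of_comp
end seq
end

end Part9
end PAux

namespace PAux
section Part10
open CategoryTheory Opposite Limits TensorProduct
section
variable {R : Type u} [CommRing R]

theorem ID_seq {A B D : Type u} [AddCommGroup A] [Module R A] [AddCommGroup B] [Module R B]
    [AddCommGroup D] [Module R D] (f : A →ₗ[R] B) (g : B →ₗ[R] D) (hf : Function.Injective f)
    (hg : Function.Surjective g) (hfg : Function.Exact f g) (hB : Module.Injective R B) (n : ℕ) :
    HasInjectiveDimensionLT (ModuleCat.of R D) (n + 1) ↔
      HasInjectiveDimensionLT (ModuleCat.of R A) (n + 2) := by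
  have h := ModuleCat.shortComplex_shortExact
    (ModuleCat.shortComplexOfCompEqZero f g hfg.linearMap_comp_eq_zero) hfg hf hg
  have hB' : Injective (ModuleCat.of R B) := (Module.injective_iff_injective_object R B).1 hB
  exact h.hasInjectiveDimensionLT_X₃_iff n hB'

theorem ID_one {A : Type u} [AddCommGroup A] [Module R A] :
    HasInjectiveDimensionLT (ModuleCat.of R A) 1 ↔ Module.Injective R A := by
  rw [Module.injective_iff_injective_object R A]
  exact (injective_iff_hasInjectiveDimensionLT_one (X := ModuleCat.of R A)).symm

theorem ID_retract {A B : Type u} [AddCommGroup A] [Module R A] [AddCommGroup B] [Module R B]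
    (i : A →ₗ[R] B) (p : B →ₗ[R] A) (h : p.comp i = LinearMap.id) (n : ℕ)
    (hB : HasInjectiveDimensionLT (ModuleCat.of R B) n) :
    HasInjectiveDimensionLT (ModuleCat.of R A) n :=
  Retract.hasInjectiveDimensionLT (Y := ModuleCat.of R B)
    ⟨ModuleCat.ofHom i, ModuleCat.ofHom p, ModuleCat.hom_ext h⟩ n

theorem ID_cores (k : ℕ) : ∀ M : ModuleCat.{u} R,
    Paper.CoresDimLE R (fun N => Module.Injective R N) k M →
      HasInjectiveDimensionLT (ModuleCat.of R M) (k + 1) := by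
  induction k with
  | zero => exact fun M h => ID_one.2 h
  | succ k ih =>
    rintro M (h | ⟨X, f, hX, hf, h⟩)
    · have := ih M h
      exact hasInjectiveDimensionLT_of_ge _ (k + 1) _ (Nat.le_succ _)
    · exact (ID_seq f (LinearMap.range f).mkQ hf (Submodule.mkQ_surjective _)
        (LinearMap.exact_iff.2 (Submodule.ker_mkQ _)) hX k).1 (ih _ h)

variable {C : Type u} [AddCommGroup C] [Module R C] {K : Cores R C}

theorem fin_injective (n : ℕ) {I : Type u} [AddCommGroup I] [Module R I]
    (hI : Module.Injective R I) : Module.Injective R ((Fin n → R) →ₗ[R] I) := by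
  constructor
  intro A B _ _ _ _ f hf g
  have hf' := Module.Flat.lTensor_preserves_injective_linearMap (M := (Fin n → R)) f hf
  obtain ⟨k, hk⟩ := hI.out _ hf' (TensorProduct.lift g.flip)
  refine ⟨(TensorProduct.curry k).flip, fun x => LinearMap.ext fun y => ?_⟩
  exact hk (y ⊗ₜ x)

/-- extending along a tensor-injective map -/
theorem hom_ext_tens {X Z P J : Type u} [AddCommGroup X] [Module R X] [AddCommGroup Z] [Module R Z]
    [AddCommGroup P] [Module R P] [AddCommGroup J] [Module R J] (hJ : Module.Injective R J)
    (i : Z →ₗ[R] P) (hi : Function.Injective (i.rTensor X)) (h : X →ₗ[R] (Z →ₗ[R] J)) :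
    ∃ h' : X →ₗ[R] (P →ₗ[R] J), ∀ x z, h' x (i z) = h x z := by
  obtain ⟨k, hk⟩ := hJ.out _ hi (TensorProduct.lift h.flip)
  exact ⟨(TensorProduct.curry k).flip, fun x z => hk (z ⊗ₜ x)⟩

theorem TV_of_cinj [IsNoetherianRing R] (hK : ∀ n, Module.Injective R (K.J n))
    {X : Type u} [AddCommGroup X] [Module R X]
    (hX : Paper.IsCInjective R C X) : TV K X := by
  obtain ⟨I, hI, ⟨e⟩⟩ := hX
  exact (TV_cinj hK hI).of_equiv e.symm

theorem hCC_of [IsNoetherianRing R] (hK : ∀ n, Module.Injective R (K.J n)) (hC : SZ K C)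
    (X Y : ModuleCat.{u} R) (hX : Paper.IsCInjective R C X) (hY : Paper.IsCInjective R C Y) :
    LiftP (R := R) X Y := by
  obtain ⟨J, hJ, ⟨e⟩⟩ := hY
  refine LiftP.of_equiv e.symm ?_
  obtain ⟨n, π, hπ⟩ := haveI := hC.1; Module.Finite.exists_fin' R C
  refine LiftP.kernel (LinearMap.lcomp R J π) (LinearMap.lcomp R J (LinearMap.ker π).subtype)
    ?_ ?_ (liftP_inj (fin_injective n hJ)) ?_
  · intro a b h
    refine LinearMap.ext fun c => ?_
    obtain ⟨x, rfl⟩ := hπ c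
    exact LinearMap.congr_fun h x
  · intro f
    constructor
    · intro h
      obtain ⟨k, hk⟩ := surj_factor π hπ f (fun x hx => LinearMap.congr_fun h ⟨x, hx⟩)
      exact ⟨k, LinearMap.ext hk⟩
    · rintro ⟨k, rfl⟩
      refine LinearMap.ext fun x => ?_
      have : π x.1 = 0 := x.2
      simp [this]
  · intro h _
    obtain ⟨h', hh⟩ := hom_ext_tens hJ _ (TV_of_cinj hK hX (ModuleCat.of R C) hC n π hπ) h
    exact ⟨h', LinearMap.ext fun x => LinearMap.ext fun z => hh x z⟩

theorem tens_fin [IsNoetherianRing R] (hK : ∀ n, Module.Injective R (K.J n)) (hC : SZ K C)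
    (hb : Function.Bijective (fun r : R => (r • LinearMap.id : C →ₗ[R] C))) (k : ℕ) :
    ∀ W : ModuleCat.{u} R, Paper.CoresDimLE R (fun N => Paper.IsCInjective R C N) k W →
      TV K W ∧ HasInjectiveDimensionLT (ModuleCat.of R (C ⊗[R] W)) (k + 1) := by
  have := hC.1
  have key : ∀ X : ModuleCat.{u} R, Paper.IsCInjective R C X → Module.Injective R (C ⊗[R] X) := by
    rintro X ⟨I, hI, ⟨e⟩⟩
    obtain ⟨e'⟩ := tens_cinj hI hb
    exact injective_of_equiv ((LinearEquiv.lTensor C e).trans e').symm hI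
  induction k with
  | zero => exact fun W h => ⟨TV_of_cinj hK h, ID_one.2 (key W h)⟩
  | succ k ih =>
    rintro W (h | ⟨X, f, hX, hf, h⟩)
    · obtain ⟨h1, h2⟩ := ih W h
      exact ⟨h1, hasInjectiveDimensionLT_of_ge _ (k + 1) _ (Nat.le_succ _)⟩
    · obtain ⟨h1, h2⟩ := ih _ h
      have hex : Function.Exact f (LinearMap.range f).mkQ :=
        LinearMap.exact_iff.2 (Submodule.ker_mkQ _)
      refine ⟨TV.kernel hK f (LinearMap.range f).mkQ hf (Submodule.mkQ_surjective _) hex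
        (TV_of_cinj hK hX) h1, ?_⟩
      exact (ID_seq (f.lTensor C) ((LinearMap.range f).mkQ.lTensor C)
        (TV.tens_inj f (LinearMap.range f).mkQ hf (Submodule.mkQ_surjective _) hex h1 hC)
        (LinearMap.lTensor_surjective C (Submodule.mkQ_surjective _))
        (lTensor_exact C hex (Submodule.mkQ_surjective _)) (key X hX) k).1 h2

/-- stage of a resolution of C -/
structure St (K : Cores R C) where
  Z : ModuleCat.{u} R
  P : ModuleCat.{u} R
  i : Z →ₗ[R] P
  hi : Function.Injective i
  hZ : SZ K Z
  hT : ∀ X : ModuleCat.{u} R, TV K X → Function.Injective (i.rTensor X)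

theorem St.ex (s : St K) : ∃ (n : ℕ) (π : (Fin n → R) →ₗ[R] s.Z), Function.Surjective π :=
  haveI := s.hZ.1
  Module.Finite.exists_fin' R s.Z

/-- rank -/
noncomputable def St.rk (s : St K) : ℕ := s.ex.choose
/-- cover -/
noncomputable def St.pm (s : St K) : (Fin s.rk → R) →ₗ[R] s.Z := s.ex.choose_spec.choose
theorem St.pm_surj (s : St K) : Function.Surjective s.pm := s.ex.choose_spec.choose_spec

/-- next stage -/
noncomputable def St.next [IsNoetherianRing R] (hK : ∀ n, Module.Injective R (K.J n)) (s : St K) :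
    St K where
  Z := ModuleCat.of R (LinearMap.ker s.pm)
  P := ModuleCat.of R (Fin s.rk → R)
  i := (LinearMap.ker s.pm).subtype
  hi := Subtype.val_injective
  hZ := SZ.ker hK s.hZ _ _ s.pm_surj
  hT := fun _ hX => hX s.Z s.hZ _ s.pm s.pm_surj

/-- all stages -/
noncomputable def stq [IsNoetherianRing R] (hK : ∀ n, Module.Injective R (K.J n)) (hC : SZ K C) :
    ℕ → St K
  | 0 => ⟨ModuleCat.of R C, ModuleCat.of R C, LinearMap.id, Function.injective_id, hC,
      fun X _ => by rw [LinearMap.rTensor_id]; exact Function.injective_id⟩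
  | n + 1 => (stq hK hC n).next hK

theorem GC_of_C [IsNoetherianRing R] (hK : ∀ n, Module.Injective R (K.J n)) (hC : SZ K C)
    (N : ModuleCat.{u} R) (hN : Paper.IsCInjective R C N) : Paper.IsGCInjective R C N := by
  obtain ⟨J, hJ, ⟨e⟩⟩ := hN
  let s := stq hK hC
  let p : ∀ n, (s (n + 1)).P →ₗ[R] (s n).Z := fun n => (s n).pm
  have hp : ∀ n, Function.Surjective (p n) := fun n => (s n).pm_surj
  have hpk : ∀ n y, p n y = 0 → ∃ z, (s (n + 1)).i z = y := fun n y h => ⟨⟨y, h⟩, rfl⟩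
  have hpk' : ∀ n z, p n ((s (n + 1)).i z) = 0 := fun n z => z.2
  let δ : ∀ n, (s (n + 1)).P →ₗ[R] (s n).P := fun n => (s n).i.comp (p n)
  let U : ℕ → ModuleCat.{u} R := fun n => ModuleCat.of R ((s n).P →ₗ[R] J)
  let D : ∀ n, U n →ₗ[R] U (n + 1) := fun n => LinearMap.lcomp R J (δ n)
  have hU : ∀ n, Module.Injective R (U (n + 1)) := fun n => fin_injective _ hJ
  have hDD : ∀ n x, D (n + 1) (D n x) = 0 := fun n x => LinearMap.ext fun y => by
    change x ((s n).i (p n ((s (n + 1)).i (p (n + 1) y)))) = 0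
    rw [hpk', map_zero, map_zero]
  -- factorization
  have fac : ∀ (n : ℕ) (f : U (n + 1)), D (n + 1) f = 0 →
      ∃ f' : (s n).Z →ₗ[R] J, LinearMap.lcomp R J (p n) f' = f := by
    intro n f hf
    obtain ⟨k, hk⟩ := surj_factor (p n) (hp n) f (by
      intro y hy
      obtain ⟨z, rfl⟩ := hpk n y hy
      obtain ⟨x, rfl⟩ := hp (n + 1) z
      exact LinearMap.congr_fun hf x)
    exact ⟨k, LinearMap.ext hk⟩
  have hex : ∀ n, Function.Exact (D n) (D (n + 1)) := by
    intro n f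
    constructor
    · intro hf
      obtain ⟨f', rfl⟩ := fac n f hf
      obtain ⟨F, hF⟩ := hJ.out (s n).i (s n).hi f'
      exact ⟨F, LinearMap.ext fun x => hF _⟩
    · rintro ⟨x, rfl⟩
      exact hDD n x
  have hHom : ∀ (X : ModuleCat.{u} R), Paper.IsCInjective R C X → ∀ (n : ℕ)
      (g : X →ₗ[R] U (n + 1)), (D (n + 1)).comp g = 0 → ∃ h : X →ₗ[R] U n, (D n).comp h = g := by
    intro X hX n g hg
    obtain ⟨k, hk⟩ := lift_factor (LinearMap.lcomp R J (p n)) (by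
      intro a b h
      refine LinearMap.ext fun c => ?_
      obtain ⟨x, rfl⟩ := hp n c
      exact LinearMap.congr_fun h x) g (fun x => fac n _ (LinearMap.congr_fun hg x))
    obtain ⟨h', hh'⟩ := hom_ext_tens hJ (s n).i ((s n).hT X (TV_of_cinj hK hX)) k
    refine ⟨h', LinearMap.ext fun x => ?_⟩
    rw [← hk]
    exact LinearMap.ext fun y => hh' x _
  have hD0 : Function.Injective (D 0) := by
    intro a b h
    refine LinearMap.ext fun c => ?_
    obtain ⟨x, hx⟩ := hp 0 c
    have := LinearMap.congr_fun h x
    change a ((s 0).i (p 0 x)) = b ((s 0).i (p 0 x)) at this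
    rw [hx] at this
    exact this
  let Y := ncx U D hDD
  refine ⟨Y.shift.X, Y.shift.d, ?_, ?_, ?_, ?_, ?_⟩
  · rintro (n | n) hn
    · exact hU n
    · exact absurd hn (by omega)
  · rintro (n | (_ | n)) hn
    · exact absurd hn (by simp)
    · exact ⟨J, hJ, ⟨LinearEquiv.refl R _⟩⟩
    · refine ⟨ModuleCat.of R PUnit, by constructor; intro A B _ _ _ _ f hf g; exact ⟨0, fun x => rfl⟩, ⟨?_⟩⟩
      exact { toFun := fun _ => 0, map_add' := fun _ _ => (add_zero _).symm,
              map_smul' := fun _ _ => (smul_zero _).symm,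
              invFun := fun _ => PUnit.unit
              left_inv := fun _ => rfl, right_inv := fun _ => LinearMap.ext fun _ => rfl }
  · rintro (n | (_ | n))
    · exact hex (n + 1)
    · exact hex 0
    · rcases n with (_ | n)
      · intro x
        constructor
        · intro h
          exact ⟨PUnit.unit, (hD0 (h.trans (map_zero (D 0)).symm)).symm⟩
        · rintro ⟨y, rfl⟩
          exact map_zero (D 0)
      · intro x
        exact ⟨fun _ => ⟨PUnit.unit, rfl⟩, fun _ => rfl⟩
  · intro X hX
    rintro (n | (_ | n)) g hg
    · exact hHom X hX (n + 1) g hg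
    · exact hHom X hX 0 g hg
    · refine ⟨0, LinearMap.ext fun x => ?_⟩
      rcases n with (_ | n)
      · exact (hD0 ((LinearMap.congr_fun hg x).trans (map_zero (D 0)).symm)).symm
      · rfl
  · refine ⟨(D 0).comp e.toLinearMap, hD0.comp e.injective, ?_⟩
    intro x
    refine (hex 0 x).trans ?_
    constructor
    · rintro ⟨y, rfl⟩
      exact ⟨e.symm y, congrArg (D 0) (e.apply_symm_apply y)⟩
    · rintro ⟨y, rfl⟩
      exact ⟨e y, rfl⟩
end

end Part10
end PAux

namespace PAux
section Part11
open CategoryTheory Opposite Limits TensorProduct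
section
variable {R : Type u} [CommRing R]

theorem hom_prime [IsNoetherianRing R] {C : Type u} [AddCommGroup C] [Module R C] [Module.Finite R C]
    (hb : Function.Injective (fun r : R => (r • LinearMap.id : C →ₗ[R] C))) (p : Ideal R)
    [p.IsPrime] : ∃ f : C →ₗ[R] (R ⧸ p), f ≠ 0 := by
  have hs : (⟨p, inferInstance⟩ : PrimeSpectrum R) ∈ Module.support R C := by
    rw [Module.support_eq_zeroLocus, PrimeSpectrum.mem_zeroLocus]
    intro r hr
    have hr0 : r = 0 := by
      apply hb
      refine LinearMap.ext fun c => ?_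
      have := Module.mem_annihilator.1 hr c
      simpa using this
    rw [hr0]
    exact zero_mem p
  have hn := Module.mem_support_iff_nontrivial_residueField_tensorProduct
    (R := R) (M := C) (⟨p, inferInstance⟩ : PrimeSpectrum R) |>.1 hs
  change Nontrivial (p.ResidueField ⊗[R] C) at hn
  obtain ⟨v, hv⟩ := exists_ne (0 : p.ResidueField ⊗[R] C)
  obtain ⟨φ, hφ⟩ := Module.Projective.exists_dual_ne_zero p.ResidueField hv
  let g : C →ₗ[R] p.ResidueField :=
    (φ.restrictScalars R).comp (TensorProduct.mk R p.ResidueField C 1)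
  let ι : (R ⧸ p) →ₗ[R] p.ResidueField := (IsScalarTower.toAlgHom R (R ⧸ p) p.ResidueField).toLinearMap
  have hι : Function.Injective ι := p.injective_algebraMap_quotient_residueField
  obtain ⟨S, hS⟩ := Module.Finite.fg_top (R := R) (M := C)
  classical
  obtain ⟨b, hb'⟩ := IsLocalization.exist_integer_multiples_of_finset (nonZeroDivisors (R ⧸ p))
    (S.image g)
  obtain ⟨b0, hb0⟩ := Ideal.Quotient.mk_surjective b.1
  have hg : ∀ c, (b0 • g) c ∈ LinearMap.range ι := by
    have : (⊤ : Submodule R C) ≤ (LinearMap.range ι).comap (b0 • g) := by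
      rw [← hS, Submodule.span_le]
      intro c hc
      obtain ⟨y, hy⟩ := hb' (g c) (Finset.mem_image_of_mem g hc)
      refine ⟨y, ?_⟩
      change algebraMap (R ⧸ p) p.ResidueField y = b0 • g c
      rw [hy, ← hb0]
      exact algebraMap_smul (R ⧸ p) b0 (g c)
    exact fun c => this Submodule.mem_top
  obtain ⟨f, hf⟩ := lift_factor ι hι (b0 • g) hg
  refine ⟨f, fun h0 => hφ ?_⟩
  have hg0 : ∀ c, g c = 0 := by
    intro c
    have h1 := hf c
    rw [h0, LinearMap.zero_apply, map_zero] at h1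
    have h2 : b0 • g c = (algebraMap (R ⧸ p) p.ResidueField b.1) * g c := by
      rw [← hb0, ← Algebra.smul_def]
      exact (algebraMap_smul (R ⧸ p) b0 (g c)).symm
    have h3 := h1.symm
    rw [LinearMap.smul_apply, h2] at h3
    rcases mul_eq_zero.1 h3 with h | h
    · exact absurd (hι (h.trans (map_zero ι).symm)) (nonZeroDivisors.coe_ne_zero b)
    · exact h
  have : ∀ v, φ v = 0 := by
    intro v
    induction v with
    | zero => exact map_zero _
    | add x y hx hy => rw [map_add, hx, hy, add_zero]
    | tmul r c =>
      have : r ⊗ₜ[R] c = r • ((1 : p.ResidueField) ⊗ₜ[R] c) := by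
        rw [TensorProduct.smul_tmul', smul_eq_mul, mul_one]
      rw [this, map_smul]
      have := hg0 c
      change φ (1 ⊗ₜ c) = 0 at this
      rw [this, smul_zero]
  exact this v

theorem hom_nz [IsNoetherianRing R] {C : Type u} [AddCommGroup C] [Module R C] [Module.Finite R C]
    (hb : Function.Injective (fun r : R => (r • LinearMap.id : C →ₗ[R] C)))
    (Q : Type u) [AddCommGroup Q] [Module R Q] (h : ∀ f : C →ₗ[R] Q, f = 0) : Subsingleton Q := by
  by_contra hQ
  rw [not_subsingleton_iff_nontrivial] at hQ
  obtain ⟨p, hp⟩ := associatedPrimes.nonempty R Q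
  have := hp.isPrime
  obtain ⟨j, hj⟩ := ((isAssociatedPrime_iff_exists_injective_linearMap p Q).1 hp).2
  obtain ⟨f, hf⟩ := hom_prime (C := C) hb p
  refine hf (LinearMap.ext fun c => hj ?_)
  have := LinearMap.congr_fun (h (j.comp f)) c
  rw [LinearMap.comp_apply] at this
  rw [this]; simp
end

end Part11
end PAux

namespace PAux
section Part12
open CategoryTheory Opposite Limits TensorProduct
section
variable {R : Type u} [CommRing R]

/-- Hom complex. -/
abbrev hcx (C : Type u) [AddCommGroup C] [Module R C] (D : Cx R) : Cx R where
  X i := ModuleCat.of R (C →ₗ[R] D.X i)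
  d i := LinearMap.llcomp R C (D.X i) (D.X (i + 1)) (D.d i)
  dd i f := LinearMap.ext fun c => D.dd i (f c)

theorem quot_injective {J : Type u} [AddCommGroup J] [Module R J] (hJ : Module.Injective R J)
    (B : Submodule R J) (hB : Module.Injective R B) : Module.Injective R (J ⧸ B) := by
  obtain ⟨s, hs⟩ := exists_section B.mkQ B.mkQ_surjective
    (injective_of_equiv (LinearEquiv.ofEq _ _ B.ker_mkQ.symm) hB)
  constructor
  intro X Y _ _ _ _ f hf g
  obtain ⟨k, hk⟩ := hJ.out f hf (s.comp g)
  exact ⟨B.mkQ.comp k, fun x => by rw [LinearMap.comp_apply, hk, LinearMap.comp_apply, hs]⟩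

theorem injective_of_subs {J : Type u} [AddCommGroup J] [Module R J] (h : Subsingleton J) :
    Module.Injective R J := by
  constructor
  intro X Y _ _ _ _ f hf g
  exact ⟨0, fun x => Subsingleton.elim _ _⟩

variable {C : Type u} [AddCommGroup C] [Module R C]

/-- the quotient of cocycles -/
theorem hom_lift_H (D : Cx R) (i : ℤ) (hB : Module.Injective R (LinearMap.range (D.d i)))
    (f : C →ₗ[R] D.H i) : ∃ g : C →ₗ[R] LinearMap.ker (D.d (i + 1)),
      ∀ c, Submodule.Quotient.mk (g c) = f c := by
  let S : Submodule R (LinearMap.ker (D.d (i + 1))) :=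
    (LinearMap.range (D.d i)).comap (LinearMap.ker (D.d (i + 1))).subtype
  have hle : LinearMap.range (D.d i) ≤ LinearMap.ker (D.d (i + 1)) := by
    rintro _ ⟨y, rfl⟩
    exact D.dd i y
  have hS : Module.Injective R S :=
    injective_of_equiv (Submodule.comapSubtypeEquivOfLe hle).symm hB
  obtain ⟨s, hs⟩ := exists_section S.mkQ S.mkQ_surjective
    (injective_of_equiv (LinearEquiv.ofEq _ _ S.ker_mkQ.symm) hS)
  exact ⟨s.comp f, fun c => hs (f c)⟩

theorem lemB [IsNoetherianRing R] [Module.Finite R C]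
    (hb : Function.Injective (fun r : R => (r • LinearMap.id : C →ₗ[R] C))) (D : Cx R)
    (hD : ∀ i, Module.Injective R (D.X i)) (i : ℤ)
    (hB : Module.Injective R (LinearMap.range (D.d i)))
    (he : Function.Exact ((hcx C D).d i) ((hcx C D).d (i + 1))) :
    Function.Exact (D.d i) (D.d (i + 1)) ∧
      Module.Injective R (LinearMap.range (D.d (i + 1))) := by
  have h1 : Function.Exact (D.d i) (D.d (i + 1)) := by
    rw [exact_iff_H]
    refine hom_nz (C := C) hb _ fun f => ?_
    obtain ⟨g, hg⟩ := hom_lift_H D i hB f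
    obtain ⟨k, hk⟩ := (he ((LinearMap.ker (D.d (i + 1))).subtype.comp g)).1
      (LinearMap.ext fun c => (g c).2)
    refine LinearMap.ext fun c => ?_
    rw [← hg c]
    refine (Submodule.Quotient.mk_eq_zero _).2 ?_
    exact ⟨k c, LinearMap.congr_fun hk c⟩
  refine ⟨h1, ?_⟩
  refine injective_of_equiv ((Submodule.quotEquivOfEq _ _ (LinearMap.exact_iff.1 h1).symm).trans
    (D.d (i + 1)).quotKerEquivRange) (quot_injective (hD (i + 1)) _ hB)

theorem lemB_all [IsNoetherianRing R] [Module.Finite R C]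
    (hb : Function.Injective (fun r : R => (r • LinearMap.id : C →ₗ[R] C))) (D : Cx R)
    (hD : ∀ i, Module.Injective R (D.X i)) (h0 : ∀ i < 0, Subsingleton (D.X i)) (m : ℤ)
    (he : ∀ i < m, Function.Exact ((hcx C D).d i) ((hcx C D).d (i + 1))) :
    (∀ i < m, Function.Exact (D.d i) (D.d (i + 1))) ∧
      ∀ i ≤ m, Module.Injective R (LinearMap.range (D.d i)) := by
  have hr : ∀ i < 0, Module.Injective R (LinearMap.range (D.d i)) := by
    intro i hi
    have := h0 i hi
    apply injective_of_subs
    constructor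
    rintro ⟨_, x, rfl⟩ ⟨_, y, rfl⟩
    rw [Subsingleton.elim x y]
  have key : ∀ k : ℕ, ∀ i : ℤ, i < k → i ≤ m → Module.Injective R (LinearMap.range (D.d i)) := by
    intro k
    induction k with
    | zero => exact fun i hi _ => hr i (by simpa using hi)
    | succ k ih =>
      intro i hi him
      obtain ⟨j, rfl⟩ : ∃ j, i = j + 1 := ⟨i - 1, by omega⟩
      push_cast at hi
      exact (lemB hb D hD j (ih j (by omega) (by omega)) (he j (by omega))).2
  have hinj : ∀ i ≤ m, Module.Injective R (LinearMap.range (D.d i)) := fun i him =>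
    key (i.toNat + 1) i (by omega) him
  exact ⟨fun i hi => (lemB hb D hD i (hinj i hi.le) (he i hi)).1, hinj⟩

theorem equiv_of_surj {A B E : Type*} [AddCommGroup A] [Module R A] [AddCommGroup B] [Module R B]
    [AddCommGroup E] [Module R E] (f : A →ₗ[R] B) (g : A →ₗ[R] E) (hf : Function.Surjective f)
    (hg : Function.Surjective g) (h : ∀ x, f x = 0 ↔ g x = 0) : Nonempty (B ≃ₗ[R] E) :=
  ⟨((f.quotKerEquivOfSurjective hf).symm.trans (Submodule.quotEquivOfEq _ (LinearMap.ker g)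
    (Submodule.ext h))).trans (g.quotKerEquivOfSurjective hg)⟩

/-- H of Hom is Hom of H. -/
theorem hom_H (D : Cx R) (i : ℤ) (hB : Module.Injective R (LinearMap.range (D.d i)))
    (hi : Module.Injective R (LinearMap.ker (D.d i))) :
    Nonempty ((hcx C D).H i ≃ₗ[R] (C →ₗ[R] D.H i)) := by
  let S : Submodule R (LinearMap.ker (D.d (i + 1))) :=
    (LinearMap.range (D.d i)).comap (LinearMap.ker (D.d (i + 1))).subtype
  let S' : Submodule R (LinearMap.ker ((hcx C D).d (i + 1))) :=
    (LinearMap.range ((hcx C D).d i)).comap (LinearMap.ker ((hcx C D).d (i + 1))).subtype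
  let g : LinearMap.ker ((hcx C D).d (i + 1)) →ₗ[R] (C →ₗ[R] D.H i) :=
    { toFun := fun f => S.mkQ.comp (LinearMap.codRestrict (LinearMap.ker (D.d (i + 1)))
        (f.1 : C →ₗ[R] D.X (i + 1)) (fun c => LinearMap.congr_fun f.2 c))
      map_add' := fun _ _ => rfl
      map_smul' := fun _ _ => rfl }
  refine equiv_of_surj S'.mkQ g S'.mkQ_surjective ?_ ?_
  · intro f
    obtain ⟨k, hk⟩ := hom_lift_H D i hB f
    refine ⟨⟨(LinearMap.ker (D.d (i + 1))).subtype.comp k, LinearMap.ext fun c => (k c).2⟩, ?_⟩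
    exact LinearMap.ext fun c => hk c
  · intro f
    refine (Submodule.Quotient.mk_eq_zero S').trans ?_
    constructor
    · rintro ⟨k, hk⟩
      refine LinearMap.ext fun c => ?_
      exact (Submodule.Quotient.mk_eq_zero S).2 ⟨k c, LinearMap.congr_fun hk c⟩
    · intro h
      have h' : ∀ c, ∃ b, (LinearMap.range (D.d i)).subtype b = (f.1 : C →ₗ[R] D.X (i + 1)) c := by
        intro c
        have := LinearMap.congr_fun h c
        obtain ⟨y, hy⟩ := (Submodule.Quotient.mk_eq_zero S).1 this
        exact ⟨⟨D.d i y, y, rfl⟩, hy⟩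
      obtain ⟨k, hk⟩ := lift_factor (LinearMap.range (D.d i)).subtype Subtype.val_injective
        (f.1 : C →ₗ[R] D.X (i + 1)) h'
      obtain ⟨s, hs⟩ := exists_section (D.d i).rangeRestrict (D.d i).surjective_rangeRestrict
        (injective_of_equiv (LinearEquiv.ofEq _ _ (LinearMap.ker_rangeRestrict (D.d i)).symm) hi)
      refine ⟨s.comp k, LinearMap.ext fun c => ?_⟩
      exact (congrArg Subtype.val (hs (k c))).trans (hk c)

theorem tailG {P : ModuleCat.{u} R → Prop}
    (hP : ∀ X Y : ModuleCat.{u} R, Nonempty (X ≃ₗ[R] Y) → P X → P Y) (D : Cx R) (k : ℕ) :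
    ∀ (a N : ℤ), N = a + k → (∀ i ≥ a, Function.Exact (D.d i) (D.d (i + 1))) →
    (∀ i ≥ a, P (D.X i)) → P (ModuleCat.of R (LinearMap.ker (D.d N))) →
    Paper.CoresDimLE R P k (ModuleCat.of R (LinearMap.ker (D.d a))) := by
  induction k with
  | zero =>
    intro a N hN _ _ h
    obtain rfl : N = a := by simpa using hN
    exact h
  | succ k ih =>
    intro a N hN he hX h
    refine coresDim_mk hP (X := D.X a) (N := ModuleCat.of R (LinearMap.ker (D.d (a + 1))))
      (LinearMap.ker (D.d a)).subtype ((D.d a).codRestrict _ (fun x => D.dd a x))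
      Subtype.val_injective ?_ ?_ (hX a le_rfl) (ih (a + 1) N (by push_cast at hN; omega)
        (fun i hi => he i (by omega)) (fun i hi => hX i (by omega)) h)
    · rintro ⟨x, hx⟩
      obtain ⟨y, hy⟩ := (he a le_rfl x).1 hx
      exact ⟨y, Subtype.ext hy⟩
    · intro x
      constructor
      · intro hx
        exact ⟨⟨x, congrArg Subtype.val hx⟩, rfl⟩
      · rintro ⟨y, rfl⟩
        exact Subtype.ext y.2

/-- the truncated term -/
abbrev D0 (D : Cx R) (m : ℤ) : Type u := D.X (m + 1) ⧸ LinearMap.range (D.d m)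

/-- inclusion of cohomology -/
def hin (D : Cx R) (m : ℤ) : D.H m →ₗ[R] D0 D m :=
  Submodule.mapQ _ _ (LinearMap.ker (D.d (m + 1))).subtype le_rfl

/-- induced differential -/
def hout (D : Cx R) (m : ℤ) : D0 D m →ₗ[R] LinearMap.ker (D.d (m + 1 + 1)) :=
  Submodule.liftQ _ ((D.d (m + 1)).codRestrict _ (fun x => D.dd (m + 1) x)) (by
    rintro _ ⟨y, rfl⟩
    exact Subtype.ext (D.dd m y))

theorem hin_inj (D : Cx R) (m : ℤ) : Function.Injective (hin D m) := by
  rw [injective_iff_map_eq_zero]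
  intro a ha
  obtain ⟨a, rfl⟩ := Submodule.mkQ_surjective _ a
  exact (Submodule.Quotient.mk_eq_zero _).2
    ((Submodule.Quotient.mk_eq_zero (LinearMap.range (D.d m)) (x := a.1)).1 ha)

theorem hin_hout (D : Cx R) (m : ℤ) : Function.Exact (hin D m) (hout D m) := by
  intro a
  constructor
  · obtain ⟨a, rfl⟩ := Submodule.mkQ_surjective _ a
    intro h
    exact ⟨Submodule.Quotient.mk ⟨a, congrArg Subtype.val h⟩, rfl⟩
  · rintro ⟨b, rfl⟩
    obtain ⟨b, rfl⟩ := Submodule.mkQ_surjective _ b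
    exact Subtype.ext b.2

theorem hout_surj (D : Cx R) (m : ℤ)
    (he : Function.Exact (D.d (m + 1)) (D.d (m + 1 + 1))) : Function.Surjective (hout D m) := by
  rintro ⟨x, hx⟩
  obtain ⟨y, hy⟩ := (he x).1 hx
  exact ⟨Submodule.Quotient.mk y, Subtype.ext hy⟩

theorem cinj_hom {I : Type u} [AddCommGroup I] [Module R I] (hI : Module.Injective R I) :
    Paper.IsCInjective R C (C →ₗ[R] I) := ⟨ModuleCat.of R I, hI, ⟨LinearEquiv.refl R _⟩⟩

/-- finite C-injective coresolution of the cohomology -/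
theorem cores_of_tail (D : Cx R) (hD : ∀ i, Module.Injective R (D.X i)) (m : ℤ)
    (hB : Module.Injective R (LinearMap.range (D.d m)))
    (he : ∀ i > m, Function.Exact ((hcx C D).d i) ((hcx C D).d (i + 1))) (N : ℤ)
    (hN : m + 1 + 1 ≤ N) (hk : Module.Injective R (LinearMap.ker (D.d N))) :
    ∃ k, Paper.CoresDimLE R (fun N => Paper.IsCInjective R C N) k
      (ModuleCat.of R (C →ₗ[R] D.H m)) := by
  have hN' : N = m + 1 + 1 + ((N - (m + 1 + 1)).toNat : ℤ) := by omega
  have hkN : Paper.IsCInjective R C (LinearMap.ker ((hcx C D).d N)) := by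
    refine ⟨ModuleCat.of R (LinearMap.ker (D.d N)), hk, ⟨LinearEquiv.ofBijective
      { toFun := fun f => (LinearMap.codRestrict (LinearMap.ker (D.d N))
          (f.1 : C →ₗ[R] D.X N) (fun c => LinearMap.congr_fun f.2 c))
        map_add' := fun _ _ => rfl
        map_smul' := fun _ _ => rfl } ⟨?_, ?_⟩⟩⟩
    · intro f g h
      refine Subtype.ext (LinearMap.ext fun c => ?_)
      exact congrArg Subtype.val (LinearMap.congr_fun h c)
    · intro f
      exact ⟨⟨(LinearMap.ker (D.d N)).subtype.comp f, LinearMap.ext fun c => (f c).2⟩, rfl⟩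
  have h1 := tailG (P := fun N => Paper.IsCInjective R C N) cinj_iso (hcx C D)
    (N - (m + 1 + 1)).toNat (m + 1 + 1) N hN' (fun i hi => he i (by omega))
    (fun i _ => cinj_hom (hD i)) hkN
  refine ⟨_, coresDim_mk (P := fun N => Paper.IsCInjective R C N) cinj_iso
    (X := ModuleCat.of R (C →ₗ[R] D0 D m))
    (N := ModuleCat.of R (LinearMap.ker ((hcx C D).d (m + 1 + 1))))
    (LinearMap.llcomp R C _ _ (hin D m))
    (LinearMap.codRestrict _ (LinearMap.llcomp R C _ _
      ((LinearMap.ker (D.d (m + 1 + 1))).subtype.comp (hout D m)))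
      (fun f => LinearMap.ext fun c => (hout D m (f c)).2)) ?_ ?_ ?_
    (cinj_hom (quot_injective (hD _) _ hB)) h1⟩
  · intro f g h
    exact LinearMap.ext fun c => hin_inj D m (LinearMap.congr_fun h c)
  · rintro ⟨f, hf⟩
    obtain ⟨k, hk⟩ := (he (m + 1) (by omega) f).1 hf
    refine ⟨(LinearMap.range (D.d m)).mkQ.comp k, Subtype.ext (LinearMap.ext fun c => ?_)⟩
    exact LinearMap.congr_fun hk c
  · intro f
    constructor
    · intro h
      obtain ⟨k, hk⟩ := lift_factor (hin D m) (hin_inj D m) f (fun c => (hin_hout D m _).1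
        (Subtype.ext (LinearMap.congr_fun (congrArg Subtype.val h) c)))
      exact ⟨k, LinearMap.ext hk⟩
    · rintro ⟨k, rfl⟩
      refine Subtype.ext (LinearMap.ext fun c => ?_)
      exact congrArg Subtype.val ((hin_hout D m).apply_apply_eq_zero (k c))
end

end Part12
end PAux

namespace PAux
section Part13
open CategoryTheory Opposite Limits TensorProduct
section
variable {R : Type u} [CommRing R] {C : Type u} [AddCommGroup C] [Module R C] {K : Cores R C}

/-- Hom into a coresolution. -/
def homCores (hC : SZ K C)
    (hb : Function.Bijective (fun r : R => (r • LinearMap.id : C →ₗ[R] C))) : Cores R R where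
  J n := ModuleCat.of R (C →ₗ[R] K.J n)
  d n := LinearMap.llcomp R C (K.J n) (K.J (n + 1)) (K.d n)
  i := LinearMap.toSpanSingleton R _ K.i
  hi := by
    intro r s h
    apply hb.1
    refine LinearMap.ext fun c => K.hi ?_
    have := LinearMap.congr_fun h c
    change r • K.i c = s • K.i c at this
    rw [← map_smul, ← map_smul] at this
    exact this
  e0 := by
    intro f
    constructor
    · intro h
      obtain ⟨k, hk⟩ := lift_factor K.i K.hi (f : C →ₗ[R] K.J 0)
        (fun c => (K.e0 _).1 (LinearMap.congr_fun h c))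
      obtain ⟨r, hr⟩ := hb.2 k
      refine ⟨r, LinearMap.ext fun c => ?_⟩
      change r • K.i c = f c
      rw [← hk c, ← map_smul]
      exact congrArg K.i (LinearMap.congr_fun hr c)
    · rintro ⟨r, rfl⟩
      refine LinearMap.ext fun c => ?_
      change K.d 0 (r • K.i c) = 0
      rw [map_smul, K.e0.apply_apply_eq_zero, smul_zero]
  ex n := by
    intro f
    constructor
    · intro h
      obtain ⟨g, hg⟩ := hC.2 n f h
      exact ⟨g, hg⟩
    · rintro ⟨g, rfl⟩
      exact LinearMap.ext fun c => (K.ex n).apply_apply_eq_zero (g c)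

theorem Gl_fg (l : List R) [Module.Finite R C] {A : Type u} [AddCommGroup A] [Module R A]
    (f : C →ₗ[R] A) (hf : ∀ c, f c ∈ Gl l A) : f ∈ Gl l (C →ₗ[R] A) := by
  intro x hx
  obtain ⟨n, hn⟩ := Gx_fg x f (fun c => hf c x hx)
  exact ⟨n, LinearMap.ext hn⟩

/-- comparison map -/
def ghf (l : List R) (K : Cores R C) : ∀ i : ℤ,
    Gl l (fam (fun n => ModuleCat.of R (C →ₗ[R] K.J n)) i) →ₗ[R] (C →ₗ[R] Gl l (fam K.J i))
  | Int.ofNat n =>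
    { toFun := fun f => LinearMap.codRestrict (Gl l (K.J n)) (f.1 : C →ₗ[R] K.J n)
        (fun c => Gl_map l (LinearMap.applyₗ (R := R) (M₂ := K.J n) c) f.2)
      map_add' := fun _ _ => rfl
      map_smul' := fun _ _ => rfl }
  | Int.negSucc _ => 0

/-- comparison chain map -/
def ghc (l : List R) (hC : SZ K C)
    (hb : Function.Bijective (fun r : R => (r • LinearMap.id : C →ₗ[R] C))) :
    CHom (gl l (homCores hC hb).cx) (hcx C (gl l K.cx)) where
  f := ghf l K
  comm i := match i with
    | Int.ofNat n => fun _ => rfl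
    | Int.negSucc n => fun x => (congrArg (ghf l K (Int.negSucc n + 1))
        (show _ = (0 : (gl l (homCores hC hb).cx).X (Int.negSucc n + 1)) from rfl)).trans
          ((map_zero _).trans (map_zero ((hcx C (gl l K.cx)).d (Int.negSucc n))).symm)

theorem ghc_bij (l : List R) (hC : SZ K C)
    (hb : Function.Bijective (fun r : R => (r • LinearMap.id : C →ₗ[R] C))) (i : ℤ) :
    Function.Bijective ((ghc l hC hb).f i) := by
  have := hC.1
  rcases i with n | n
  · constructor
    · intro f g h
      refine Subtype.ext (LinearMap.ext fun c => ?_)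
      exact congrArg Subtype.val (LinearMap.congr_fun h c)
    · intro f
      let f' : C →ₗ[R] K.J n := (Gl l (K.J n)).subtype.comp f
      exact ⟨⟨f', Gl_fg l f' (fun c => (f c).2)⟩, rfl⟩
  · constructor
    · intro f g h
      exact Subtype.ext (Subsingleton.elim (α := PUnit) _ _)
    · intro f
      refine ⟨0, LinearMap.ext fun c => ?_⟩
      exact Subtype.ext (Subsingleton.elim (α := PUnit) _ _)

theorem H_hom [IsNoetherianRing R] (l : List R) (hK : ∀ n, Module.Injective R (K.J n))
    (hC : SZ K C) (hb : Function.Bijective (fun r : R => (r • LinearMap.id : C →ₗ[R] C))) (i j : ℤ)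
    (hij : j = i + l.length) :
    Nonempty ((T l (conc R R)).H i ≃ₗ[R] (hcx C (gl l K.cx)).H j) := by
  have := hC.1
  obtain ⟨e1⟩ := H_cores l (Z := C) (homCores hC hb) (fun n => cinj_hom (hK n)) i j hij
  obtain ⟨e2⟩ := (QIso.of_bijective (ghc_bij l hC hb)).equiv j
  exact ⟨e1.trans e2⟩

theorem H_tens [IsNoetherianRing R] (l : List R) (hK : ∀ n, Module.Injective R (K.J n)) (i j : ℤ)
    (hij : j = i + l.length) :
    Nonempty ((T l (conc R C)).H i ≃ₗ[R] (gl l K.cx).H j) :=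
  H_cores l (Z := R) K (fun n => good_of_inj (hK n)) i j hij

theorem lcoh_T [IsNoetherianRing R] {l : List R} {𝔞 : Ideal R} (h𝔞 : 𝔞 = Ideal.span {x | x ∈ l})
    (n : ℕ) (i : ℤ) (hi : jm n = i + l.length) :
    Nonempty (Paper.lcoh R 𝔞 n R ≃ₗ[R] (T l (conc R R)).H i) := by
  have E : InjectiveResolution (ModuleCat.of R R) := injectiveResolution _
  obtain ⟨e1⟩ := lcoh_equiv E h𝔞 n
  obtain ⟨e2⟩ := H_tens l (K := coresOf E) (coresOf_inj E) i (jm n) hi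
  exact ⟨e1.trans e2.symm⟩
end

end Part13
end PAux

namespace PAux
section Part14
open CategoryTheory Opposite Limits TensorProduct
section
variable {R : Type u} [CommRing R] {C : Type u} [AddCommGroup C] [Module R C] {K : Cores R C}

theorem jm_eq (n : ℕ) : jm n = (n : ℤ) - 1 := by
  rcases n with _ | n
  · rfl
  · change (n : ℤ) = _
    push_cast
    ring

theorem T_exact [IsNoetherianRing R] {l : List R} {𝔞 : Ideal R} (h𝔞 : 𝔞 = Ideal.span {x | x ∈ l})
    {n : ℕ} (h : Paper.IsRelCM R 𝔞 n R) (i : ℤ) (hi : i + l.length ≠ jm n) :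
    Function.Exact ((T l (conc R R)).d i) ((T l (conc R R)).d (i + 1)) := by
  by_cases hj : i + l.length < -1
  · have : Subsingleton ((T l (conc R R)).X (i + 1)) :=
      T_below l _ 0 (fun j hj => conc_subs j hj.ne) _ (by omega)
    intro x
    rw [Subsingleton.elim x 0]
    exact ⟨fun _ => ⟨0, map_zero _⟩, fun _ => map_zero _⟩
  · rw [exact_iff_H]
    obtain ⟨k, hk⟩ : ∃ k : ℕ, i + l.length = jm k := ⟨(i + l.length + 1).toNat, by rw [jm_eq]; omega⟩
    obtain ⟨e⟩ := lcoh_T h𝔞 k i hk.symm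
    have := h.1 k (by rintro rfl; exact hi hk)
    exact e.symm.toEquiv.subsingleton

theorem cx_inj (hK : ∀ n, Module.Injective R (K.J n)) (i : ℤ) : Module.Injective R (K.cx.X i) := by
  rcases i with n | n
  · exact hK n
  · exact injective_of_subs (inferInstanceAs (Subsingleton PUnit))

theorem cx_subs (i : ℤ) (hi : i < 0) : Subsingleton (K.cx.X i) := by
  rcases i with n | n
  · exact absurd hi (by simp)
  · exact (inferInstanceAs (Subsingleton PUnit))

theorem gl_subs (l : List R) (i : ℤ) (hi : i < 0) : Subsingleton ((gl l K.cx).X i) := by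
  have := cx_subs (K := K) i hi
  exact inferInstanceAs (Subsingleton (Gl l (K.cx.X i)))

theorem gl_inj [IsNoetherianRing R] (l : List R) (hK : ∀ n, Module.Injective R (K.J n)) (i : ℤ) :
    Module.Injective R ((gl l K.cx).X i) := Gl_inj l _ (cx_inj hK i)

theorem hcx_exact [IsNoetherianRing R] {l : List R} {𝔞 : Ideal R}
    (h𝔞 : 𝔞 = Ideal.span {x | x ∈ l}) (hK : ∀ n, Module.Injective R (K.J n))
    (hC : SZ K C) (hb : Function.Bijective (fun r : R => (r • LinearMap.id : C →ₗ[R] C)))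
    {n : ℕ} (h : Paper.IsRelCM R 𝔞 n R) (i : ℤ) (hi : i ≠ jm n) :
    Function.Exact ((hcx C (gl l K.cx)).d i) ((hcx C (gl l K.cx)).d (i + 1)) := by
  rw [exact_iff_H]
  obtain ⟨e⟩ := H_hom l hK hC hb (i - l.length) i (by ring)
  have := (exact_iff_H _ _).1 (T_exact h𝔞 h (i - l.length) (by rwa [sub_add_cancel]))
  exact e.symm.toEquiv.subsingleton

theorem ker_gl_inj [IsNoetherianRing R] (l : List R) (D : Cx R) (i : ℤ)
    (h : Module.Injective R (LinearMap.ker (D.d i))) :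
    Module.Injective R (LinearMap.ker ((gl l D).d i)) := by
  have h1 := Gl_inj l _ h
  refine injective_of_equiv (LinearEquiv.ofBijective
    (LinearMap.codRestrict (LinearMap.ker ((gl l D).d i))
      ((LinearMap.ker (D.d i)).subtype.restrict (p := Gl l (LinearMap.ker (D.d i)))
        (q := Gl l (D.X i)) (fun x hx => Gl_map l _ hx))
      (fun x => Subtype.ext x.1.2)) ⟨?_, ?_⟩) h1
  · intro x y hxy
    apply Subtype.ext
    apply Subtype.ext
    exact congrArg (fun z => z.1.1) hxy
  · rintro ⟨⟨x, hx⟩, hx'⟩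
    refine ⟨⟨⟨x, congrArg Subtype.val hx'⟩, ?_⟩, rfl⟩
    intro y hy
    obtain ⟨n, hn⟩ := hx y hy
    exact ⟨n, Subtype.ext hn⟩

/-- cosyzygies -/
theorem ID_cosyz (hK : ∀ n, Module.Injective R (K.J n)) (n t : ℕ)
    (h : HasInjectiveDimensionLT (ModuleCat.of R C) (n + t + 1)) :
    HasInjectiveDimensionLT (ModuleCat.of R (LinearMap.ker (K.d n))) (t + 1) := by
  induction n generalizing t with
  | zero =>
    obtain ⟨s, hs⟩ := lift_factor K.i K.hi (LinearMap.ker (K.d 0)).subtype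
      (fun x => (K.e0 _).1 x.2)
    refine ID_retract s (K.i.codRestrict (LinearMap.ker (K.d 0))
      (fun x => K.e0.apply_apply_eq_zero x)) ?_ _ (by simpa using h)
    exact LinearMap.ext fun x => Subtype.ext (hs x)
  | succ n ih =>
    have h2 := ih (t + 1) (by
      have : n + (t + 1) + 1 = n + 1 + t + 1 := by ring
      rwa [this])
    refine (ID_seq (LinearMap.ker (K.d n)).subtype ((K.d n).codRestrict (LinearMap.ker (K.d (n + 1)))
      (fun x => (K.ex n).apply_apply_eq_zero x)) Subtype.val_injective ?_ ?_ (hK n) t).2 h2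
    · rintro ⟨x, hx⟩
      obtain ⟨y, hy⟩ := (K.ex n x).1 hx
      exact ⟨y, Subtype.ext hy⟩
    · intro x
      constructor
      · intro hx
        exact ⟨⟨x, congrArg Subtype.val hx⟩, rfl⟩
      · rintro ⟨y, rfl⟩
        exact Subtype.ext y.2

theorem coresDim_mono {P Q : ModuleCat.{u} R → Prop} (hPQ : ∀ X, P X → Q X) (k : ℕ) :
    ∀ M, Paper.CoresDimLE R P k M → Paper.CoresDimLE R Q k M := by
  induction k with
  | zero => exact fun M => hPQ M
  | succ k ih =>
    rintro M (h | ⟨X, f, hX, hf, h⟩)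
    · exact Or.inl (ih _ h)
    · exact Or.inr ⟨X, f, hPQ X hX, hf, ih _ h⟩

theorem coresDim_ne_top {P : ModuleCat.{u} R → Prop} (M : ModuleCat.{u} R) :
    Paper.CoresDim R P M ≠ ⊤ ↔ ∃ k, Paper.CoresDimLE R P k M := by
  constructor
  · intro h
    by_contra hn
    push Not at hn
    apply h
    have : {n : ℕ∞ | ∃ k : ℕ, (k : ℕ∞) = n ∧ Paper.CoresDimLE R P k M} = ∅ := by
      ext n
      simp [hn]
    rw [Paper.CoresDim, this, sInf_empty]
  · rintro ⟨k, hk⟩ h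
    have : Paper.CoresDim R P M ≤ k := sInf_le ⟨k, rfl, hk⟩
    rw [h] at this
    simp at this

theorem lemB_gl [IsNoetherianRing R] {l : List R} {𝔞 : Ideal R}
    (h𝔞 : 𝔞 = Ideal.span {x | x ∈ l}) (hK : ∀ n, Module.Injective R (K.J n))
    (hC : SZ K C) (hb : Function.Bijective (fun r : R => (r • LinearMap.id : C →ₗ[R] C)))
    {n : ℕ} (h : Paper.IsRelCM R 𝔞 n R) :
    (∀ i < jm n, Function.Exact ((gl l K.cx).d i) ((gl l K.cx).d (i + 1))) ∧
      ∀ i ≤ jm n, Module.Injective R (LinearMap.range ((gl l K.cx).d i)) :=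
  haveI := hC.1
  lemB_all hb.1 (gl l K.cx) (gl_inj l hK) (gl_subs l) (jm n)
    (fun i hi => hcx_exact h𝔞 hK hC hb h i hi.ne)

theorem lcoh_hom [IsNoetherianRing R] {l : List R} {𝔞 : Ideal R}
    (h𝔞 : 𝔞 = Ideal.span {x | x ∈ l}) (hK : ∀ n, Module.Injective R (K.J n))
    (hC : SZ K C) (hb : Function.Bijective (fun r : R => (r • LinearMap.id : C →ₗ[R] C)))
    {n : ℕ} (h : Paper.IsRelCM R 𝔞 n R) :
    Nonempty (Paper.lcoh R 𝔞 n R ≃ₗ[R] (C →ₗ[R] (gl l K.cx).H (jm n))) := by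
  obtain ⟨e1⟩ := lcoh_T h𝔞 n (jm n - l.length) (by ring)
  obtain ⟨e2⟩ := H_hom l hK hC hb (jm n - l.length) (jm n) (by ring)
  obtain ⟨h1, h2⟩ := lemB_gl h𝔞 hK hC hb h
  obtain ⟨j, hj⟩ : ∃ j, jm n = j + 1 := ⟨jm n - 1, by ring⟩
  have h3 : Module.Injective R (LinearMap.ker ((gl l K.cx).d (jm n))) := by
    rw [hj, LinearMap.exact_iff.1 (h1 j (by omega))]
    exact h2 j (by omega)
  obtain ⟨e3⟩ := hom_H (C := C) (gl l K.cx) (jm n) (h2 _ le_rfl) h3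
  exact ⟨(e1.trans e2).trans e3⟩

theorem i_ii [IsNoetherianRing R] (hK : ∀ n, Module.Injective R (K.J n))
    (hC : SZ K C) (hb : Function.Bijective (fun r : R => (r • LinearMap.id : C →ₗ[R] C)))
    (hd : Paper.injDim R C ≠ ⊤) (𝔞 : Ideal R) (n : ℕ) (h : Paper.IsRelCM R 𝔞 n R) :
    Paper.GCinjDim R C (Paper.lcoh R 𝔞 n R) ≠ ⊤ := by
  obtain ⟨k, hk⟩ := (coresDim_ne_top _).1 hd
  have hk := ID_cores k _ hk
  obtain ⟨S, hS⟩ := IsNoetherian.noetherian 𝔞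
  have h𝔞 : 𝔞 = Ideal.span {x | x ∈ S.toList} := by simp [← hS]
  set l := S.toList
  have hN : ∀ N ≥ k, Module.Injective R (LinearMap.ker (K.d N)) := by
    intro N hN
    rw [← ID_one]
    exact ID_cosyz hK N 0 (hasInjectiveDimensionLT_of_ge (ModuleCat.of R C) (k + 1) _ (by omega))
  let N := max k (n + 1)
  have hN1 : Module.Injective R (LinearMap.ker ((gl l K.cx).d (N : ℤ))) :=
    ker_gl_inj l K.cx (N : ℤ) (hN N (le_max_left _ _))
  obtain ⟨k', hk'⟩ := cores_of_tail (C := C) (gl l K.cx) (gl_inj l hK) (jm n)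
    ((lemB_gl h𝔞 hK hC hb h).2 _ le_rfl) (fun i hi => hcx_exact h𝔞 hK hC hb h i hi.ne') N
    (by rw [jm_eq]; have := le_max_right k (n + 1); omega) hN1
  obtain ⟨e⟩ := lcoh_hom h𝔞 hK hC hb h
  refine (coresDim_ne_top _).2 ⟨k', ?_⟩
  refine coresDim_mono (fun X hX => GC_of_C hK hC X hX) k' _ ?_
  exact coresDim_equiv cinj_iso k' _ _ ⟨e.symm⟩ hk'

theorem relCM_bot [IsNoetherianRing R] [Nontrivial R] : Paper.IsRelCM R (⊥ : Ideal R) 0 R := by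
  have h𝔞 : (⊥ : Ideal R) = Ideal.span {x | x ∈ ([] : List R)} := by simp
  constructor
  · intro i hi
    obtain ⟨e⟩ := lcoh_T h𝔞 i (jm i) (by simp)
    have : Subsingleton ((conc R R).X (jm i + 1)) := conc_subs _ (by rw [jm_eq]; omega)
    have : Subsingleton ((T ([] : List R) (conc R R)).H (jm i)) := by
      rw [← exact_iff_H]
      intro x
      exact ⟨fun _ => ⟨0, Subsingleton.elim (α := (conc R R).X (jm i + 1)) _ _⟩, fun _ => rfl⟩
    exact e.toEquiv.subsingleton
  · intro hs
    obtain ⟨e⟩ := lcoh_T h𝔞 0 (-1) (by rw [jm_eq]; simp)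
    have h2 : Subsingleton ((T ([] : List R) (conc R R)).H (-1)) := e.symm.toEquiv.subsingleton
    rw [← exact_iff_H] at h2
    obtain ⟨y, hy⟩ := (h2 (1 : R)).1 rfl
    exact one_ne_zero (α := R) hy.symm
end

end Part14
end PAux

namespace PAux
section Part15
open CategoryTheory Opposite Limits TensorProduct
section
variable {R : Type u} [CommRing R]

theorem sec_of_proj (D : Cx R) (i : ℤ) (he : Function.Exact (D.d i) (D.d (i + 1)))
    (hp : Module.Projective R (LinearMap.ker (D.d (i + 1)))) :
    ∃ s : LinearMap.ker (D.d (i + 1)) →ₗ[R] D.X i, ∀ x, D.d i (s x) = x.1 := by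
  obtain ⟨s, hs⟩ := Module.projective_lifting_property
    ((D.d i).codRestrict (LinearMap.ker (D.d (i + 1))) (fun x => D.dd i x)) LinearMap.id (by
      rintro ⟨x, hx⟩
      obtain ⟨y, hy⟩ := (he x).1 hx
      exact ⟨y, Subtype.ext hy⟩)
  exact ⟨s, fun x => congrArg Subtype.val (LinearMap.congr_fun hs x)⟩

theorem retr_of_sec (D : Cx R) (i : ℤ) (s : LinearMap.ker (D.d (i + 1)) →ₗ[R] D.X i)
    (hs : ∀ x, D.d i (s x) = x.1) :
    ∃ r : D.X i →ₗ[R] LinearMap.ker (D.d i), (∀ x, D.d i x = 0 → (r x).1 = x) := by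
  let v : D.X i →ₗ[R] D.X i := LinearMap.id - s.comp ((D.d i).codRestrict
    (LinearMap.ker (D.d (i + 1))) (fun x => D.dd i x))
  have hm : ∀ x, v x ∈ LinearMap.ker (D.d i) := by
    intro x
    rw [LinearMap.mem_ker, LinearMap.sub_apply, map_sub, LinearMap.comp_apply, hs]
    exact sub_self _
  refine ⟨LinearMap.codRestrict (LinearMap.ker (D.d i)) v hm, ?_⟩
  intro x hx
  change x - s _ = x
  have : (D.d i).codRestrict (LinearMap.ker (D.d (i + 1))) (fun x => D.dd i x) x = 0 :=
    Subtype.ext hx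
  rw [this, map_zero, sub_zero]

theorem ker_proj (D : Cx R) (hD : ∀ i, Module.Projective R (D.X i)) (a b : ℤ)
    (hb : ∀ i > b, Subsingleton (D.X i)) (he : ∀ i ≥ a, Function.Exact (D.d i) (D.d (i + 1)))
    (i : ℤ) (hi : a ≤ i) : Module.Projective R (LinearMap.ker (D.d i)) := by
  have key : ∀ k : ℕ, ∀ i : ℤ, b < i + k → a ≤ i → Module.Projective R (LinearMap.ker (D.d i)) := by
    intro k
    induction k with
    | zero =>
      intro i hbi _
      have := hb i (by simpa using hbi)
      infer_instance
    | succ k ih =>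
      intro i hbi hai
      obtain ⟨s, hs⟩ := sec_of_proj D i (he i hai) (ih (i + 1) (by push_cast at hbi; omega) (by omega))
      obtain ⟨r, hr⟩ := retr_of_sec D i s hs
      have := hD i
      exact Module.Projective.of_split (LinearMap.ker (D.d i)).subtype r
        (LinearMap.ext fun x => Subtype.ext (hr x.1 x.2))
  exact key (b + 1 - i).toNat i (by omega) hi

/-- projective tail -/
def PT (D : Cx R) (a : ℤ) : Prop :=
  (∀ i, Module.Projective R (D.X i)) ∧ (∀ i ≥ a, Function.Exact (D.d i) (D.d (i + 1))) ∧
    ∀ i ≥ a, Module.Projective R (LinearMap.ker (D.d i))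

theorem PT.reg {D : Cx R} {a : ℤ} (h : PT D a) (i : ℤ) (hi : a ≤ i) :
    ∃ k : D.X (i + 1) →ₗ[R] D.X i, ∀ x, D.d i (k (D.d i x)) = D.d i x := by
  obtain ⟨s, hs⟩ := sec_of_proj D i (h.2.1 i hi) (h.2.2 _ (by omega))
  obtain ⟨s', hs'⟩ := sec_of_proj D (i + 1) (h.2.1 _ (by omega)) (h.2.2 _ (by omega))
  obtain ⟨r, hr⟩ := retr_of_sec D (i + 1) s' hs'
  exact ⟨s.comp r, fun x => by rw [LinearMap.comp_apply, hs, hr _ (D.dd i x)]⟩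

variable {C : Type u} [AddCommGroup C] [Module R C]

theorem PT.tens {D : Cx R} {a : ℤ} (h : PT D a) (i : ℤ) (hi : a ≤ i) :
    Function.Exact ((D.d i).rTensor C) ((D.d (i + 1)).rTensor C) := by
  obtain ⟨k, hk⟩ := h.reg (i + 1) (by omega)
  have := h.1 (i + 1)
  obtain ⟨u, hu⟩ := Module.projective_lifting_property
    ((D.d i).codRestrict (LinearMap.ker (D.d (i + 1))) (fun x => D.dd i x))
    ((LinearMap.id - k.comp (D.d (i + 1))).codRestrict (LinearMap.ker (D.d (i + 1))) (fun x => by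
      rw [LinearMap.mem_ker, LinearMap.sub_apply, map_sub, LinearMap.comp_apply, hk]
      exact sub_self _)) (by
      rintro ⟨x, hx⟩
      obtain ⟨y, hy⟩ := (h.2.1 i hi x).1 hx
      exact ⟨y, Subtype.ext hy⟩)
  have hu' : (D.d i).comp u = LinearMap.id - k.comp (D.d (i + 1)) :=
    LinearMap.ext fun x => congrArg Subtype.val (LinearMap.congr_fun hu x)
  intro t
  constructor
  · intro ht
    refine ⟨u.rTensor C t, ?_⟩
    rw [← LinearMap.comp_apply, ← LinearMap.rTensor_comp, hu', LinearMap.rTensor_sub,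
      LinearMap.sub_apply, LinearMap.rTensor_comp, LinearMap.comp_apply, ht, map_zero, sub_zero,
      LinearMap.rTensor_id, LinearMap.id_apply]
  · rintro ⟨y, rfl⟩
    rw [← LinearMap.comp_apply, ← LinearMap.rTensor_comp]
    have : (D.d (i + 1)).comp (D.d i) = 0 := LinearMap.ext (D.dd i)
    rw [this, LinearMap.rTensor_zero, LinearMap.zero_apply]

theorem tens_comm {D E : Cx R} {e : ∀ i, (D.X i ⊗[R] C) ≃ₗ[R] E.X i}
    (he : ∀ i (t : D.X i) (c : C), e (i + 1) (D.d i t ⊗ₜ c) = E.d i (e i (t ⊗ₜ c))) (i : ℤ)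
    (τ : D.X i ⊗[R] C) : e (i + 1) ((D.d i).rTensor C τ) = E.d i (e i τ) := by
  induction τ with
  | zero => simp
  | add x y hx hy => simp only [map_add, hx, hy]
  | tmul t c => exact he i t c

theorem tens_exact_iff {D E : Cx R} (h : IsTens C D E) (i : ℤ) :
    Function.Exact (E.d i) (E.d (i + 1)) ↔
      Function.Exact ((D.d i).rTensor C) ((D.d (i + 1)).rTensor C) := by
  obtain ⟨e, he⟩ := h
  have hc := tens_comm he
  constructor
  · intro hx t
    rw [← (e (i + 1 + 1)).map_eq_zero_iff, hc, hx]
    constructor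
    · rintro ⟨y, hy⟩
      obtain ⟨y, rfl⟩ := (e i).surjective y
      exact ⟨y, (e (i + 1)).injective ((hc i y).trans hy)⟩
    · rintro ⟨y, rfl⟩
      exact ⟨e i y, (hc i y).symm⟩
  · intro hx t
    obtain ⟨t, rfl⟩ := (e (i + 1)).surjective t
    rw [← hc, (e (i + 1 + 1)).map_eq_zero_iff, hx]
    constructor
    · rintro ⟨y, rfl⟩
      exact ⟨e i y, (hc i y).symm⟩
    · rintro ⟨y, hy⟩
      obtain ⟨y, rfl⟩ := (e i).surjective y
      exact ⟨y, (e (i + 1)).injective ((hc i y).trans hy)⟩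

/-- Cohomology of the tensor product at the edge. -/
theorem PT.H_tens {D E : Cx R} {m : ℤ} (h : PT D (m + 1)) (hE : IsTens C D E) :
    Nonempty (E.H m ≃ₗ[R] (D.H m ⊗[R] C)) := by
  obtain ⟨e, he⟩ := hE
  have hc := tens_comm he
  obtain ⟨k, hk⟩ := h.reg (m + 1) le_rfl
  let P := LinearMap.ker (D.d (m + 1))
  let ι : P →ₗ[R] D.X (m + 1) := P.subtype
  let r : D.X (m + 1) →ₗ[R] P := (LinearMap.id - k.comp (D.d (m + 1))).codRestrict P (fun x => by
      rw [LinearMap.mem_ker, LinearMap.sub_apply, map_sub, LinearMap.comp_apply, hk]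
      exact sub_self _)
  have hrι : r.comp ι = LinearMap.id := LinearMap.ext fun x => Subtype.ext (by
    change x.1 - k (D.d (m + 1) x.1) = x.1
    have : D.d (m + 1) x.1 = 0 := x.2
    rw [this, map_zero, sub_zero])
  have hιr : ι.comp r = LinearMap.id - k.comp (D.d (m + 1)) := rfl
  have hιinj : Function.Injective (ι.rTensor C) := by
    intro a b hab
    have := congrArg (r.rTensor C) hab
    rwa [← LinearMap.comp_apply, ← LinearMap.comp_apply, ← LinearMap.rTensor_comp, hrι,
      LinearMap.rTensor_id] at this
  have hdι : (D.d (m + 1)).comp ι = 0 := LinearMap.ext fun x => x.2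
  let S : Submodule R P := (LinearMap.range (D.d m)).comap P.subtype
  let dm : D.X m →ₗ[R] P := (D.d m).codRestrict P (fun x => D.dd m x)
  have hex : Function.Exact dm S.mkQ := by
    intro x
    refine (Submodule.Quotient.mk_eq_zero S).trans ?_
    constructor
    · rintro ⟨y, hy⟩
      exact ⟨y, Subtype.ext hy⟩
    · rintro ⟨y, rfl⟩
      exact ⟨y, rfl⟩
  have hex' : Function.Exact (dm.rTensor C) (S.mkQ.rTensor C) := rTensor_exact C hex S.mkQ_surjective
  have hιdm : ι.comp dm = D.d m := rfl
  let S' : Submodule R (LinearMap.ker (E.d (m + 1))) :=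
    (LinearMap.range (E.d m)).comap (LinearMap.ker (E.d (m + 1))).subtype
  let w : (P ⊗[R] C) →ₗ[R] LinearMap.ker (E.d (m + 1)) :=
    ((e (m + 1)).toLinearMap.comp (ι.rTensor C)).codRestrict _ (fun x => by
      rw [LinearMap.mem_ker, LinearMap.comp_apply]
      refine (hc (m + 1) _).symm.trans ?_
      rw [← LinearMap.comp_apply, ← LinearMap.rTensor_comp, hdι, LinearMap.rTensor_zero,
        LinearMap.zero_apply, map_zero])
  refine equiv_of_surj (S'.mkQ.comp w) (S.mkQ.rTensor C) ?_ (LinearMap.rTensor_surjective C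
    S.mkQ_surjective) ?_
  · refine S'.mkQ_surjective.comp ?_
    rintro ⟨x, hx⟩
    obtain ⟨t, rfl⟩ := (e (m + 1)).surjective x
    have ht : (D.d (m + 1)).rTensor C t = 0 :=
      (e (m + 1 + 1)).map_eq_zero_iff.1 ((hc (m + 1) t).trans hx)
    refine ⟨r.rTensor C t, Subtype.ext ?_⟩
    change e (m + 1) (ι.rTensor C (r.rTensor C t)) = e (m + 1) t
    rw [← LinearMap.comp_apply, ← LinearMap.rTensor_comp, hιr, LinearMap.rTensor_sub,
      LinearMap.sub_apply, LinearMap.rTensor_comp, LinearMap.comp_apply, ht, map_zero, sub_zero,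
      LinearMap.rTensor_id, LinearMap.id_apply]
  · intro t
    rw [hex' t]
    refine (Submodule.Quotient.mk_eq_zero S' (x := w t)).trans ?_
    constructor
    · rintro ⟨y, hy⟩
      obtain ⟨y, rfl⟩ := (e m).surjective y
      refine ⟨y, hιinj ((e (m + 1)).injective ?_)⟩
      refine Eq.trans ?_ hy
      rw [← hc, ← LinearMap.comp_apply, ← LinearMap.rTensor_comp, hιdm]
    · rintro ⟨y, rfl⟩
      refine ⟨e m y, ?_⟩
      refine (hc m y).symm.trans ?_
      change _ = e (m + 1) (ι.rTensor C (dm.rTensor C y))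
      rw [← LinearMap.comp_apply (ι.rTensor C), ← LinearMap.rTensor_comp, hιdm]
end

end Part15
end PAux

namespace PAux
section Part16
open CategoryTheory Opposite Limits TensorProduct
section
variable {R : Type u} [CommRing R] {C : Type u} [AddCommGroup C] [Module R C]

theorem ext_lemma (D : Cx R) (hp : ∀ i, Module.Projective R (D.X i)) (m b : ℤ)
    (hb : ∀ i < b, Subsingleton (D.X i))
    (ht : ∀ i < m, Function.Exact ((D.d i).rTensor C) ((D.d (i + 1)).rTensor C)) (k : ℕ) :
    ∀ i ≤ m, i < b + k → ∀ L : ModuleCat.{u} R, LL C L → ∀ φ : D.X i →ₗ[R] L,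
      (∀ x, D.d i x = 0 → φ x = 0) → ∃ g : D.X (i + 1) →ₗ[R] L, ∀ x, g (D.d i x) = φ x := by
  induction k with
  | zero =>
    intro i _ hi L _ φ _
    have := hb i (by simpa using hi)
    refine ⟨0, fun x => ?_⟩
    rw [Subsingleton.elim x 0, map_zero, map_zero, map_zero]
  | succ k ih =>
    intro i him hi L hL φ hφ
    by_cases hik : i < b + k
    · exact ih i him hik L hL φ hφ
    obtain ⟨j, rfl⟩ : ∃ j, i = j + 1 := ⟨i - 1, by ring⟩
    push_cast at hi
    obtain ⟨-, X, π, ⟨I, hI, ⟨e⟩⟩, hπ, hLk⟩ := hL.unfold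
    have := hp (j + 1)
    obtain ⟨ψ, hψ⟩ := Module.projective_lifting_property π φ hπ
    have hψ' : ∀ x, π (ψ x) = φ x := LinearMap.congr_fun hψ
    let φ2 : D.X j →ₗ[R] LinearMap.ker π := (ψ.comp (D.d j)).codRestrict (LinearMap.ker π)
      (fun x => (hψ' _).trans (hφ _ (D.dd j x)))
    obtain ⟨g, hg⟩ := ih j (by omega) (by omega) _ hLk φ2 (by
      intro x hx
      refine Subtype.ext ?_
      change ψ (D.d j x) = 0
      rw [hx, map_zero])
    let g' : D.X (j + 1) →ₗ[R] LinearMap.ker π := g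
    let ψ2 : D.X (j + 1) →ₗ[R] X := ψ - (LinearMap.ker π).subtype.comp g'
    have h1 : ∀ x, π (ψ2 x) = φ x := by
      intro x
      have : π (g' x).1 = 0 := (g' x).2
      change π (ψ x - (g' x).1) = _
      rw [map_sub, this, sub_zero, hψ']
    have h2 : ∀ x, ψ2 (D.d j x) = 0 := by
      intro x
      change ψ (D.d j x) - (g' (D.d j x)).1 = 0
      have : g' (D.d j x) = φ2 x := hg x
      rw [this]
      exact sub_self _
    let u : D.X (j + 1) ⊗[R] C →ₗ[R] I := TensorProduct.lift (e.toLinearMap.comp ψ2)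
    obtain ⟨v, hv⟩ := inj_factor hI ((D.d (j + 1)).rTensor C) u (by
      intro t ht0
      obtain ⟨y, rfl⟩ := (ht j (by omega) t).1 ht0
      have : u.comp ((D.d j).rTensor C) = 0 := by
        apply TensorProduct.ext'
        intro x c
        change e (ψ2 (D.d j x)) c = 0
        rw [h2, map_zero, LinearMap.zero_apply]
      exact LinearMap.congr_fun this y)
    refine ⟨π.comp (e.symm.toLinearMap.comp (TensorProduct.curry v)), fun x => ?_⟩
    refine Eq.trans (congrArg π ?_) (h1 x)
    refine (e.symm_apply_eq).2 (LinearMap.ext fun c => ?_)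
    exact hv (x ⊗ₜ c)

theorem section_lemma (D : Cx R) (m b : ℤ) (h : PT D (m + 1))
    (hb : ∀ i < b, Subsingleton (D.X i))
    (ht : ∀ i < m, Function.Exact ((D.d i).rTensor C) ((D.d (i + 1)).rTensor C))
    (W : ModuleCat.{u} R) (p : W →ₗ[R] D.H m) (hp : Function.Surjective p)
    (hL : LL C (ModuleCat.of R (LinearMap.ker p))) :
    ∃ s : D.H m →ₗ[R] W, ∀ x, p (s x) = x := by
  let P := LinearMap.ker (D.d (m + 1))
  have : Module.Projective R P := h.2.2 _ le_rfl
  let S : Submodule R P := (LinearMap.range (D.d m)).comap P.subtype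
  let q : P →ₗ[R] D.H m := S.mkQ
  obtain ⟨σ, hσ⟩ := Module.projective_lifting_property p q hp
  have hσ' : ∀ x, p (σ x) = q x := LinearMap.congr_fun hσ
  let dm : D.X m →ₗ[R] P := (D.d m).codRestrict P (fun x => D.dd m x)
  have hq : ∀ x, q (dm x) = 0 := fun x => (Submodule.Quotient.mk_eq_zero S).2 ⟨x, rfl⟩
  let φ : D.X m →ₗ[R] LinearMap.ker p := (σ.comp dm).codRestrict (LinearMap.ker p)
    (fun x => (hσ' _).trans (hq x))
  obtain ⟨g, hg⟩ := ext_lemma (C := C) D h.1 m b hb ht (m + 1 - b).toNat m le_rfl (by omega) _ hL φ (by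
    intro x hx
    refine Subtype.ext ?_
    change σ (dm x) = 0
    have : dm x = 0 := Subtype.ext hx
    rw [this, map_zero])
  let g' : D.X (m + 1) →ₗ[R] LinearMap.ker p := g
  let σ2 : P →ₗ[R] W := σ - (LinearMap.ker p).subtype.comp (g'.comp P.subtype)
  obtain ⟨s, hs⟩ := surj_factor q S.mkQ_surjective σ2 (by
    intro x hx
    obtain ⟨y, hy⟩ := (Submodule.Quotient.mk_eq_zero S).1 hx
    have hxy : x = dm y := Subtype.ext hy.symm
    subst hxy
    change σ (dm y) - (g' (D.d m y)).1 = 0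
    have : g' (D.d m y) = φ y := hg y
    rw [this]
    exact sub_self _)
  refine ⟨s, fun x => ?_⟩
  obtain ⟨z, rfl⟩ := S.mkQ_surjective x
  refine (congrArg p (hs z)).trans ?_
  have h0 : p (g' z.1).1 = 0 := (g' z.1).2
  change p (σ z - (g' z.1).1) = _
  rw [map_sub, h0, sub_zero, hσ']

/-- Eventually injective kernels. -/
theorem ker_tail (D : Cx R) (hD : ∀ i, Module.Injective R (D.X i)) (t : ℕ) :
    ∀ a : ℤ, (∀ i ≥ a, Function.Exact (D.d i) (D.d (i + 1))) →
    HasInjectiveDimensionLT (ModuleCat.of R (LinearMap.ker (D.d a))) (t + 1) →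
    Module.Injective R (LinearMap.ker (D.d (a + t))) := by
  induction t with
  | zero =>
    intro a _ h
    rw [← ID_one]
    have h3 : a + ((0 : ℕ) : ℤ) = a := by simp
    rw [h3]
    exact h
  | succ t ih =>
    intro a he h
    have h1 : HasInjectiveDimensionLT (ModuleCat.of R (LinearMap.ker (D.d (a + 1)))) (t + 1) := by
      refine (ID_seq (LinearMap.ker (D.d a)).subtype ((D.d a).codRestrict
        (LinearMap.ker (D.d (a + 1))) (fun x => D.dd a x)) Subtype.val_injective ?_ ?_ (hD a) t).2 h
      · rintro ⟨x, hx⟩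
        obtain ⟨y, hy⟩ := (he a le_rfl x).1 hx
        exact ⟨y, Subtype.ext hy⟩
      · intro x
        constructor
        · intro hx
          exact ⟨⟨x, congrArg Subtype.val hx⟩, rfl⟩
        · rintro ⟨y, rfl⟩
          exact Subtype.ext y.2
    have h2 := ih (a + 1) (fun i hi => he i (by omega)) h1
    have h3 : a + ((t + 1 : ℕ) : ℤ) = a + 1 + t := by push_cast; ring
    rw [h3]
    exact h2

variable {K : Cores R C}

theorem step4_aux [IsNoetherianRing R] {l : List R} {𝔞 : Ideal R}
    (h𝔞 : 𝔞 = Ideal.span {x | x ∈ l}) (hK : ∀ n, Module.Injective R (K.J n))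
    (hC : SZ K C) (hb : Function.Bijective (fun r : R => (r • LinearMap.id : C →ₗ[R] C)))
    {n : ℕ} (h : Paper.IsRelCM R 𝔞 n R) (hG : Paper.GCinjDim R C (Paper.lcoh R 𝔞 n R) ≠ ⊤)
    (D : Cx R) (hDi : ∀ i, Module.Injective R (D.X i))
    (hB : (∀ i < jm n, Function.Exact (D.d i) (D.d (i + 1))) ∧
      ∀ i ≤ jm n, Module.Injective R (LinearMap.range (D.d i)))
    (hH : ∀ i j : ℤ, j = i + l.length → Nonempty ((T l (conc R C)).H i ≃ₗ[R] D.H j)) :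
    ∃ N : ℕ, ∀ j ≥ N, Function.Exact (D.d (j : ℤ)) (D.d ((j : ℤ) + 1)) ∧
      Module.Injective R (LinearMap.ker (D.d (j : ℤ))) := by
  obtain ⟨m, hm⟩ : ∃ m : ℤ, m = jm n - l.length := ⟨_, rfl⟩
  have hT := fun i hi => T_exact h𝔞 h i hi
  obtain ⟨e1⟩ := lcoh_T h𝔞 n m (by rw [hm]; ring)
  have hTC : IsTens C (T l (conc R R)) (T l (conc R C)) := (isTens_conc C).T l
  have hp : ∀ i, Module.Projective R ((T l (conc R R)).X i) := T_proj l _ conc_proj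
  have hbel : ∀ i < -(l.length : ℤ), Subsingleton ((T l (conc R R)).X i) := fun i hi =>
    T_below l _ 0 (fun j hj => conc_subs j hj.ne) _ (by omega)
  have hPT : PT (T l (conc R R)) (m + 1) := by
    refine ⟨hp, fun i hi => hT i (by omega), ker_proj _ hp (m + 1) 0 ?_ ?_⟩
    · exact fun i hi => T_above l _ 0 (fun j hj => conc_subs j hj.ne') i hi
    · exact fun i hi => hT i (by omega)
  have hDe : ∀ i > jm n, Function.Exact (D.d i) (D.d (i + 1)) := by
    intro i hi
    have h1 := (tens_exact_iff hTC (i - l.length)).2 (hPT.tens _ (by omega))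
    obtain ⟨e⟩ := hH (i - l.length) i (by ring)
    rw [exact_iff_H] at h1 ⊢
    exact e.symm.toEquiv.subsingleton
  have hlow : ∀ i < m, Function.Exact (((T l (conc R R)).d i).rTensor C)
      (((T l (conc R R)).d (i + 1)).rTensor C) := by
    intro i hi
    rw [← tens_exact_iff hTC]
    obtain ⟨e⟩ := hH i (i + l.length) rfl
    have := (exact_iff_H _ _).1 (hB.1 (i + l.length) (by omega))
    rw [exact_iff_H]
    exact e.toEquiv.subsingleton
  obtain ⟨g, hg⟩ := (coresDim_ne_top _).1 hG
  obtain ⟨W, k, p, hps, hL, hW⟩ := exists_LW (hCC_of hK hC) g _ hg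
  let p' : W →ₗ[R] (T l (conc R R)).H m := e1.toLinearMap.comp p
  have hpk : LinearMap.ker p = LinearMap.ker p' := by
    apply Submodule.ext
    intro x
    exact (e1.map_eq_zero_iff (x := p x)).symm
  obtain ⟨s, hs⟩ := section_lemma (C := C) (T l (conc R R)) m _ hPT hbel
    hlow W p' (e1.surjective.comp hps)
    (hL.of_equiv (B := ModuleCat.of R (LinearMap.ker p')) (LinearEquiv.ofEq _ _ hpk))
  obtain ⟨e2⟩ := hPT.H_tens hTC
  obtain ⟨e3⟩ := hH m (jm n) (by rw [hm]; ring)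
  let e4 : D.H (jm n) ≃ₗ[R] (C ⊗[R] (T l (conc R R)).H m) :=
    (e3.symm.trans e2).trans (TensorProduct.comm R _ _)
  have hID : HasInjectiveDimensionLT (ModuleCat.of R (D.H (jm n))) (k + 1) := by
    refine ID_retract ((s.lTensor C).comp e4.toLinearMap) (e4.symm.toLinearMap.comp (p'.lTensor C))
      ?_ _ (tens_fin hK hC hb k W hW).2
    have hps' : p'.comp s = LinearMap.id := LinearMap.ext hs
    refine LinearMap.ext fun x => ?_
    change e4.symm (p'.lTensor C (s.lTensor C (e4 x))) = x
    rw [← LinearMap.comp_apply, ← LinearMap.lTensor_comp, hps', LinearMap.lTensor_id,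
      LinearMap.id_apply, LinearEquiv.symm_apply_apply]
  have hID2 : HasInjectiveDimensionLT
      (ModuleCat.of R (LinearMap.ker (D.d (jm n + 1 + 1)))) (k + 1) :=
    (ID_seq (hin D (jm n)) (hout D (jm n)) (hin_inj D _) (hout_surj D _ (hDe _ (by omega)))
      (hin_hout D _) (quot_injective (hDi _) _ (hB.2 _ le_rfl)) k).2
      (hasInjectiveDimensionLT_of_ge _ (k + 1) _ (by omega))
  refine ⟨n + 1 + k, fun j hj => ⟨hDe j (by rw [jm_eq]; omega), ?_⟩⟩
  obtain ⟨t, rfl⟩ : ∃ t, j = n + 1 + t := ⟨j - (n + 1), by omega⟩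
  have := ker_tail D hDi t (jm n + 1 + 1) (fun i hi => hDe i (by omega))
    (hasInjectiveDimensionLT_of_ge _ (k + 1) _ (by omega))
  have h3 : ((n + 1 + t : ℕ) : ℤ) = jm n + 1 + 1 + t := by rw [jm_eq]; push_cast; ring
  rw [h3]
  exact this

theorem step4 [IsNoetherianRing R] {l : List R} {𝔞 : Ideal R}
    (h𝔞 : 𝔞 = Ideal.span {x | x ∈ l}) (hK : ∀ n, Module.Injective R (K.J n))
    (hC : SZ K C) (hb : Function.Bijective (fun r : R => (r • LinearMap.id : C →ₗ[R] C)))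
    {n : ℕ} (h : Paper.IsRelCM R 𝔞 n R) (hG : Paper.GCinjDim R C (Paper.lcoh R 𝔞 n R) ≠ ⊤) :
    ∃ N : ℕ, ∀ j ≥ N, Function.Exact ((gl l K.cx).d (j : ℤ)) ((gl l K.cx).d ((j : ℤ) + 1)) ∧
      Module.Injective R (LinearMap.ker ((gl l K.cx).d (j : ℤ))) :=
  step4_aux h𝔞 hK hC hb h hG (gl l K.cx) (gl_inj l hK) (lemB_gl h𝔞 hK hC hb h)
    (fun i j hij => H_tens l hK i j hij)

/-- Cocycles killed by `𝔞` are coboundaries in high degree. -/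
theorem step4b {l : List R} {𝔞 : Ideal R} (h𝔞 : 𝔞 = Ideal.span {x | x ∈ l}) (j : ℕ)
    (he : Function.Exact ((gl l K.cx).d (j : ℤ)) ((gl l K.cx).d ((j : ℤ) + 1)))
    (hi : Module.Injective R (LinearMap.ker ((gl l K.cx).d (j : ℤ))))
    {X : Type u} [AddCommGroup X] [Module R X] (hX : ∀ a ∈ 𝔞, ∀ x : X, a • x = 0)
    (f : X →ₗ[R] K.J (j + 1)) (hf : (K.d (j + 1)).comp f = 0) :
    ∃ g : X →ₗ[R] K.J j, (K.d j).comp g = f := by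
  let d0 : Gl l (K.J j) →ₗ[R] Gl l (K.J (j + 1)) := (gl l K.cx).d (j : ℤ)
  let d1 : Gl l (K.J (j + 1)) →ₗ[R] Gl l (K.J (j + 1 + 1)) := (gl l K.cx).d ((j + 1 : ℕ) : ℤ)
  have he' : Function.Exact d0 d1 := he
  have hd0 : ∀ x, (d0 x).1 = K.d j x.1 := fun x => rfl
  have hd1 : ∀ x, (d1 x).1 = K.d (j + 1) x.1 := fun x => rfl
  obtain ⟨s, hs⟩ := exists_section (d0.codRestrict (LinearMap.ker d1)
    (fun x => he'.apply_apply_eq_zero x)) (by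
      rintro ⟨x, hx⟩
      obtain ⟨y, hy⟩ := (he' x).1 hx
      exact ⟨y, Subtype.ext hy⟩) (by
      have : LinearMap.ker (d0.codRestrict (LinearMap.ker d1)
        (fun x => he'.apply_apply_eq_zero x)) = LinearMap.ker d0 := LinearMap.ker_codRestrict _ _ _
      rw [this]
      exact hi)
  have hfG : ∀ x, f x ∈ Gl l (K.J (j + 1)) := fun x => (Gl_pow h𝔞 (f x)).2 ⟨1, fun a ha => by
    rw [pow_one] at ha
    rw [← map_smul, hX a ha, map_zero]⟩
  let f1 : X →ₗ[R] LinearMap.ker d1 := (f.codRestrict (Gl l (K.J (j + 1))) hfG).codRestrict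
    (LinearMap.ker d1) (fun x => Subtype.ext (LinearMap.congr_fun hf x))
  refine ⟨(Gl l (K.J j)).subtype.comp (s.comp f1), LinearMap.ext fun x => ?_⟩
  exact congrArg (fun z => z.1.1) (hs (f1 x))
end

end Part16
end PAux

namespace PAux
section Part17
open CategoryTheory Opposite Limits TensorProduct
section
variable {R : Type u} [CommRing R] {C : Type u} [AddCommGroup C] [Module R C]

/-- multiplication by `a` on quotients -/
def qmul (I : Ideal R) (a : R) : (R ⧸ Submodule.comap (a • LinearMap.id : R →ₗ[R] R) I) →ₗ[R] (R ⧸ I) :=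
  Submodule.mapQ _ _ (a • LinearMap.id) le_rfl

/-- projection on quotients -/
def qpr (I : Ideal R) (a : R) : (R ⧸ I) →ₗ[R] (R ⧸ (I ⊔ Ideal.span {a})) :=
  Submodule.mapQ _ _ LinearMap.id le_sup_left

theorem qmul_inj (I : Ideal R) (a : R) : Function.Injective (qmul I a) := by
  rw [injective_iff_map_eq_zero]
  intro x hx
  obtain ⟨x, rfl⟩ := Submodule.mkQ_surjective _ x
  exact (Submodule.Quotient.mk_eq_zero _).2
    ((Submodule.Quotient.mk_eq_zero I (x := a • x)).1 hx)

theorem qpr_surj (I : Ideal R) (a : R) : Function.Surjective (qpr I a) := by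
  intro x
  obtain ⟨x, rfl⟩ := Submodule.mkQ_surjective _ x
  exact ⟨Submodule.Quotient.mk x, rfl⟩

theorem q_exact (I : Ideal R) (a : R) : Function.Exact (qmul I a) (qpr I a) := by
  intro x
  constructor
  · obtain ⟨x, rfl⟩ := Submodule.mkQ_surjective _ x
    intro hx
    have h1 : x ∈ I ⊔ Ideal.span {a} := (Submodule.Quotient.mk_eq_zero _).1 hx
    obtain ⟨y, hy, z, hz, rfl⟩ := Submodule.mem_sup.1 h1
    obtain ⟨r, rfl⟩ := Ideal.mem_span_singleton'.1 hz
    refine ⟨Submodule.Quotient.mk r, ?_⟩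
    refine (Submodule.Quotient.eq I (x := a • r) (y := y + r * a)).2 ?_
    have : a • r - (y + r * a) = -y := by simp only [smul_eq_mul]; ring
    rw [this]
    exact neg_mem hy
  · rintro ⟨y, rfl⟩
    obtain ⟨y, rfl⟩ := Submodule.mkQ_surjective _ y
    refine (Submodule.Quotient.mk_eq_zero (I ⊔ Ideal.span {a}) (x := a • y)).2 ?_
    exact Submodule.mem_sup_right (Ideal.mem_span_singleton'.2 ⟨y, mul_comm _ _⟩)

theorem ext_mid (I : Ideal R) (a : R) (k : ℕ)
    (h1 : Subsingleton (Abelian.Ext.{u}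
      (ModuleCat.of R (R ⧸ Submodule.comap (a • LinearMap.id : R →ₗ[R] R) I)) (ModuleCat.of R C) k))
    (h2 : Subsingleton (Abelian.Ext.{u}
      (ModuleCat.of R (R ⧸ (I ⊔ Ideal.span {a}))) (ModuleCat.of R C) k)) :
    Subsingleton (Abelian.Ext.{u} (ModuleCat.of R (R ⧸ I)) (ModuleCat.of R C) k) := by
  have h := ModuleCat.shortComplex_shortExact
    (ModuleCat.shortComplexOfCompEqZero (qmul I a) (qpr I a) (q_exact I a).linearMap_comp_eq_zero)
    (q_exact I a) (qmul_inj I a) (qpr_surj I a)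
  have key : ∀ x : Abelian.Ext.{u} (ModuleCat.of R (R ⧸ I)) (ModuleCat.of R C) k, x = 0 := by
    intro x
    obtain ⟨y, hy⟩ := Abelian.Ext.contravariant_sequence_exact₂ h (ModuleCat.of R C) x
      (h1.elim _ _)
    rw [← hy, h2.elim y 0]
    simp
  exact ⟨fun x y => (key x).trans (key y).symm⟩

theorem comap_prime {p : Ideal R} (hp : p.IsPrime) {a : R} (ha : a ∉ p) :
    Submodule.comap (a • LinearMap.id : R →ₗ[R] R) p = p := by
  apply Submodule.ext
  intro x
  constructor
  · intro hx
    exact (hp.mem_or_mem (x := a) (y := x) hx).resolve_left ha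
  · intro hx
    exact p.mul_mem_left a hx

theorem ext_prime [IsNoetherianRing R] [IsLocalRing R] [Module.Finite R C]
    {p : Ideal R} (hp : p.IsPrime) {a : R} (ha : a ∉ p)
    (ham : a ∈ IsLocalRing.maximalIdeal R) (k : ℕ)
    (h2 : Subsingleton (Abelian.Ext.{u}
      (ModuleCat.of R (R ⧸ (p ⊔ Ideal.span {a}))) (ModuleCat.of R C) (k + 1))) :
    Subsingleton (Abelian.Ext.{u} (ModuleCat.of R (R ⧸ p)) (ModuleCat.of R C) k) := by
  have hcm := comap_prime hp ha
  let μ : (R ⧸ p) →ₗ[R] (R ⧸ p) := a • LinearMap.id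
  have hμ : Function.Injective μ := by
    rw [injective_iff_map_eq_zero]
    intro x hx
    obtain ⟨x, rfl⟩ := Submodule.mkQ_surjective _ x
    have : a • x ∈ p := (Submodule.Quotient.mk_eq_zero p (x := a • x)).1 hx
    exact (Submodule.Quotient.mk_eq_zero _).2 ((hp.mem_or_mem (x := a) (y := x) this).resolve_left ha)
  have hex : Function.Exact μ (qpr p a) := by
    intro x
    rw [q_exact p a x]
    constructor
    · rintro ⟨y, rfl⟩
      obtain ⟨y, rfl⟩ := Submodule.mkQ_surjective _ y
      exact ⟨Submodule.Quotient.mk y, rfl⟩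
    · rintro ⟨y, rfl⟩
      obtain ⟨y, rfl⟩ := Submodule.mkQ_surjective _ y
      exact ⟨Submodule.Quotient.mk y, rfl⟩
  have h := ModuleCat.shortComplex_shortExact
    (ModuleCat.shortComplexOfCompEqZero μ (qpr p a) hex.linearMap_comp_eq_zero)
    hex hμ (qpr_surj p a)
  have key : ∀ x : Abelian.Ext.{u} (ModuleCat.of R (R ⧸ p)) (ModuleCat.of R C) k,
      ∃ y : Abelian.Ext.{u} (ModuleCat.of R (R ⧸ p)) (ModuleCat.of R C) k, a • y = x := by
    intro x
    obtain ⟨y, hy⟩ := Abelian.Ext.contravariant_sequence_exact₁ h (ModuleCat.of R C) x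
      (n₁ := k + 1) (add_comm 1 k) (h2.elim _ _)
    refine ⟨y, ?_⟩
    rw [← hy]
    have e1 : ModuleCat.ofHom μ = a • 𝟙 (ModuleCat.of R (R ⧸ p)) := rfl
    change _ = (Abelian.Ext.mk₀ (ModuleCat.ofHom μ)).comp y (zero_add k)
    rw [e1, Abelian.Ext.mk₀_smul, Abelian.Ext.smul_comp, Abelian.Ext.mk₀_id_comp]
  have hfin : Module.Finite R (Abelian.Ext.{u} (ModuleCat.of R (R ⧸ p)) (ModuleCat.of R C) k) :=
    inferInstance
  have hbot := Submodule.eq_bot_of_le_smul_of_le_jacobson_bot (IsLocalRing.maximalIdeal R)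
    (⊤ : Submodule R (Abelian.Ext.{u} (ModuleCat.of R (R ⧸ p)) (ModuleCat.of R C) k))
    hfin.1 (by
      intro x _
      obtain ⟨y, rfl⟩ := key x
      exact Submodule.smul_mem_smul ham trivial) (IsLocalRing.maximalIdeal_le_jacobson _)
  exact (Submodule.subsingleton_iff R).1 (subsingleton_of_bot_eq_top hbot.symm)

theorem ext_all [IsNoetherianRing R] [IsLocalRing R] [Module.Finite R C]
    (𝔞 : Ideal R) (h𝔞 : 𝔞 ≠ ⊤) (N : ℕ)
    (h : ∀ k ≥ N, ∀ I : Ideal R, 𝔞 ≤ I →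
      Subsingleton (Abelian.Ext.{u} (ModuleCat.of R (R ⧸ I)) (ModuleCat.of R C) k)) (I : Ideal R) :
    ∀ k ≥ N, Subsingleton (Abelian.Ext.{u} (ModuleCat.of R (R ⧸ I)) (ModuleCat.of R C) k) := by
  induction I using WellFoundedGT.induction with
  | ind I ih =>
    intro k hk
    by_cases hI : 𝔞 ≤ I
    · exact h k hk I hI
    have lt1 : ∀ a ∉ I, I < I ⊔ Ideal.span {a} := fun a ha =>
      lt_of_le_of_ne le_sup_left fun he => ha (by
        rw [he]; exact Submodule.mem_sup_right (Ideal.mem_span_singleton_self a))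
    by_cases hp : I.IsPrime
    · obtain ⟨a, ha, haI⟩ := SetLike.not_le_iff_exists.1 hI
      exact ext_prime hp haI (IsLocalRing.le_maximalIdeal h𝔞 ha) k
        (ih _ (lt1 a haI) (k + 1) (by omega))
    · have hne : I ≠ ⊤ := fun he => hI (he ▸ le_top)
      obtain ⟨a, ha, b, hb, hab⟩ := (Ideal.not_isPrime_iff.1 hp).resolve_left hne
      refine ext_mid I a k (ih _ ?_ k hk) (ih _ (lt1 a ha) k hk)
      refine lt_of_le_of_ne (fun x hx => I.mul_mem_left a hx) fun he => hb ?_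
      rw [he]
      exact hab

theorem ker_baer {K : Cores R C} (hK : ∀ n, Module.Injective R (K.J n)) (N : ℕ)
    (h : ∀ I : Ideal R, ∀ f : (R ⧸ I) →ₗ[R] K.J (N + 1), (K.d (N + 1)).comp f = 0 →
      ∃ g : (R ⧸ I) →ₗ[R] K.J N, (K.d N).comp g = f) :
    Module.Injective R (LinearMap.ker (K.d N)) := by
  rw [← Module.Baer.iff_injective]
  intro I g
  obtain ⟨e, he⟩ := inj_factor (hK N) I.subtype ((LinearMap.ker (K.d N)).subtype.comp g) (by
    intro a ha
    rw [show a = 0 from Subtype.ext ha, map_zero])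
  have hk0 : ∀ x ∈ I, K.d N (e x) = 0 := by
    intro x hx
    exact (congrArg (K.d N) (he ⟨x, hx⟩)).trans (g ⟨x, hx⟩).2
  obtain ⟨f, hf⟩ := surj_factor (Submodule.mkQ I) (Submodule.mkQ_surjective I) ((K.d N).comp e) (by
    intro a ha
    exact hk0 a ((Submodule.Quotient.mk_eq_zero I).1 ha))
  obtain ⟨w, hw⟩ := h I f (by
    refine LinearMap.ext fun x => ?_
    obtain ⟨x, rfl⟩ := Submodule.mkQ_surjective I x
    exact (congrArg (K.d (N + 1)) (hf x)).trans ((K.ex N).apply_apply_eq_zero _))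
  let v : R →ₗ[R] K.J N := e - w.comp (Submodule.mkQ I)
  refine ⟨v.codRestrict (LinearMap.ker (K.d N)) (fun x => ?_), fun x hx => Subtype.ext ?_⟩
  · rw [LinearMap.mem_ker]
    change K.d N (e x - w (Submodule.mkQ I x)) = 0
    rw [map_sub]
    have h1 : K.d N (w (Submodule.mkQ I x)) = f (Submodule.mkQ I x) := LinearMap.congr_fun hw _
    rw [h1, hf]
    exact sub_self _
  · change e x - w (Submodule.mkQ I x) = _
    have h1 : Submodule.mkQ I x = 0 := (Submodule.Quotient.mk_eq_zero I).2 hx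
    rw [h1, map_zero, sub_zero]
    exact he ⟨x, hx⟩

theorem injDim_of_ker {K : Cores R C} (hK : ∀ n, Module.Injective R (K.J n)) (N : ℕ)
    (h : Module.Injective R (LinearMap.ker (K.d N))) : Paper.injDim R C ≠ ⊤ := by
  refine (coresDim_ne_top _).2 ⟨N, ?_⟩
  have hP : ∀ X Y : ModuleCat.{u} R, Nonempty (X ≃ₗ[R] Y) → Module.Injective R X →
    Module.Injective R Y := fun X Y ⟨e⟩ h => injective_of_equiv e h
  have h1 := tailG hP K.cx N 0 N (by simp) (by
    intro i hi
    obtain ⟨j, rfl⟩ := Int.eq_ofNat_of_zero_le hi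
    exact K.ex j) (fun i _ => cx_inj hK i) h
  refine coresDim_equiv hP N _ _ ⟨?_⟩ h1
  refine (LinearEquiv.ofBijective (K.i.codRestrict (LinearMap.ker (K.d 0))
      (fun x => K.e0.apply_apply_eq_zero x)) ⟨?_, ?_⟩).symm
  · intro x y hxy
    exact K.hi (congrArg Subtype.val hxy)
  · rintro ⟨x, hx⟩
    obtain ⟨y, hy⟩ := (K.e0 x).1 hx
    exact ⟨y, Subtype.ext hy⟩

theorem iii_i [IsNoetherianRing R] [IsLocalRing R] (E : InjectiveResolution (ModuleCat.of R C))
    (hC : SZ (coresOf E) C)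
    (hb : Function.Bijective (fun r : R => (r • LinearMap.id : C →ₗ[R] C)))
    (𝔞 : Ideal R) (n : ℕ) (h𝔞 : 𝔞 ≠ ⊤) (h : Paper.IsRelCM R 𝔞 n R)
    (hG : Paper.GCinjDim R C (Paper.lcoh R 𝔞 n R) ≠ ⊤) : Paper.injDim R C ≠ ⊤ := by
  have := hC.1
  have hK := coresOf_inj E
  obtain ⟨S, hS⟩ := IsNoetherian.noetherian 𝔞
  have h𝔞l : 𝔞 = Ideal.span {x | x ∈ S.toList} := by simp [← hS]
  obtain ⟨N, hN⟩ := step4 h𝔞l hK hC hb h hG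
  have key : ∀ k ≥ N + 1, ∀ I : Ideal R, 𝔞 ≤ I →
      Subsingleton (Abelian.Ext.{u} (ModuleCat.of R (R ⧸ I)) (ModuleCat.of R C) k) := by
    intro k hk I hI
    obtain ⟨j, rfl⟩ : ∃ j, k = j + 1 := ⟨k - 1, by omega⟩
    rw [ext_subs_iff E]
    intro f hf
    obtain ⟨h1, h2⟩ := hN j (by omega)
    refine step4b h𝔞l j h1 h2 ?_ f hf
    intro a ha x
    obtain ⟨x, rfl⟩ := Submodule.mkQ_surjective I x
    exact (Submodule.Quotient.mk_eq_zero I (x := a • x)).2 (I.mul_mem_right x (hI ha))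
  have key2 := ext_all 𝔞 h𝔞 (N + 1) key
  exact injDim_of_ker hK N (ker_baer hK N fun I => (ext_subs_iff E (R ⧸ I) N).1 (key2 I _ le_rfl))

theorem main_thm [IsNoetherianRing R] [IsLocalRing R] (hC : Paper.IsSemidualizing R C) :
    ((Paper.injDim R C ≠ ⊤ ↔
        ∀ (𝔞 : Ideal R) (n : ℕ), 𝔞 ≠ ⊤ → Paper.IsRelCM R 𝔞 n R →
          Paper.GCinjDim R C (Paper.lcoh R 𝔞 n R) ≠ ⊤) ∧
     ((∀ (𝔞 : Ideal R) (n : ℕ), 𝔞 ≠ ⊤ → Paper.IsRelCM R 𝔞 n R →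
          Paper.GCinjDim R C (Paper.lcoh R 𝔞 n R) ≠ ⊤) ↔
        ∃ (𝔞 : Ideal R) (n : ℕ), 𝔞 ≠ ⊤ ∧ Paper.IsRelCM R 𝔞 n R ∧
          Paper.GCinjDim R C (Paper.lcoh R 𝔞 n R) ≠ ⊤)) := by
  let E := injectiveResolution (ModuleCat.of R C)
  have hSZ : SZ (coresOf E) C := ⟨hC.1, fun n f hf =>
    (ext_subs_iff E C n).1 (ext_subs_paper C (n + 1) (hC.2.2 (n + 1) (by omega))) f hf⟩
  have h12 := fun hd 𝔞 n (_ : 𝔞 ≠ ⊤) h => i_ii (coresOf_inj E) hSZ hC.2.1 hd 𝔞 n h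
  have h23 : (∀ (𝔞 : Ideal R) (n : ℕ), 𝔞 ≠ ⊤ → Paper.IsRelCM R 𝔞 n R →
          Paper.GCinjDim R C (Paper.lcoh R 𝔞 n R) ≠ ⊤) →
        ∃ (𝔞 : Ideal R) (n : ℕ), 𝔞 ≠ ⊤ ∧ Paper.IsRelCM R 𝔞 n R ∧
          Paper.GCinjDim R C (Paper.lcoh R 𝔞 n R) ≠ ⊤ :=
    fun h => ⟨⊥, 0, bot_ne_top, relCM_bot, h ⊥ 0 bot_ne_top relCM_bot⟩
  have h31 : (∃ (𝔞 : Ideal R) (n : ℕ), 𝔞 ≠ ⊤ ∧ Paper.IsRelCM R 𝔞 n R ∧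
          Paper.GCinjDim R C (Paper.lcoh R 𝔞 n R) ≠ ⊤) → Paper.injDim R C ≠ ⊤ := by
    rintro ⟨𝔞, n, h𝔞, h, hG⟩
    exact iii_i E hSZ hC.2.1 𝔞 n h𝔞 h hG
  exact ⟨⟨h12, fun h => h31 (h23 h)⟩, ⟨h23, fun h => h12 (h31 h)⟩⟩
end

end Part17
end PAux

open Paper IsLocalRing

/-- **Proposition 3.5.** Let `C` be a semidualizing module over a Noetherian local ring
`R`. Then `C` is dualizing iff `Gid_C H^n_𝔞(R)` is finite for all proper ideals `𝔞` such
that `R` is relative Cohen-Macaulay with respect to `𝔞` with `ht_R 𝔞 = n`, iff the same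
holds for some such ideal. -/
theorem isDualizing_iff_GCinjDim_localCohomology
    (R : Type u) [CommRing R] [IsNoetherianRing R] [IsLocalRing R]
    (C : Type u) [AddCommGroup C] [Module R C] (hC : IsSemidualizing R C) :
    ((injDim R C ≠ ⊤ ↔
        ∀ (𝔞 : Ideal R) (n : ℕ), 𝔞 ≠ ⊤ → IsRelCM R 𝔞 n R →
          GCinjDim R C (lcoh R 𝔞 n R) ≠ ⊤) ∧
     ((∀ (𝔞 : Ideal R) (n : ℕ), 𝔞 ≠ ⊤ → IsRelCM R 𝔞 n R →
          GCinjDim R C (lcoh R 𝔞 n R) ≠ ⊤) ↔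
        ∃ (𝔞 : Ideal R) (n : ℕ), 𝔞 ≠ ⊤ ∧ IsRelCM R 𝔞 n R ∧
          GCinjDim R C (lcoh R 𝔞 n R) ≠ ⊤)) := by
  exact PAux.main_thm hC
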